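/- arXiv:1907.11535 — 3 statements merged into one kernel-verified Lean document; each statement's English description precedes it below -/
import Mathlib

section
/- Let u be a time-global classical solution of problem (B) whose initial data u0 ∈ C^1([-1,1]) satisfies: u0 is even, 1 ≤ u0(x) ≤ M0 on [-1,1], 0 < u0'(x) < tan(πx/2) for x ∈ (0,1), and u0'(1) = u0(1). Then for every t > 0 and every x ∈ (0,1): 0 < u_x(x,t) < tan(πx/2) and -tan(πx/2) < u_x(-x,t) < 0. -/
open Real

/-- Partial derivative in `x` of a function `u(x,t)`. -/
noncomputable def ux (u : ℝ → ℝ → ℝ) (x t : ℝ) : ℝ := deriv (fun y => u y t) x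

/-- Second partial derivative in `x` of a function `u(x,t)`. -/
noncomputable def uxx (u : ℝ → ℝ → ℝ) (x t : ℝ) : ℝ := deriv (fun y => ux u y t) x

/-- Partial derivative in `t` of a function `u(x,t)`. -/
noncomputable def ut (u : ℝ → ℝ → ℝ) (x t : ℝ) : ℝ := deriv (fun s => u x s) t

/-- A time-global classical solution of problem (B) with initial data `u0`:
`u` and `u_x` are continuous on `[-1,1] × [0,∞)`, `u` is `C^{2,1}` in
`(-1,1) × (0,∞)` where it satisfies `u_t = u_xx/(1+u_x²)`, with boundary
conditions `u_x(±1,t) = ±u(±1,t)` for `t > 0` and initial condition `u(·,0) = u0`. -/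
def IsGlobalSolB (u : ℝ → ℝ → ℝ) (u0 : ℝ → ℝ) : Prop :=
  ContinuousOn (fun p : ℝ × ℝ => u p.1 p.2) (Set.Icc (-1 : ℝ) 1 ×ˢ Set.Ici (0 : ℝ)) ∧
  ContinuousOn (fun p : ℝ × ℝ => ux u p.1 p.2) (Set.Icc (-1 : ℝ) 1 ×ˢ Set.Ici (0 : ℝ)) ∧
  (∀ t > (0 : ℝ), ∀ x ∈ Set.Ioo (-1 : ℝ) 1,
    DifferentiableAt ℝ (fun y => u y t) x ∧
    DifferentiableAt ℝ (fun y => ux u y t) x ∧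
    DifferentiableAt ℝ (fun s => u x s) t ∧
    ut u x t = uxx u x t / (1 + ux u x t ^ 2)) ∧
  (∀ t > (0 : ℝ), ux u 1 t = u 1 t ∧ ux u (-1) t = - u (-1) t) ∧
  (∀ x ∈ Set.Icc (-1 : ℝ) 1, u x 0 = u0 x)


open Set Filter Topology

lemma aux_first_touch {X : Type*} [TopologicalSpace X] [T2Space X] (K : Set X) (hK : IsCompact K)
    (T : ℝ) (Z : X → ℝ → ℝ)
    (hc : ContinuousOn (fun p : X × ℝ => Z p.1 p.2) (K ×ˢ Set.Icc 0 T))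
    (h0 : ∀ z ∈ K, Z z 0 < 0)
    (hno : ∀ z ∈ K, ∀ t ∈ Set.Ioc 0 T, Z z t = 0 → (∀ z' ∈ K, Z z' t ≤ 0) →
      (∀ s ∈ Set.Ico 0 t, ∀ z' ∈ K, Z z' s < 0) → False) :
    ∀ z ∈ K, ∀ t ∈ Set.Icc 0 T, Z z t < 0 := by
  by_contra hcon
  push Not at hcon
  obtain ⟨z1, hz1, t1, ht1, hZ1⟩ := hcon
  set S : Set (X × ℝ) := (K ×ˢ Set.Icc 0 T) ∩ (fun p : X × ℝ => Z p.1 p.2) ⁻¹' Set.Ici 0 with hS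
  have hKc : IsCompact (K ×ˢ Set.Icc (0:ℝ) T) := hK.prod isCompact_Icc
  have hScl : IsClosed S := hc.preimage_isClosed_of_isClosed hKc.isClosed isClosed_Ici
  have hSc : IsCompact S := hKc.of_isClosed_subset hScl Set.inter_subset_left
  have hne : S.Nonempty := ⟨(z1, t1), ⟨hz1, ht1⟩, hZ1⟩
  obtain ⟨⟨z, t⟩, hzt, hmin⟩ := hSc.exists_isMinOn hne (continuous_snd.continuousOn)
  obtain ⟨⟨hz, ht⟩, hZ⟩ := hzt
  simp only [Set.mem_preimage, Set.mem_Ici] at hZ hz ht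
  have hlt : ∀ s ∈ Set.Ico 0 t, ∀ z' ∈ K, Z z' s < 0 := by
    intro s hs z' hz'
    by_contra hge
    push Not at hge
    have : (z', s) ∈ S := ⟨⟨hz', hs.1, hs.2.le.trans ht.2⟩, hge⟩
    have := hmin this
    simp at this
    linarith [hs.2]
  have htpos : 0 < t := by
    rcases ht.1.lt_or_eq with h | h
    · exact h
    · rw [← h] at hZ
      exact absurd (h0 z hz) (not_lt.mpr hZ)
  have hle : ∀ z' ∈ K, Z z' t ≤ 0 := by
    intro z' hz'
    have h1 : ContinuousWithinAt (fun s => Z z' s) (Set.Icc 0 T) t := by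
      have := hc (z', t) ⟨hz', ht⟩
      exact ContinuousWithinAt.comp (f := fun s : ℝ => (z', s)) (x := t) this
        (by fun_prop) (fun s hs => ⟨hz', hs⟩)
    have h2 : Tendsto (fun s => Z z' s) (𝓝[Set.Ico 0 t] t) (𝓝 (Z z' t)) :=
      h1.mono_left (nhdsWithin_mono _ (fun s hs => ⟨hs.1, hs.2.le.trans ht.2⟩))
    have hnb : (𝓝[Set.Ico 0 t] t).NeBot := by
      rw [← mem_closure_iff_nhdsWithin_neBot, closure_Ico htpos.ne]
      exact ⟨htpos.le, le_rfl⟩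
    refine le_of_tendsto h2 ?_
    filter_upwards [self_mem_nhdsWithin] with s hs
    exact (hlt s hs z' hz').le
  exact hno z hz t ⟨htpos, ht.2⟩ (le_antisymm (hle z hz) hZ) hle hlt

/-- one-sided derivative test from the left -/
lemma aux_left {f : ℝ → ℝ} {d b y : ℝ} (hy : y < b) (hd : HasDerivWithinAt f d (Set.Iic b) b)
    (h : ∀ x ∈ Set.Ioo y b, f b ≤ f x) : d ≤ 0 := by
  have h1 := (hd.mono Set.Iio_subset_Iic_self)
  rw [hasDerivWithinAt_iff_tendsto_slope' (by simp)] at h1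
  refine le_of_tendsto h1 ?_
  filter_upwards [Ioo_mem_nhdsLT hy] with x hx
  rw [slope_def_field]
  exact div_nonpos_of_nonneg_of_nonpos (by linarith [h x hx]) (by linarith [hx.2])

lemma aux_left' {f : ℝ → ℝ} {d b y : ℝ} (hy : y < b) (hd : HasDerivWithinAt f d (Set.Iic b) b)
    (h : ∀ x ∈ Set.Ioo y b, f x ≤ f b) : 0 ≤ d := by
  have := aux_left hy hd.neg (fun x hx => by simpa using h x hx)
  linarith

lemma aux_right {f : ℝ → ℝ} {d b y : ℝ} (hy : b < y) (hd : HasDerivWithinAt f d (Set.Ici b) b)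
    (h : ∀ x ∈ Set.Ioo b y, f x ≤ f b) : d ≤ 0 := by
  have h1 := (hd.mono Set.Ioi_subset_Ici_self)
  rw [hasDerivWithinAt_iff_tendsto_slope' (by simp)] at h1
  refine le_of_tendsto h1 ?_
  filter_upwards [Ioo_mem_nhdsGT hy] with x hx
  rw [slope_def_field]
  exact div_nonpos_of_nonpos_of_nonneg (by linarith [h x hx]) (by linarith [hx.1])

lemma aux_right' {f : ℝ → ℝ} {d b y : ℝ} (hy : b < y) (hd : HasDerivWithinAt f d (Set.Ici b) b)
    (h : ∀ x ∈ Set.Ioo b y, f b ≤ f x) : 0 ≤ d := by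
  have := aux_right hy hd.neg (fun x hx => by simpa using h x hx)
  linarith

lemma aux_second {f f' : ℝ → ℝ} {x0 f'' : ℝ} (h1 : ∀ᶠ x in 𝓝 x0, HasDerivAt f (f' x) x)
    (h2 : HasDerivAt f' f'' x0) (hmax : IsLocalMax f x0) : f' x0 = 0 ∧ f'' ≤ 0 := by
  have h0 : f' x0 = 0 := hmax.hasDerivAt_eq_zero h1.self_of_nhds
  refine ⟨h0, ?_⟩
  by_contra hpos
  push Not at hpos
  have he : deriv f =ᶠ[𝓝 x0] f' := h1.mono fun x hx => hx.deriv
  have hdd : deriv (deriv f) x0 = f'' := by rw [he.deriv_eq, h2.deriv]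
  have hmin : IsLocalMin f x0 := isLocalMin_of_deriv_deriv_pos (by rw [hdd]; exact hpos)
    (by rw [he.self_of_nhds, h0]) h1.self_of_nhds.continuousAt
  have hconst : f =ᶠ[𝓝 x0] fun _ => f x0 := by
    filter_upwards [hmin, hmax] with x hx hx'
    exact le_antisymm hx' hx
  have hd : deriv f =ᶠ[𝓝 x0] fun _ => 0 := by
    have := hconst.deriv
    simpa using this
  have : deriv (deriv f) x0 = 0 := by rw [hd.deriv_eq]; simp
  linarith

lemma aux_second' {f f' : ℝ → ℝ} {x0 f'' : ℝ} (h1 : ∀ᶠ x in 𝓝 x0, HasDerivAt f (f' x) x)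
    (h2 : HasDerivAt f' f'' x0) (hmin : IsLocalMin f x0) : f' x0 = 0 ∧ 0 ≤ f'' := by
  have := aux_second (f := fun x => - f x) (f' := fun x => - f' x) (h1.mono fun x hx => hx.neg)
    h2.neg hmin.neg
  constructor <;> linarith [this.1, this.2]

/-- the algebra behind the comparison argument -/
lemma aux_sqrt_lip (p q : ℝ) :
    (1 / √(1 + p ^ 2) - 1 / √(1 + q ^ 2)) ^ 2 ≤ (p + q) ^ 2 := by
  set R := √(1 + p ^ 2) with hR
  set S := √(1 + q ^ 2) with hS
  have hR2 : R ^ 2 = 1 + p ^ 2 := Real.sq_sqrt (by positivity)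
  have hS2 : S ^ 2 = 1 + q ^ 2 := Real.sq_sqrt (by positivity)
  have hR0 : 0 < R := Real.sqrt_pos.mpr (by positivity)
  have hS0 : 0 < S := Real.sqrt_pos.mpr (by positivity)
  have h1 : 1 - p * q ≤ R * S := by
    apply le_of_sq_le_sq _ (by positivity)
    rw [mul_pow, hR2, hS2]
    nlinarith [sq_nonneg (p + q)]
  have h2 : (R - S) ^ 2 ≤ (p + q) ^ 2 := by nlinarith
  have h3 : 1 ≤ (R * S) ^ 2 := by
    rw [mul_pow, hR2, hS2]; nlinarith [sq_nonneg p, sq_nonneg q, sq_nonneg (p * q)]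
  have h4 : (1 / R - 1 / S) ^ 2 = (R - S) ^ 2 / (R * S) ^ 2 := by
    field_simp
    ring
  rw [h4]
  calc (R - S) ^ 2 / (R * S) ^ 2 ≤ (R - S) ^ 2 / 1 := by gcongr
    _ ≤ _ := by simpa using h2

set_option maxHeartbeats 4000000 in
/-- pure algebra for the doubling argument -/
lemma aux_algebra (K C D1 D2 lam x y u1 u2 P1 P2 X1 X2 r1 r2 e : ℝ) (hK : 0 ≤ K)
    (hC : C = 13 * K ^ 2 + 1)
    (hD1 : D1 = (23 * K ^ 2 + C + 1) / 2)
    (hD2 : D2 = (20 * K ^ 2 + 1 + 2 * D1) / 2)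
    (hlam : lam = D2 ^ 2 + 2 + 4 * (1 + 2 * K) * D2 + 20 * K ^ 2 + 2 * D1 + 4 * K * D2)
    (he : 0 < e) (hx : |x| ≤ 1) (hy : |y| ≤ 1)
    (hu2 : |u2| ≤ K) (hP2 : |P2| ≤ K)
    (hr1 : r1 = 1 / √(1 + P1 ^ 2)) (hr2 : r2 = 1 / √(1 + P2 ^ 2))
    (h0 : (3 - x ^ 2) * u1 - (3 - y ^ 2) * u2 = (x + y) ^ 2 / (2 * e) + e * (C + x ^ 2 / 2))
    (hpx : (3 - x ^ 2) * P1 - 2 * x * u1 = (x + y) / e + e * x)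
    (hpy : -((3 - y ^ 2) * P2 - 2 * y * u2) = (x + y) / e)
    (h2 : r1 ^ 2 * ((3 - x ^ 2) * X1 - 4 * x * P1 - 2 * u1)
      - r2 ^ 2 * ((3 - y ^ 2) * X2 - 4 * y * P2 - 2 * u2) ≤ (r1 - r2) ^ 2 / e + e * r1 ^ 2)
    (ht : lam * (-(x + y) ^ 2 / (2 * e) + e * (C + x ^ 2 / 2)) ≤
      (3 - x ^ 2) * (X1 / (1 + P1 ^ 2)) - (3 - y ^ 2) * (X2 / (1 + P2 ^ 2))) : False := by
  have ha1 : r1 ^ 2 = 1 / (1 + P1 ^ 2) := by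
    rw [hr1, div_pow, Real.sq_sqrt (by positivity), one_pow]
  have ha2 : r2 ^ 2 = 1 / (1 + P2 ^ 2) := by
    rw [hr2, div_pow, Real.sq_sqrt (by positivity), one_pow]
  have hlip : (r1 - r2) ^ 2 ≤ (P1 + P2) ^ 2 := by rw [hr1, hr2]; exact aux_sqrt_lip P1 P2
  have hr1n : 0 ≤ r1 := by rw [hr1]; positivity
  have hr2n : 0 ≤ r2 := by rw [hr2]; positivity
  have ha1l : r1 ^ 2 ≤ 1 := by
    rw [ha1, div_le_one (by positivity)]; linarith [sq_nonneg P1]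
  have ha2l : r2 ^ 2 ≤ 1 := by
    rw [ha2, div_le_one (by positivity)]; linarith [sq_nonneg P2]
  have hr1l : r1 ≤ 1 := (sq_le_one_iff₀ hr1n).mp ha1l
  have hr2l : r2 ≤ 1 := (sq_le_one_iff₀ hr2n).mp ha2l
  rw [div_eq_mul_one_div X1, div_eq_mul_one_div X2, ← ha1, ← ha2] at ht
  have hx2 : x ^ 2 ≤ 1 := (sq_le_one_iff_abs_le_one x).mpr hx
  have hy2 : y ^ 2 ≤ 1 := (sq_le_one_iff_abs_le_one y).mpr hy
  have mulb : ∀ a b A B : ℝ, |a| ≤ A → |b| ≤ B → |a * b| ≤ A * B := by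
    intro a b A B h h'
    rw [abs_mul]
    exact mul_le_mul h h' (abs_nonneg _) ((abs_nonneg _).trans h)
  set s := x + y with hs
  -- bound on s
  have hsb : |s| ≤ 5 * K * e := by
    have h1 : |s / e| ≤ 5 * K := by
      rw [← hpy, abs_neg]
      have e1 : |(3 - y ^ 2) * P2| ≤ 3 * K :=
        mulb _ _ _ _ (by rw [abs_le]; constructor <;> linarith [sq_nonneg y]) hP2
      have e2 : |2 * y * u2| ≤ 2 * K :=
        mulb _ _ _ _ (by rw [abs_mul]; norm_num; linarith) hu2
      rw [abs_le] at *
      constructor <;> linarith [e1.1, e1.2, e2.1, e2.2]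
    rw [abs_div, abs_of_pos he, div_le_iff₀ he] at h1
    exact h1
  have hs2 : s ^ 2 / (2 * e) ≤ 25 / 2 * K ^ 2 * e := by
    rw [div_le_iff₀ (by positivity)]
    have : s ^ 2 ≤ (5 * K * e) ^ 2 := sq_le_sq' (by linarith [abs_le.mp hsb]) (abs_le.mp hsb).2
    exact this.trans_eq (by ring)
  have hs2n : 0 ≤ s ^ 2 / (2 * e) := by positivity
  have hC0 : 0 < C := by rw [hC]; positivity
  -- difference of values
  have hxy : |x - y| ≤ 2 := by
    rw [abs_le] at *; constructor <;> linarith [hx.1, hx.2, hy.1, hy.2]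
  have hd1 : |u1 - u2| ≤ D1 * e := by
    have h1 : (3 - x ^ 2) * (u1 - u2) = ((x - y) * s) * u2 + (s ^ 2 / (2 * e) + e * (C + x ^ 2 / 2)) := by
      rw [← h0, hs]; ring
    have h2 : |((x - y) * s) * u2| ≤ (2 * (5 * K * e)) * K := mulb _ _ _ _ (mulb _ _ _ _ hxy hsb) hu2
    have h3 : |(3 - x ^ 2) * (u1 - u2)| ≤ 2 * D1 * e := by
      rw [h1, hD1]
      rw [abs_le] at h2 ⊢
      have h4 : 0 ≤ e * (C + x ^ 2 / 2) := by positivity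
      have h5 : e * (C + x ^ 2 / 2) ≤ e * (C + 1) := by gcongr; linarith
      have h6 : 0 ≤ K ^ 2 * e := by positivity
      have h7 : 0 ≤ C * e := by positivity
      constructor <;> linarith [h2.1, h2.2, he]
    rw [abs_mul, abs_of_pos (by linarith : 0 < 3 - x ^ 2)] at h3
    have h8 := mul_le_mul_of_nonneg_right (by linarith : (2:ℝ) ≤ 3 - x ^ 2) (abs_nonneg (u1 - u2))
    linarith
  have hd2 : |P1 + P2| ≤ D2 * e := by
    have h1 : (3 - x ^ 2) * (P1 + P2) =
        -((x - y) * s) * P2 + e * x + 2 * x * (u1 - u2) + 2 * s * u2 := by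
      have : (3 - x ^ 2) * P1 + (3 - y ^ 2) * P2 = e * x + 2 * x * u1 + 2 * y * u2 := by linarith
      rw [hs]; linear_combination this
    have h2 : |-((x - y) * s) * P2| ≤ (2 * (5 * K * e)) * K :=
      mulb _ _ _ _ (by rw [abs_neg]; exact mulb _ _ _ _ hxy hsb) hP2
    have h3 : |e * x| ≤ e * 1 := mulb _ _ _ _ (by rw [abs_of_pos he]) hx
    have h4 : |2 * x * (u1 - u2)| ≤ 2 * 1 * (D1 * e) :=
      mulb _ _ _ _ (mulb _ _ _ _ (by norm_num) hx) hd1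
    have h5 : |2 * s * u2| ≤ 2 * (5 * K * e) * K :=
      mulb _ _ _ _ (mulb _ _ _ _ (by norm_num) hsb) hu2
    have h6 : |(3 - x ^ 2) * (P1 + P2)| ≤ 2 * D2 * e := by
      rw [h1, hD2]
      rw [abs_le] at h2 h3 h4 h5 ⊢
      constructor <;> linarith [h2.1, h2.2, h3.1, h3.2, h4.1, h4.2, h5.1, h5.2]
    rw [abs_mul, abs_of_pos (by linarith : 0 < 3 - x ^ 2)] at h6
    have h8 := mul_le_mul_of_nonneg_right (by linarith : (2:ℝ) ≤ 3 - x ^ 2) (abs_nonneg (P1 + P2))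
    linarith
  have hD1n : 0 ≤ D1 := by rw [hD1]; positivity
  have hD2n : 0 ≤ D2 := by rw [hD2]; positivity
  have hr12 : |r1 - r2| ≤ D2 * e := (sq_le_sq.mp hlip).trans hd2
  have hq : (r1 - r2) ^ 2 / e ≤ D2 ^ 2 * e := by
    rw [div_le_iff₀ he]
    have := sq_le_sq' (by linarith [abs_le.mp hr12]) (abs_le.mp hr12).2
    exact this.trans_eq (by ring)
  have ha12 : |r1 ^ 2 - r2 ^ 2| ≤ D2 * e * 2 := by
    have : r1 ^ 2 - r2 ^ 2 = (r1 - r2) * (r1 + r2) := by ring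
    rw [this]
    exact mulb _ _ _ _ hr12 (by rw [abs_of_nonneg (by positivity)]; linarith)
  have ha1a : |r1 ^ 2| ≤ 1 := by rw [abs_of_nonneg (by positivity)]; exact ha1l
  have ha2a : |r2 ^ 2| ≤ 1 := by rw [abs_of_nonneg (by positivity)]; exact ha2l
  -- lower-order terms
  have key : r1 ^ 2 * (4 * x * P1 + 2 * u1) - r2 ^ 2 * (4 * y * P2 + 2 * u2)
      = 4 * x * (r1 ^ 2 * (P1 + P2)) - 4 * x * ((r1 ^ 2 - r2 ^ 2) * P2) - 4 * s * (r2 ^ 2 * P2)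
        + 2 * (r1 ^ 2 * (u1 - u2)) + 2 * ((r1 ^ 2 - r2 ^ 2) * u2) := by
    rw [hs]; ring
  have k1 : |4 * x * (r1 ^ 2 * (P1 + P2))| ≤ 4 * 1 * (1 * (D2 * e)) :=
    mulb _ _ _ _ (mulb _ _ _ _ (by norm_num) hx) (mulb _ _ _ _ ha1a hd2)
  have k2 : |4 * x * ((r1 ^ 2 - r2 ^ 2) * P2)| ≤ 4 * 1 * ((D2 * e * 2) * K) :=
    mulb _ _ _ _ (mulb _ _ _ _ (by norm_num) hx) (mulb _ _ _ _ ha12 hP2)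
  have k3 : |4 * s * (r2 ^ 2 * P2)| ≤ 4 * (5 * K * e) * (1 * K) :=
    mulb _ _ _ _ (mulb _ _ _ _ (by norm_num) hsb) (mulb _ _ _ _ ha2a hP2)
  have k4 : |2 * (r1 ^ 2 * (u1 - u2))| ≤ 2 * (1 * (D1 * e)) :=
    mulb _ _ _ _ (by norm_num) (mulb _ _ _ _ ha1a hd1)
  have k5 : |2 * ((r1 ^ 2 - r2 ^ 2) * u2)| ≤ 2 * ((D2 * e * 2) * K) :=
    mulb _ _ _ _ (by norm_num) (mulb _ _ _ _ ha12 hu2)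
  have hlampos : 0 < lam := by rw [hlam]; positivity
  have hlow : lam * e ≤ lam * (-s ^ 2 / (2 * e) + e * (C + x ^ 2 / 2)) := by
    apply mul_le_mul_of_nonneg_left _ hlampos.le
    have : -s ^ 2 / (2 * e) = -(s ^ 2 / (2 * e)) := by ring
    rw [this, hC]
    have : 0 ≤ e * (x ^ 2 / 2) := by positivity
    have : 0 ≤ e * K ^ 2 := by positivity
    linarith
  have her : e * r1 ^ 2 ≤ e := mul_le_of_le_one_right he.le ha1l
  have hfin : lam * e ≤ D2 ^ 2 * e + e + (4 * 1 * (1 * (D2 * e)) + 4 * 1 * ((D2 * e * 2) * K)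
      + 4 * (5 * K * e) * (1 * K) + 2 * (1 * (D1 * e)) + 2 * ((D2 * e * 2) * K)) := by
    have k1' := (abs_le.mp k1).2
    have k2' := (abs_le.mp k2).1
    have k3' := (abs_le.mp k3).1
    have k4' := (abs_le.mp k4).2
    have k5' := (abs_le.mp k5).2
    linarith [h2, ht, hlow, key, hq, her]
  rw [hlam] at hfin
  linarith [hfin]

lemma B_derivs {u : ℝ → ℝ → ℝ} {u0 : ℝ → ℝ} (hu : IsGlobalSolB u u0) {t x : ℝ} (ht : 0 < t)
    (hx : x ∈ Set.Ioo (-1 : ℝ) 1) :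
    HasDerivAt (fun y => u y t) (ux u x t) x ∧ HasDerivAt (fun y => ux u y t) (uxx u x t) x ∧
    HasDerivAt (fun s => u x s) (uxx u x t / (1 + ux u x t ^ 2)) t := by
  obtain ⟨-, -, h, -, -⟩ := hu
  obtain ⟨h1, h2, h3, h4⟩ := h t ht x hx
  refine ⟨h1.hasDerivAt, h2.hasDerivAt, ?_⟩
  rw [← h4]
  exact h3.hasDerivAt

lemma B_cont_x {u : ℝ → ℝ → ℝ}
    (h : ContinuousOn (fun p : ℝ × ℝ => u p.1 p.2) (Set.Icc (-1 : ℝ) 1 ×ˢ Set.Ici (0 : ℝ)))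
    {t : ℝ} (ht : 0 ≤ t) : ContinuousOn (fun y => u y t) (Set.Icc (-1 : ℝ) 1) :=
  ContinuousOn.comp (g := fun p : ℝ × ℝ => u p.1 p.2) (f := fun y => (y, t)) h (by fun_prop)
    (fun y hy => ⟨hy, ht⟩)

lemma B_cont_t {u : ℝ → ℝ → ℝ}
    (h : ContinuousOn (fun p : ℝ × ℝ => u p.1 p.2) (Set.Icc (-1 : ℝ) 1 ×ˢ Set.Ici (0 : ℝ)))
    {x : ℝ} (hx : x ∈ Set.Icc (-1 : ℝ) 1) : ContinuousOn (fun s => u x s) (Set.Ici (0 : ℝ)) :=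
  ContinuousOn.comp (g := fun p : ℝ × ℝ => u p.1 p.2) (f := fun s => (x, s)) h (by fun_prop)
    (fun y hy => ⟨hx, hy⟩)

lemma B_right {u : ℝ → ℝ → ℝ} {u0 : ℝ → ℝ} (hu : IsGlobalSolB u u0) {t : ℝ} (ht : 0 < t) :
    HasDerivWithinAt (fun y => u y t) (ux u 1 t) (Set.Iic 1) 1 := by
  refine hasDerivWithinAt_Iic_of_tendsto_deriv (s := Set.Ioo (-1) 1) ?_ ?_ ?_ ?_
  · intro x hx
    exact (B_derivs hu ht hx).1.differentiableAt.differentiableWithinAt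
  · exact (B_cont_x hu.1 ht.le 1 (by simp)).mono Set.Ioo_subset_Icc_self
  · exact Ioo_mem_nhdsLT (by norm_num)
  · have h1 : Tendsto (fun y => ux u y t) (𝓝[Set.Icc (-1) 1] 1) (𝓝 (ux u 1 t)) :=
      B_cont_x hu.2.1 ht.le 1 (by simp)
    rw [← nhdsWithin_Ioo_eq_nhdsLT (by norm_num : (-1:ℝ) < 1)]
    exact h1.mono_left (nhdsWithin_mono _ Set.Ioo_subset_Icc_self)

lemma B_left {u : ℝ → ℝ → ℝ} {u0 : ℝ → ℝ} (hu : IsGlobalSolB u u0) {t : ℝ} (ht : 0 < t) :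
    HasDerivWithinAt (fun y => u y t) (ux u (-1) t) (Set.Ici (-1)) (-1) := by
  refine hasDerivWithinAt_Ici_of_tendsto_deriv (s := Set.Ioo (-1) 1) ?_ ?_ ?_ ?_
  · intro x hx
    exact (B_derivs hu ht hx).1.differentiableAt.differentiableWithinAt
  · exact (B_cont_x hu.1 ht.le (-1) (by simp)).mono Set.Ioo_subset_Icc_self
  · exact Ioo_mem_nhdsGT (by norm_num)
  · have h1 : Tendsto (fun y => ux u y t) (𝓝[Set.Icc (-1) 1] (-1)) (𝓝 (ux u (-1) t)) :=
      B_cont_x hu.2.1 ht.le (-1) (by simp)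
    rw [← nhdsWithin_Ioo_eq_nhdsGT (by norm_num : (-1:ℝ) < 1)]
    exact h1.mono_left (nhdsWithin_mono _ Set.Ioo_subset_Icc_self)

lemma B_pos {u : ℝ → ℝ → ℝ} {u0 : ℝ → ℝ} (hu : IsGlobalSolB u u0)
    (h1 : ∀ x ∈ Set.Icc (-1 : ℝ) 1, 1 ≤ u0 x) {T : ℝ} :
    ∀ x ∈ Set.Icc (-1 : ℝ) 1, ∀ t ∈ Set.Icc 0 T, 1 / (2 + t) < u x t := by
  have := aux_first_touch (Set.Icc (-1 : ℝ) 1) isCompact_Icc T (fun x t => 1 / (2 + t) - u x t)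
    ?_ ?_ ?_
  · intro x hx t ht
    linarith [this x hx t ht]
  · apply ContinuousOn.sub
    · apply ContinuousOn.div continuousOn_const (by fun_prop)
      intro p hp
      have := hp.2.1
      linarith
    · exact hu.1.mono (Set.prod_mono le_rfl (fun t ht => ht.1))
  · intro x hx
    have := h1 x hx
    simp only [hu.2.2.2.2 x hx]
    norm_num
    linarith
  · intro x hx t ht hz hle hlt
    have ht0 := ht.1
    have hpos : 0 < u x t := by
      have : 0 < 1 / (2 + t) := by positivity
      linarith
    have hmin : ∀ y ∈ Set.Icc (-1:ℝ) 1, u x t ≤ u y t := fun y hy => by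
      linarith [hle y hy]
    rcases hx.2.lt_or_eq with hx1 | hx1
    · rcases hx.1.lt_or_eq with hx2 | hx2
      · have hxI : x ∈ Set.Ioo (-1:ℝ) 1 := ⟨hx2, hx1⟩
        have hloc : IsLocalMin (fun y => u y t) x := by
          filter_upwards [Icc_mem_nhds hx2 hx1] with y hy using hmin y hy
        have h2 := aux_second' (f := fun y => u y t) (f' := fun y => ux u y t)
          (by filter_upwards [Ioo_mem_nhds hx2 hx1] with y hy using (B_derivs hu ht0 hy).1)
          (B_derivs hu ht0 hxI).2.1 hloc
        have h3 : HasDerivAt (fun s => 1 / (2 + s) - u x s)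
            (-1 / (2 + t) ^ 2 - uxx u x t / (1 + ux u x t ^ 2)) t := by
          refine HasDerivAt.sub ?_ (B_derivs hu ht0 hxI).2.2
          have h7 : HasDerivAt (fun s : ℝ => 1 / (2 + s)) _ t :=
            (hasDerivAt_const t (1:ℝ)).div ((hasDerivAt_id t).const_add 2) (by simp; linarith)
          exact h7.congr_deriv (by simp)
        have h4 := aux_left' (y := 0) ht0 h3.hasDerivWithinAt
          (fun s hs => by rw [hz]; exact (hlt s ⟨hs.1.le, hs.2⟩ x hx).le)
        have h5 : 0 ≤ uxx u x t / (1 + ux u x t ^ 2) := div_nonneg h2.2 (by positivity)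
        have h6 : -1 / (2 + t) ^ 2 < 0 := div_neg_of_neg_of_pos (by norm_num) (by positivity)
        linarith
      · subst hx2
        have := aux_right' (y := 1) (by norm_num) (B_left hu ht0)
          (fun y hy => hmin y ⟨hy.1.le, hy.2.le⟩)
        rw [(hu.2.2.2.1 t ht0).2] at this
        linarith
    · subst hx1
      have := aux_left (y := -1) (by norm_num) (B_right hu ht0)
          (fun y hy => hmin y ⟨hy.1.le, hy.2.le⟩)
      rw [(hu.2.2.2.1 t ht0).1] at this
      linarith

/-- comparison of the slope with a (stationary angle) grim reaper profile -/
lemma grim_compare (w wx wxx : ℝ → ℝ → ℝ) (T c d : ℝ) (hc : c ≠ 0)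
    (hang : ∀ x ∈ Set.Icc (0:ℝ) 1, c * x + d ∈ Set.Ioo (-(π / 2)) (π / 2))
    (hw : ContinuousOn (fun p : ℝ × ℝ => w p.1 p.2) (Set.Icc (0 : ℝ) 1 ×ˢ Set.Icc (0 : ℝ) T))
    (hd1 : ∀ t ∈ Set.Ioc 0 T, ∀ x ∈ Set.Ioo (0:ℝ) 1, HasDerivAt (fun y => w y t) (wx x t) x)
    (hd2 : ∀ t ∈ Set.Ioc 0 T, ∀ x ∈ Set.Ioo (0:ℝ) 1, HasDerivAt (fun y => wx y t) (wxx x t) x)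
    (hdt : ∀ t ∈ Set.Ioc 0 T, ∀ x ∈ Set.Ioo (0:ℝ) 1,
      HasDerivAt (fun s => w x s) (wxx x t / (1 + wx x t ^ 2)) t)
    (hb0 : ∀ t ∈ Set.Ioc 0 T, HasDerivWithinAt (fun y => w y t) (wx 0 t) (Set.Ici 0) 0)
    (hb1 : ∀ t ∈ Set.Ioc 0 T, HasDerivWithinAt (fun y => w y t) (wx 1 t) (Set.Iic 1) 1)
    (hs0 : ∀ t ∈ Set.Ioc 0 T, tan d < wx 0 t)
    (hs1 : ∀ t ∈ Set.Ioc 0 T, tan (c + d) < wx 1 t)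
    (hini : ∀ x ∈ Set.Ioo (0:ℝ) 1, HasDerivAt (fun y => w y 0) (wx x 0) x)
    (hini' : ∀ x ∈ Set.Ioo (0:ℝ) 1, tan (c * x + d) ≤ wx x 0) :
    ∀ t ∈ Set.Ioc 0 T, ∀ x ∈ Set.Ioo (0:ℝ) 1, tan (c * x + d) ≤ wx x t := by
  set G : ℝ → ℝ := fun x => - Real.log (Real.cos (c * x + d)) / c with hG
  have hcos : ∀ x ∈ Set.Icc (0:ℝ) 1, 0 < Real.cos (c * x + d) := fun x hx =>
    Real.cos_pos_of_mem_Ioo (hang x hx)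
  have hlin : ∀ x : ℝ, HasDerivAt (fun y => c * y + d) c x := fun x => by
    simpa using ((hasDerivAt_id x).const_mul c).add_const d
  have hGd : ∀ x ∈ Set.Icc (0:ℝ) 1, HasDerivAt G (tan (c * x + d)) x := by
    intro x hx
    have h1 := (((hlin x).cos.log (hcos x hx).ne').neg).div_const c
    refine h1.congr_deriv ?_
    rw [Real.tan_eq_sin_div_cos]
    have := (hcos x hx).ne'
    field_simp
  have hGdd : ∀ x ∈ Set.Icc (0:ℝ) 1,
      HasDerivAt (fun y => tan (c * y + d)) (c * (1 + tan (c * x + d) ^ 2)) x := by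
    intro x hx
    have h1 := (Real.hasDerivAt_tan (hcos x hx).ne').comp x (hlin x)
    refine h1.congr_deriv ?_
    rw [← Real.inv_one_add_tan_sq (hcos x hx).ne']
    field_simp
  have hGc : ContinuousOn G (Set.Icc 0 1) := fun x hx => (hGd x hx).continuousAt.continuousWithinAt
  -- the initial difference is monotone
  have hmono0 : T ∈ Set.Ici (0:ℝ) → MonotoneOn (fun x => w x 0 - G x) (Set.Icc 0 1) := by
    intro hT
    apply monotoneOn_of_deriv_nonneg (convex_Icc 0 1)
    · refine ContinuousOn.sub ?_ hGc
      exact ContinuousOn.comp (g := fun p : ℝ × ℝ => w p.1 p.2) (f := fun y => (y, (0:ℝ))) hw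
        (by fun_prop) (fun y hy => ⟨hy, le_rfl, hT⟩)
    · intro x hx
      rw [interior_Icc] at hx
      exact ((hini x hx).sub (hGd x (Set.Ioo_subset_Icc_self hx))).differentiableAt.differentiableWithinAt
    · intro x hx
      rw [interior_Icc] at hx
      have := ((hini x hx).sub (hGd x (Set.Ioo_subset_Icc_self hx))).deriv
      have h2 := hini' x hx
      have h3 : deriv (fun x => w x 0 - G x) x = wx x 0 - tan (c * x + d) := this
      rw [h3]; linarith
  set K : Set (ℝ × ℝ) := {p | 0 ≤ p.2 ∧ p.2 ≤ p.1 ∧ p.1 ≤ 1} with hKdef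
  have hKsub : K ⊆ Set.Icc (0:ℝ) 1 ×ˢ Set.Icc (0:ℝ) 1 := by
    rintro ⟨x, y⟩ ⟨h1, h2, h3⟩
    simp only at h1 h2 h3
    exact ⟨⟨h1.trans h2, h3⟩, ⟨h1, h2.trans h3⟩⟩
  have hKcl : IsClosed K := by
    apply IsClosed.inter (isClosed_le continuous_const continuous_snd)
    exact IsClosed.inter (isClosed_le continuous_snd continuous_fst)
      (isClosed_le continuous_fst continuous_const)
  have hK : IsCompact K := (isCompact_Icc.prod isCompact_Icc).of_isClosed_subset hKcl hKsub
  have main : ∀ ε > 0, ∀ p ∈ K, ∀ t ∈ Set.Icc 0 T,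
      (w p.2 t - G p.2) - (w p.1 t - G p.1) - ε * (1 + t) < 0 := by
    intro ε hε
    by_cases hT : T ∈ Set.Ici (0:ℝ)
    swap
    · intro p hp t ht
      exact absurd (ht.1.trans ht.2) hT
    apply aux_first_touch K hK T
      (fun p t => (w p.2 t - G p.2) - (w p.1 t - G p.1) - ε * (1 + t))
    · have c1 : ContinuousOn (fun q : (ℝ × ℝ) × ℝ => w q.1.2 q.2) (K ×ˢ Set.Icc 0 T) :=
        ContinuousOn.comp (g := fun p : ℝ × ℝ => w p.1 p.2)
          (f := fun q : (ℝ × ℝ) × ℝ => (q.1.2, q.2)) hw (by fun_prop)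
          (fun q hq => ⟨(hKsub hq.1).2, hq.2⟩)
      have c2 : ContinuousOn (fun q : (ℝ × ℝ) × ℝ => w q.1.1 q.2) (K ×ˢ Set.Icc 0 T) :=
        ContinuousOn.comp (g := fun p : ℝ × ℝ => w p.1 p.2)
          (f := fun q : (ℝ × ℝ) × ℝ => (q.1.1, q.2)) hw (by fun_prop)
          (fun q hq => ⟨(hKsub hq.1).1, hq.2⟩)
      have c3 : ContinuousOn (fun q : (ℝ × ℝ) × ℝ => G q.1.2) (K ×ˢ Set.Icc 0 T) :=
        ContinuousOn.comp (g := G) (f := fun q : (ℝ × ℝ) × ℝ => q.1.2) hGc (by fun_prop)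
          (fun q hq => (hKsub hq.1).2)
      have c4 : ContinuousOn (fun q : (ℝ × ℝ) × ℝ => G q.1.1) (K ×ˢ Set.Icc 0 T) :=
        ContinuousOn.comp (g := G) (f := fun q : (ℝ × ℝ) × ℝ => q.1.1) hGc (by fun_prop)
          (fun q hq => (hKsub hq.1).1)
      exact ((c1.sub c3).sub (c2.sub c4)).sub (by fun_prop)
    · intro p hp
      have := hmono0 hT (hKsub hp).2 (hKsub hp).1 hp.2.1
      simp only at this
      linarith
    · rintro ⟨x, y⟩ hp t ht hz hle hlt
      obtain ⟨hy0, hyx, hx1⟩ := hp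
      simp only at hy0 hyx hx1 hz hle hlt
      have ht0 := ht.1
      have hne : y < x := by
        rcases hyx.lt_or_eq with h | h
        · exact h
        · subst h
          have : 0 < ε * (1 + t) := by positivity
          linarith
      have hxmin : ∀ x' ∈ Set.Icc y 1, w x t - G x ≤ w x' t - G x' := by
        intro x' hx'
        have := hle (x', y) ⟨hy0, hx'.1, hx'.2⟩
        simp only at this
        linarith
      have hymax : ∀ y' ∈ Set.Icc 0 x, w y' t - G y' ≤ w y t - G y := by
        intro y' hy'
        have := hle (x, y') ⟨hy'.1, hy'.2, hx1⟩
        simp only at this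
        linarith
      have hxlt : x < 1 := by
        rcases hx1.lt_or_eq with h | h
        · exact h
        · exfalso
          subst h
          have hdd := (hb1 t ht).sub (hGd 1 (by simp)).hasDerivWithinAt
          have := aux_left hne hdd (fun y' hy' => hxmin y' ⟨hy'.1.le, hy'.2.le⟩)
          have h2 := hs1 t ht
          rw [mul_one] at this
          linarith
      have hypos : 0 < y := by
        rcases hy0.lt_or_eq with h | h
        · exact h
        · exfalso
          subst h
          have hdd := (hb0 t ht).sub (hGd 0 (by simp)).hasDerivWithinAt
          have := aux_right hne hdd (fun y' hy' => hymax y' ⟨hy'.1.le, hy'.2.le⟩)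
          have h2 := hs0 t ht
          rw [mul_zero, zero_add] at this
          linarith
      have hxI : x ∈ Set.Ioo (0:ℝ) 1 := ⟨hypos.trans hne, hxlt⟩
      have hyI : y ∈ Set.Ioo (0:ℝ) 1 := ⟨hypos, hne.trans hxlt⟩
      have hev : ∀ z ∈ Set.Ioo (0:ℝ) 1, ∀ᶠ z' in 𝓝 z,
          HasDerivAt (fun z => w z t - G z) (wx z' t - tan (c * z' + d)) z' := by
        intro z hz
        filter_upwards [Ioo_mem_nhds hz.1 hz.2] with z' hz'
        exact (hd1 t ht z' hz').sub (hGd z' (Set.Ioo_subset_Icc_self hz'))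
      have hx2 := aux_second' (f' := fun z' => wx z' t - tan (c * z' + d)) (hev x hxI)
        ((hd2 t ht x hxI).sub (hGdd x (Set.Ioo_subset_Icc_self hxI)))
        (by filter_upwards [Icc_mem_nhds hne hxlt] with z hz using hxmin z hz)
      have hy2 := aux_second (f' := fun z' => wx z' t - tan (c * z' + d)) (hev y hyI)
        ((hd2 t ht y hyI).sub (hGdd y (Set.Ioo_subset_Icc_self hyI)))
        (by filter_upwards [Icc_mem_nhds hypos hne] with z hz using hymax z hz)
      have ex : tan (c * x + d) = wx x t := by linarith [hx2.1]
      have ey : tan (c * y + d) = wx y t := by linarith [hy2.1]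
      rw [ex] at hx2
      rw [ey] at hy2
      have fx : c ≤ wxx x t / (1 + wx x t ^ 2) := by
        rw [le_div_iff₀ (by positivity)]; linarith [hx2.2]
      have fy : wxx y t / (1 + wx y t ^ 2) ≤ c := by
        rw [div_le_iff₀ (by positivity)]; linarith [hy2.2]
      have htd : HasDerivAt (fun s => (w y s - G y) - (w x s - G x) - ε * (1 + s))
          (wxx y t / (1 + wx y t ^ 2) - wxx x t / (1 + wx x t ^ 2) - ε) t := by
        have h1 := (((hdt t ht y hyI).sub_const (G y)).sub ((hdt t ht x hxI).sub_const (G x))).sub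
          (((hasDerivAt_id t).const_add 1).const_mul ε)
        exact h1.congr_deriv (by simp)
      have := aux_left' (y := 0) ht0 htd.hasDerivWithinAt (fun s hs => by
        rw [hz]; exact (hlt s ⟨hs.1.le, hs.2⟩ (x, y) ⟨hy0, hyx, hx1⟩).le)
      linarith
  intro t ht x hx
  have hmono : ∀ x' ∈ Set.Icc (0:ℝ) x, w x' t - G x' ≤ w x t - G x := by
    intro x' hx'
    by_contra hcon
    push Not at hcon
    have ht0 := ht.1
    have h1 := main (((w x' t - G x') - (w x t - G x)) / (2 * (1 + t)))
      (div_pos (by linarith) (by positivity)) (x, x') ⟨hx'.1, hx'.2, hx.2.le⟩ t ⟨ht.1.le, ht.2⟩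
    simp only at h1
    have : ((w x' t - G x') - (w x t - G x)) / (2 * (1 + t)) * (1 + t)
      = ((w x' t - G x') - (w x t - G x)) / 2 := by field_simp
    rw [this] at h1
    linarith
  have hdd := (hd1 t ht x hx).sub (hGd x (Set.Ioo_subset_Icc_self hx))
  have := aux_left' hx.1 hdd.hasDerivWithinAt (fun x' hx' => hmono x' ⟨hx'.1.le, hx'.2.le⟩)
  linarith

lemma B_init {u : ℝ → ℝ → ℝ} {u0 : ℝ → ℝ} (hu : IsGlobalSolB u u0)
    (hu0C1 : ContDiffOn ℝ 1 u0 (Set.Icc (-1 : ℝ) 1)) {x : ℝ} (hx : x ∈ Set.Ioo (-1 : ℝ) 1) :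
    HasDerivAt (fun y => u y 0) (ux u x 0) x ∧
      ux u x 0 = derivWithin u0 (Set.Icc (-1 : ℝ) 1) x := by
  have hn : Set.Icc (-1 : ℝ) 1 ∈ 𝓝 x := Icc_mem_nhds hx.1 hx.2
  have h1 : DifferentiableAt ℝ u0 x :=
    ((hu0C1.differentiableOn (by norm_num)) x (Set.Ioo_subset_Icc_self hx)).differentiableAt hn
  have he : (fun y => u y 0) =ᶠ[𝓝 x] u0 := by
    filter_upwards [hn] with y hy using hu.2.2.2.2 y hy
  have h2 : DifferentiableAt ℝ (fun y => u y 0) x := he.differentiableAt_iff.mpr h1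
  refine ⟨h2.hasDerivAt, ?_⟩
  rw [derivWithin_of_mem_nhds hn, ux, he.deriv_eq]

lemma B_bound {u : ℝ → ℝ → ℝ} {u0 : ℝ → ℝ} (hu : IsGlobalSolB u u0) (T : ℝ) :
    ∃ K : ℝ, 0 ≤ K ∧ ∀ x ∈ Set.Icc (-1 : ℝ) 1, ∀ t ∈ Set.Icc 0 T, |u x t| ≤ K ∧ |ux u x t| ≤ K := by
  have hc : IsCompact (Set.Icc (-1 : ℝ) 1 ×ˢ Set.Icc (0:ℝ) T) := isCompact_Icc.prod isCompact_Icc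
  have hsub : Set.Icc (-1 : ℝ) 1 ×ˢ Set.Icc (0:ℝ) T ⊆ Set.Icc (-1 : ℝ) 1 ×ˢ Set.Ici (0:ℝ) :=
    Set.prod_mono le_rfl (fun t ht => ht.1)
  obtain ⟨K1, h1⟩ := hc.exists_bound_of_continuousOn (hu.1.mono hsub)
  obtain ⟨K2, h2⟩ := hc.exists_bound_of_continuousOn (hu.2.1.mono hsub)
  refine ⟨max 0 (max K1 K2), le_max_left _ _, fun x hx t ht => ⟨?_, ?_⟩⟩
  · exact (h1 (x, t) ⟨hx, ht⟩).trans ((le_max_left _ _).trans (le_max_right _ _))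
  · exact (h2 (x, t) ⟨hx, ht⟩).trans ((le_max_right _ _).trans (le_max_right _ _))

lemma aux_mul_deriv {f : ℝ → ℝ} {S : Set ℝ} {P x : ℝ} (h : HasDerivWithinAt f P S x) :
    HasDerivWithinAt (fun y => (3 - y ^ 2) * f y) ((3 - x ^ 2) * P - 2 * x * f x) S x := by
  have h1 : HasDerivWithinAt (fun y : ℝ => 3 - y ^ 2) (-(2 * x)) S x := by
    have := ((hasDerivAt_pow 2 x).const_sub 3).hasDerivWithinAt (s := S)
    exact this.congr_deriv (by simp)
  exact (h1.mul h).congr_deriv (by ring)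

lemma aux_mul_deriv2 {f f' : ℝ → ℝ} {X x : ℝ} (h : HasDerivAt f (f' x) x)
    (h' : HasDerivAt f' X x) :
    HasDerivAt (fun y => (3 - y ^ 2) * f' y - 2 * y * f y)
      ((3 - x ^ 2) * X - 4 * x * f' x - 2 * f x) x := by
  have h1 := aux_mul_deriv (h'.hasDerivWithinAt (s := Set.univ))
  rw [hasDerivWithinAt_univ] at h1
  have h2 : HasDerivAt (fun y : ℝ => 2 * y) 2 x :=
    ((hasDerivAt_id x).const_mul 2).congr_deriv (by simp)
  exact (h1.sub (h2.mul h)).congr_deriv (by ring)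

lemma aux_pen_x (e C y x : ℝ) (he : e ≠ 0) :
    HasDerivAt (fun x => (x + y) ^ 2 / (2 * e) + e * (C + x ^ 2 / 2)) ((x + y) / e + e * x) x := by
  have h1 := ((((hasDerivAt_id x).add_const y).pow 2).div_const (2 * e)).add
    (((((hasDerivAt_id x).pow 2).div_const 2).const_add C).const_mul e)
  refine h1.congr_deriv ?_
  simp
  field_simp

lemma aux_pen_y (e C y x : ℝ) (he : e ≠ 0) :
    HasDerivAt (fun y => (x + y) ^ 2 / (2 * e) + e * (C + x ^ 2 / 2)) ((x + y) / e) y := by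
  have h1 := ((((hasDerivAt_id y).const_add x).pow 2).div_const (2 * e)).add_const
    (e * (C + x ^ 2 / 2))
  refine h1.congr_deriv ?_
  simp
  field_simp

/-- second-order conditions at an interior maximum of the doubled function -/
lemma aux_double_max (v v' : ℝ → ℝ) (x y A B e C : ℝ) (he : e ≠ 0)
    (hx : x ∈ Set.Ioo (-1 : ℝ) 1) (hy : y ∈ Set.Ioo (-1 : ℝ) 1)
    (hv : ∀ z ∈ Set.Ioo (-1 : ℝ) 1, HasDerivAt v (v' z) z)
    (hA : HasDerivAt v' A x) (hB : HasDerivAt v' B y)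
    (hmax : ∀ x' ∈ Set.Icc (-1 : ℝ) 1, ∀ y' ∈ Set.Icc (-1 : ℝ) 1,
      v x' - v y' - ((x' + y') ^ 2 / (2 * e) + e * (C + x' ^ 2 / 2)) ≤
      v x - v y - ((x + y) ^ 2 / (2 * e) + e * (C + x ^ 2 / 2))) (ξ η : ℝ) :
    ξ * v' x - η * v' y - ((ξ + η) * (x + y) / e + e * ξ * x) = 0 ∧
    ξ ^ 2 * A - η ^ 2 * B - ((ξ + η) ^ 2 / e + e * ξ ^ 2) ≤ 0 := by
  have hl : ∀ a b τ : ℝ, HasDerivAt (fun s : ℝ => a + b * s) b τ := fun a b τ =>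
    (((hasDerivAt_id τ).const_mul b).const_add a).congr_deriv (by simp)
  have hcx : ∀ᶠ τ in 𝓝 (0:ℝ), x + ξ * τ ∈ Set.Ioo (-1:ℝ) 1 := by
    have : ContinuousAt (fun τ : ℝ => x + ξ * τ) 0 := by fun_prop
    exact this.eventually_mem (by simpa using Ioo_mem_nhds hx.1 hx.2)
  have hcy : ∀ᶠ τ in 𝓝 (0:ℝ), y + η * τ ∈ Set.Ioo (-1:ℝ) 1 := by
    have : ContinuousAt (fun τ : ℝ => y + η * τ) 0 := by fun_prop
    exact this.eventually_mem (by simpa using Ioo_mem_nhds hy.1 hy.2)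
  have := aux_second (x0 := 0)
    (f := fun τ => v (x + ξ * τ) - v (y + η * τ) -
      (((x + y) + (ξ + η) * τ) ^ 2 / (2 * e) + e * (C + (x + ξ * τ) ^ 2 / 2)))
    (f' := fun τ => v' (x + ξ * τ) * ξ - v' (y + η * τ) * η -
      ((ξ + η) * ((x + y) + (ξ + η) * τ) / e + e * ξ * (x + ξ * τ)))
    (f'' := A * ξ * ξ - B * η * η - ((ξ + η) ^ 2 / e + e * ξ ^ 2)) ?_ ?_ ?_
  · simp only [mul_zero, add_zero] at this
    constructor
    · linarith [this.1]
    · have := this.2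
      ring_nf at this ⊢
      linarith
  · filter_upwards [hcx, hcy] with τ h1 h2
    have d1 := (hv _ h1).comp τ (hl x ξ τ)
    have d2 := (hv _ h2).comp τ (hl y η τ)
    have d3 := (((hl (x + y) (ξ + η) τ).pow 2).div_const (2 * e)).add
      (((((hl x ξ τ).pow 2).div_const 2).const_add C).const_mul e)
    refine ((d1.sub d2).sub d3).congr_deriv ?_
    simp
    field_simp
  · have hA' : HasDerivAt v' A (x + ξ * 0) := by simpa using hA
    have hB' : HasDerivAt v' B (y + η * 0) := by simpa using hB
    have d1 := (hA'.comp 0 (hl x ξ 0)).mul_const ξ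
    have d2 := (hB'.comp 0 (hl y η 0)).mul_const η
    have d3 := (((hl (x + y) (ξ + η) 0).const_mul (ξ + η)).div_const e).add
      ((hl x ξ 0).const_mul (e * ξ))
    refine ((d1.sub d2).sub d3).congr_deriv ?_
    ring
  · filter_upwards [hcx, hcy] with τ h1 h2
    have := hmax _ (Set.Ioo_subset_Icc_self h1) _ (Set.Ioo_subset_Icc_self h2)
    simp only [mul_zero, add_zero]
    have e1 : x + ξ * τ + (y + η * τ) = x + y + (ξ + η) * τ := by ring
    rw [e1] at this
    exact this

lemma B_even_le {u : ℝ → ℝ → ℝ} {u0 : ℝ → ℝ} (hu : IsGlobalSolB u u0)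
    (hu0C1 : ContDiffOn ℝ 1 u0 (Set.Icc (-1 : ℝ) 1))
    (heven : ∀ x ∈ Set.Icc (-1 : ℝ) 1, u0 x = u0 (-x)) (T : ℝ) :
    ∀ x ∈ Set.Icc (-1 : ℝ) 1, ∀ t ∈ Set.Icc 0 T, u x t ≤ u (-x) t := by
  obtain ⟨K, hK0, hKb⟩ := B_bound hu T
  obtain ⟨C, hC⟩ : ∃ C, C = 13 * K ^ 2 + 1 := ⟨_, rfl⟩
  obtain ⟨D1, hD1⟩ : ∃ D1, D1 = (23 * K ^ 2 + C + 1) / 2 := ⟨_, rfl⟩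
  obtain ⟨D2, hD2⟩ : ∃ D2, D2 = (20 * K ^ 2 + 1 + 2 * D1) / 2 := ⟨_, rfl⟩
  obtain ⟨lam, hlam⟩ : ∃ lam, lam = D2 ^ 2 + 2 + 4 * (1 + 2 * K) * D2 + 20 * K ^ 2 + 2 * D1
    + 4 * K * D2 := ⟨_, rfl⟩
  have hC0 : 0 < C := by rw [hC]; positivity
  set Q : Set (ℝ × ℝ) := Set.Icc (-1:ℝ) 1 ×ˢ Set.Icc (-1:ℝ) 1 with hQ
  -- initial Lipschitz bound
  have hlip : 0 ≤ T → ∀ x ∈ Set.Icc (-1:ℝ) 1, ∀ y ∈ Set.Icc (-1:ℝ) 1, 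
      (3 - x ^ 2) * u x 0 - (3 - y ^ 2) * u y 0 ≤ 5 * K * |x - y| := by
    intro hT
    have hd : ∀ x ∈ Set.Ioo (-1:ℝ) 1, HasDerivAt (fun x => (3 - x ^ 2) * u x 0)
        ((3 - x ^ 2) * ux u x 0 - 2 * x * u x 0) x := by
      intro x hx
      have := aux_mul_deriv ((B_init hu hu0C1 hx).1.hasDerivWithinAt (s := Set.univ))
      rwa [hasDerivWithinAt_univ] at this
    have hb : ∀ x ∈ Set.Ioo (-1:ℝ) 1, |(3 - x ^ 2) * ux u x 0 - 2 * x * u x 0| ≤ 5 * K := by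
      intro x hx
      obtain ⟨b1, b2⟩ := hKb x (Set.Ioo_subset_Icc_self hx) 0 ⟨le_rfl, hT⟩
      have hx2 : |3 - x ^ 2| ≤ 3 := by
        rw [abs_le]; constructor <;> nlinarith [hx.1, hx.2, sq_nonneg x]
      have hx1 : |2 * x| ≤ 2 := by
        rw [abs_le]; constructor <;> linarith [hx.1, hx.2]
      calc |(3 - x ^ 2) * ux u x 0 - 2 * x * u x 0|
          ≤ |(3 - x ^ 2) * ux u x 0| + |2 * x * u x 0| := abs_sub _ _
        _ = |3 - x ^ 2| * |ux u x 0| + |2 * x| * |u x 0| := by rw [abs_mul, abs_mul (2 * x)]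
        _ ≤ 3 * K + 2 * K := by gcongr
        _ = 5 * K := by ring
    have hcv : ContinuousOn (fun x => (3 - x ^ 2) * u x 0) (Set.Icc (-1:ℝ) 1) :=
      ContinuousOn.mul (by fun_prop) (B_cont_x hu.1 le_rfl)
    have hlinear : ∀ x : ℝ, HasDerivAt (fun x => 5 * K * x) (5 * K) x := fun x =>
      ((hasDerivAt_id x).const_mul (5 * K)).congr_deriv (by simp)
    have m1 : MonotoneOn (fun x => 5 * K * x - (3 - x ^ 2) * u x 0) (Set.Icc (-1:ℝ) 1) := by
      apply monotoneOn_of_deriv_nonneg (convex_Icc _ _) ((by fun_prop : ContinuousOn _ _).sub hcv)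
      · intro x hx
        rw [interior_Icc] at hx
        exact ((hlinear x).sub (hd x hx)).differentiableAt.differentiableWithinAt
      · intro x hx
        rw [interior_Icc] at hx
        have h1 : deriv (fun x => 5 * K * x - (3 - x ^ 2) * u x 0) x = _ :=
          ((hlinear x).sub (hd x hx)).deriv
        refine le_of_le_of_eq ?_ h1.symm
        linarith [(abs_le.mp (hb x hx)).2]
    have m2 : MonotoneOn (fun x => 5 * K * x + (3 - x ^ 2) * u x 0) (Set.Icc (-1:ℝ) 1) := by
      apply monotoneOn_of_deriv_nonneg (convex_Icc _ _) ((by fun_prop : ContinuousOn _ _).add hcv)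
      · intro x hx
        rw [interior_Icc] at hx
        exact ((hlinear x).add (hd x hx)).differentiableAt.differentiableWithinAt
      · intro x hx
        rw [interior_Icc] at hx
        have h1 : deriv (fun x => 5 * K * x + (3 - x ^ 2) * u x 0) x = _ :=
          ((hlinear x).add (hd x hx)).deriv
        refine le_of_le_of_eq ?_ h1.symm
        linarith [(abs_le.mp (hb x hx)).1]
    intro x hx y hy
    rcases le_total x y with h | h
    · rw [abs_of_nonpos (by linarith)]
      have := m2 hx hy h
      simp only at this
      linarith
    · rw [abs_of_nonneg (by linarith)]
      have := m1 hy hx h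
      simp only at this
      linarith
  have main : ∀ ε > 0, ∀ p ∈ Q, ∀ t ∈ Set.Icc 0 T,
      (3 - p.1 ^ 2) * u p.1 t - (3 - p.2 ^ 2) * u p.2 t -
        ((p.1 + p.2) ^ 2 / (2 * (ε * exp (lam * t))) + ε * exp (lam * t) * (C + p.1 ^ 2 / 2)) < 0 := by
    intro ε hε
    by_cases hT : 0 ≤ T
    swap
    · intro p hp t ht
      exact absurd (ht.1.trans ht.2) hT
    apply aux_first_touch Q (isCompact_Icc.prod isCompact_Icc) T (fun p t =>
      (3 - p.1 ^ 2) * u p.1 t - (3 - p.2 ^ 2) * u p.2 t -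
        ((p.1 + p.2) ^ 2 / (2 * (ε * exp (lam * t))) + ε * exp (lam * t) * (C + p.1 ^ 2 / 2)))
    · have c1 : ContinuousOn (fun q : (ℝ × ℝ) × ℝ => u q.1.1 q.2) (Q ×ˢ Set.Icc 0 T) :=
        ContinuousOn.comp (g := fun p : ℝ × ℝ => u p.1 p.2)
          (f := fun q : (ℝ × ℝ) × ℝ => (q.1.1, q.2)) hu.1 (by fun_prop)
          (fun q hq => ⟨hq.1.1, hq.2.1⟩)
      have c2 : ContinuousOn (fun q : (ℝ × ℝ) × ℝ => u q.1.2 q.2) (Q ×ˢ Set.Icc 0 T) :=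
        ContinuousOn.comp (g := fun p : ℝ × ℝ => u p.1 p.2)
          (f := fun q : (ℝ × ℝ) × ℝ => (q.1.2, q.2)) hu.1 (by fun_prop)
          (fun q hq => ⟨hq.1.2, hq.2.1⟩)
      have c3 : Continuous (fun q : (ℝ × ℝ) × ℝ => (q.1.1 + q.1.2) ^ 2 / (2 * (ε * exp (lam * q.2)))
          + ε * exp (lam * q.2) * (C + q.1.1 ^ 2 / 2)) := by
        apply Continuous.add _ (by fun_prop)
        exact Continuous.div (by fun_prop) (by fun_prop) (fun q => by positivity)
      exact (((by fun_prop : ContinuousOn (fun q : (ℝ × ℝ) × ℝ => 3 - q.1.1 ^ 2) _).mul c1).sub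
        ((by fun_prop : ContinuousOn (fun q : (ℝ × ℝ) × ℝ => 3 - q.1.2 ^ 2) _).mul c2)).sub
        c3.continuousOn
    · rintro ⟨x, y⟩ ⟨hx, hy⟩
      simp only at hx hy ⊢
      have hy' : -y ∈ Set.Icc (-1:ℝ) 1 := ⟨by linarith [hy.2], by linarith [hy.1]⟩
      have h1 := hlip hT x hx (-y) hy'
      rw [hu.2.2.2.2 (-y) hy', ← heven y hy, ← hu.2.2.2.2 y hy, sub_neg_eq_add, neg_sq] at h1
      rw [mul_zero, Real.exp_zero, mul_one]
      have h2 : 5 * K * |x + y| ≤ (x + y) ^ 2 / (2 * ε) + 25 / 2 * K ^ 2 * ε := by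
        rw [← sq_abs (x + y)]
        have : |x + y| ^ 2 / (2 * ε) + 25 / 2 * K ^ 2 * ε - 5 * K * |x + y|
          = (|x + y| - 5 * K * ε) ^ 2 / (2 * ε) := by field_simp; ring
        have h3 : 0 ≤ (|x + y| - 5 * K * ε) ^ 2 / (2 * ε) := by positivity
        linarith
      have h3 : 25 / 2 * K ^ 2 * ε < ε * (C + x ^ 2 / 2) := by
        rw [hC]
        have a1 : 0 ≤ K ^ 2 * ε := by positivity
        have a2 : 0 ≤ ε * x ^ 2 := by positivity
        linarith
      linarith
    · rintro ⟨x, y⟩ ⟨hx, hy⟩ t ht hz hle hlt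
      simp only at hx hy hz
      have ht0 := ht.1
      have hepos : 0 < ε * exp (lam * t) := by positivity
      obtain ⟨e, he⟩ : ∃ e, e = ε * exp (lam * t) := ⟨_, rfl⟩
      rw [← he] at hz hepos
      have hmax : ∀ x' ∈ Set.Icc (-1 : ℝ) 1, ∀ y' ∈ Set.Icc (-1 : ℝ) 1,
          (3 - x' ^ 2) * u x' t - (3 - y' ^ 2) * u y' t
            - ((x' + y') ^ 2 / (2 * e) + e * (C + x' ^ 2 / 2)) ≤
          (3 - x ^ 2) * u x t - (3 - y ^ 2) * u y t
            - ((x + y) ^ 2 / (2 * e) + e * (C + x ^ 2 / 2)) := by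
        intro x' hx' y' hy'
        rw [hz, he]
        exact hle (x', y') ⟨hx', hy'⟩
      obtain ⟨bc1, bc2⟩ := hu.2.2.2.1 t ht0
      have hx1 : x < 1 := by
        rcases hx.2.lt_or_eq with h | h
        · exact h
        · exfalso
          subst h
          have d1 := ((aux_mul_deriv (B_right hu ht0)).sub_const ((3 - y ^ 2) * u y t)).sub
            (aux_pen_x e C y 1 hepos.ne').hasDerivWithinAt
          have := aux_left' (y := -1) (by norm_num) d1
            (fun x' hx' => hmax x' ⟨hx'.1.le, hx'.2.le⟩ y hy)
          rw [bc1] at this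
          have h2 : 0 ≤ (1 + y) / e := div_nonneg (by linarith [hy.1]) hepos.le
          linarith
      have hx2 : -1 < x := by
        rcases hx.1.lt_or_eq with h | h
        · exact h
        · exfalso
          subst h
          have d1 := ((aux_mul_deriv (B_left hu ht0)).sub_const ((3 - y ^ 2) * u y t)).sub
            (aux_pen_x e C y (-1) hepos.ne').hasDerivWithinAt
          have := aux_right (y := 1) (by norm_num) d1
            (fun x' hx' => hmax x' ⟨hx'.1.le, hx'.2.le⟩ y hy)
          rw [bc2] at this
          have h2 : (-1 + y) / e ≤ 0 := div_nonpos_of_nonpos_of_nonneg (by linarith [hy.2]) hepos.le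
          linarith
      have hy1 : y < 1 := by
        rcases hy.2.lt_or_eq with h | h
        · exact h
        · exfalso
          subst h
          have d1 := ((aux_mul_deriv (B_right hu ht0)).const_sub ((3 - x ^ 2) * u x t)).sub
            (aux_pen_y e C 1 x hepos.ne').hasDerivWithinAt
          have := aux_left' (y := -1) (by norm_num) d1
            (fun y' hy' => hmax x hx y' ⟨hy'.1.le, hy'.2.le⟩)
          rw [bc1] at this
          have h2 : 0 < (x + 1) / e := div_pos (by linarith) hepos
          linarith
      have hy2 : -1 < y := by
        rcases hy.1.lt_or_eq with h | h
        · exact h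
        · exfalso
          subst h
          have d1 := ((aux_mul_deriv (B_left hu ht0)).const_sub ((3 - x ^ 2) * u x t)).sub
            (aux_pen_y e C (-1) x hepos.ne').hasDerivWithinAt
          have := aux_right (y := 1) (by norm_num) d1
            (fun y' hy' => hmax x hx y' ⟨hy'.1.le, hy'.2.le⟩)
          rw [bc2] at this
          have h2 : (x + -1) / e < 0 := div_neg_of_neg_of_pos (by linarith) hepos
          linarith
      have hxI : x ∈ Set.Ioo (-1:ℝ) 1 := ⟨hx2, hx1⟩
      have hyI : y ∈ Set.Ioo (-1:ℝ) 1 := ⟨hy2, hy1⟩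
      have hsec := aux_double_max (fun z => (3 - z ^ 2) * u z t)
        (fun z => (3 - z ^ 2) * ux u z t - 2 * z * u z t) x y _ _ e C hepos.ne' hxI hyI
        (fun z hz => by
          have := aux_mul_deriv ((B_derivs hu ht0 hz).1.hasDerivWithinAt (s := Set.univ))
          rwa [hasDerivWithinAt_univ] at this)
        (aux_mul_deriv2 (B_derivs hu ht0 hxI).1 (B_derivs hu ht0 hxI).2.1)
        (aux_mul_deriv2 (B_derivs hu ht0 hyI).1 (B_derivs hu ht0 hyI).2.1) hmax
      have s1 := (hsec 1 0).1
      have s2 := (hsec 0 1).1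
      have s3 := (hsec (1 / √(1 + ux u x t ^ 2)) (-(1 / √(1 + ux u y t ^ 2)))).2
      have hed : HasDerivAt (fun s => ε * exp (lam * s)) (lam * e) t := by
        have := (((hasDerivAt_id t).const_mul lam).exp).const_mul ε
        refine this.congr_deriv ?_
        rw [he]; simp; ring
      have htd : HasDerivAt (fun s => (3 - x ^ 2) * u x s - (3 - y ^ 2) * u y s -
          ((x + y) ^ 2 / (2 * (ε * exp (lam * s))) + ε * exp (lam * s) * (C + x ^ 2 / 2)))
          ((3 - x ^ 2) * (uxx u x t / (1 + ux u x t ^ 2))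
            - (3 - y ^ 2) * (uxx u y t / (1 + ux u y t ^ 2))
            - lam * (-(x + y) ^ 2 / (2 * e) + e * (C + x ^ 2 / 2))) t := by
        have h1 := (((B_derivs hu ht0 hxI).2.2.const_mul (3 - x ^ 2)).sub
          ((B_derivs hu ht0 hyI).2.2.const_mul (3 - y ^ 2))).sub
          (((hasDerivAt_const t ((x + y) ^ 2)).div (hed.const_mul 2)
            (by positivity)).add (hed.mul_const (C + x ^ 2 / 2)))
        refine h1.congr_deriv ?_
        rw [← he]
        field_simp
        ring
      have htt := aux_left' (y := 0) ht0 htd.hasDerivWithinAt (fun s hs => by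
        rw [← he, hz]
        exact (hlt s ⟨hs.1.le, hs.2⟩ (x, y) ⟨hx, hy⟩).le)
      have htI : t ∈ Set.Icc 0 T := ⟨ht0.le, ht.2⟩
      refine aux_algebra K C D1 D2 lam x y (u x t) (u y t) (ux u x t) (ux u y t) (uxx u x t)
        (uxx u y t) _ _ e hK0 hC hD1 hD2 hlam hepos (abs_le.mpr hx) (abs_le.mpr hy)
        (hKb y hy t htI).1 (hKb y hy t htI).2 rfl rfl ?_ ?_ ?_ ?_ ?_
      · linarith
      · ring_nf at s1 ⊢; linarith
      · ring_nf at s2 ⊢; linarith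
      · rw [neg_sq, ← sub_eq_add_neg] at s3
        linarith
      · linarith
  intro x hx t ht
  by_contra hcon
  push Not at hcon
  have hx2 : x ^ 2 ≤ 1 := by nlinarith [hx.1, hx.2]
  have hE := exp_pos (lam * t)
  have hx' : -x ∈ Set.Icc (-1:ℝ) 1 := ⟨by linarith [hx.2], by linarith [hx.1]⟩
  have hg : 0 < u x t - u (-x) t := by linarith
  have h1 := main ((u x t - u (-x) t) / (exp (lam * t) * (C + 1))) (by positivity) (x, -x)
    ⟨hx, hx'⟩ t ht
  simp only [add_neg_cancel, neg_sq] at h1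
  have h2 : (u x t - u (-x) t) / (exp (lam * t) * (C + 1)) * exp (lam * t) * (C + x ^ 2 / 2)
      = (u x t - u (-x) t) * ((C + x ^ 2 / 2) / (C + 1)) := by field_simp
  rw [h2] at h1
  have h3 : (C + x ^ 2 / 2) / (C + 1) ≤ 1 := by
    rw [div_le_one (by positivity)]; linarith
  have h4 := mul_le_mul_of_nonneg_left h3 hg.le
  have h5 := mul_nonneg hg.le (by linarith : 0 ≤ 2 - x ^ 2)
  norm_num at h1
  nlinarith

lemma aux_tan_le {θ b : ℝ} (h1 : -(π / 2) < θ) (h2 : θ ≤ arctan b) : tan θ ≤ b := by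
  have := Real.strictMonoOn_tan.monotoneOn ⟨h1, h2.trans_lt (arctan_lt_pi_div_two b)⟩
    ⟨neg_pi_div_two_lt_arctan b, arctan_lt_pi_div_two b⟩ h2
  rwa [tan_arctan] at this

lemma aux_tan_lt {θ b : ℝ} (h1 : -(π / 2) < θ) (h2 : θ < arctan b) : tan θ < b := by
  have := Real.strictMonoOn_tan ⟨h1, h2.trans (arctan_lt_pi_div_two b)⟩
    ⟨neg_pi_div_two_lt_arctan b, arctan_lt_pi_div_two b⟩ h2
  rwa [tan_arctan] at this

lemma B_corner {u : ℝ → ℝ → ℝ} {u0 : ℝ → ℝ} (hu : IsGlobalSolB u u0) : ux u 1 0 = u 1 0 := by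
  have h1 : Tendsto (fun s => ux u 1 s) (𝓝[>] 0) (𝓝 (ux u 1 0)) :=
    (B_cont_t hu.2.1 (by simp) 0 (by simp)).mono_left (nhdsWithin_mono _ Set.Ioi_subset_Ici_self)
  have h2 : Tendsto (fun s => u 1 s) (𝓝[>] 0) (𝓝 (u 1 0)) :=
    (B_cont_t hu.1 (by simp) 0 (by simp)).mono_left (nhdsWithin_mono _ Set.Ioi_subset_Ici_self)
  refine tendsto_nhds_unique h1 (h2.congr' ?_)
  filter_upwards [self_mem_nhdsWithin] with s hs using (hu.2.2.2.1 s hs).1.symm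

/-- finer upper gradient estimate for symmetric solutions.
With `u0` even, `1 ≤ u0 ≤ M0`, `0 < u0' < tan(πx/2)` on `(0,1)` and
`u0'(1) = u0(1)`, for every `t > 0` and `x ∈ (0,1)`:
`0 < u_x(x,t) < tan(πx/2)` and `-tan(πx/2) < u_x(-x,t) < 0`. -/
theorem stmt_11 (M0 : ℝ) (hM0 : 0 < M0) (u0 : ℝ → ℝ)
    (hu0C1 : ContDiffOn ℝ 1 u0 (Set.Icc (-1 : ℝ) 1))
    (heven : ∀ x ∈ Set.Icc (-1 : ℝ) 1, u0 x = u0 (-x))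
    (hbounds : ∀ x ∈ Set.Icc (-1 : ℝ) 1, 1 ≤ u0 x ∧ u0 x ≤ M0)
    (hslope : ∀ x ∈ Set.Ioo (0 : ℝ) 1,
      0 < derivWithin u0 (Set.Icc (-1 : ℝ) 1) x ∧
      derivWithin u0 (Set.Icc (-1 : ℝ) 1) x < Real.tan (π * x / 2))
    (hend : derivWithin u0 (Set.Icc (-1 : ℝ) 1) 1 = u0 1)
    (u : ℝ → ℝ → ℝ) (hu : IsGlobalSolB u u0) :
    ∀ t > (0 : ℝ), ∀ x ∈ Set.Ioo (0 : ℝ) 1,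
      (0 < ux u x t ∧ ux u x t < Real.tan (π * x / 2)) ∧
      (-Real.tan (π * x / 2) < ux u (-x) t ∧ ux u (-x) t < 0) := by
  intro t ht x hx
  have hpi := Real.pi_gt_three
  have hub : ∀ y ∈ Set.Icc (-1 : ℝ) 1, 1 ≤ u0 y := fun y hy => (hbounds y hy).1
  -- evenness
  have hev : ∀ s ∈ Set.Icc 0 t, ∀ y ∈ Set.Icc (-1 : ℝ) 1, u y s = u (-y) s := by
    intro s hs y hy
    have hy' : -y ∈ Set.Icc (-1 : ℝ) 1 := ⟨by linarith [hy.2], by linarith [hy.1]⟩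
    apply le_antisymm (B_even_le hu hu0C1 heven t y hy s hs)
    have := B_even_le hu hu0C1 heven t (-y) hy' s hs
    rwa [neg_neg] at this
  have hodd : ∀ s ∈ Set.Icc 0 t, ∀ y ∈ Set.Ioo (-1 : ℝ) 1, ux u (-y) s = - ux u y s := by
    intro s hs y hy
    have he : (fun z => u z s) =ᶠ[𝓝 y] fun z => u (-z) s := by
      filter_upwards [Icc_mem_nhds hy.1 hy.2] with z hz using hev s hs z hz
    have h1 : ux u y s = deriv (fun z => u (-z) s) y := he.deriv_eq
    rw [deriv_comp_neg (fun z => u z s) y] at h1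
    rw [h1, neg_neg, ux]
  have hzero : ∀ s ∈ Set.Icc 0 t, ux u 0 s = 0 := by
    intro s hs
    have := hodd s hs 0 (by norm_num)
    rw [neg_zero] at this
    linarith
  have hsub : Set.Ioo (0:ℝ) 1 ⊆ Set.Ioo (-1) 1 := Set.Ioo_subset_Ioo (by norm_num) le_rfl
  have hIcc : Set.Icc (0:ℝ) 1 ⊆ Set.Icc (-1) 1 := Set.Icc_subset_Icc (by norm_num) le_rfl
  have hwc : ContinuousOn (fun p : ℝ × ℝ => u p.1 p.2) (Set.Icc (0 : ℝ) 1 ×ˢ Set.Icc (0 : ℝ) t) :=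
    hu.1.mono (Set.prod_mono hIcc (fun s hs => hs.1))
  obtain ⟨a, ha⟩ : ∃ a, a = x / 2 := ⟨_, rfl⟩
  have ha0 : 0 < a := by rw [ha]; linarith [hx.1]
  have hax : a < x := by rw [ha]; linarith [hx.1]
  have ha1 : a < 1 := hax.trans hx.2
  have hacont : ContinuousOn (fun y => arctan (ux u y 0)) (Set.Icc a 1) :=
    Real.continuous_arctan.comp_continuousOn
      ((B_cont_x hu.2.1 le_rfl).mono (Set.Icc_subset_Icc (by linarith) le_rfl))
  have hslope' : ∀ y ∈ Set.Ioo (0 : ℝ) 1, 0 < ux u y 0 ∧ ux u y 0 < tan (π * y / 2) := by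
    intro y hy
    rw [(B_init hu hu0C1 (hsub hy)).2]
    exact hslope y hy
  have hatan : ∀ y ∈ Set.Ioo (0 : ℝ) 1, arctan (ux u y 0) < π * y / 2 := by
    intro y hy
    have h1 := Real.arctan_strictMono (hslope' y hy).2
    rwa [Real.arctan_tan (by nlinarith [hy.1]) (by nlinarith [hy.2])] at h1
  have hlow : 0 < ux u x t := by
    obtain ⟨y0, hy0, hmin⟩ := (isCompact_Icc (a := a) (b := 1)).exists_isMinOn
      ⟨1, ha1.le, le_rfl⟩ hacont
    have hm : 0 < arctan (ux u y0 0) := by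
      rw [Real.arctan_pos]
      rcases hy0.2.lt_or_eq with h | h
      · exact (hslope' y0 ⟨ha0.trans_le hy0.1, h⟩).1
      · rw [h, B_corner hu, hu.2.2.2.2 1 (by simp)]
        linarith [hub 1 (by simp)]
    have hn : 0 < arctan (1 / (2 + t)) := Real.arctan_pos.mpr (by positivity)
    obtain ⟨κ, hκ0, hκ⟩ := exists_between (lt_min (lt_min hm hn) one_pos)
    rw [lt_min_iff, lt_min_iff] at hκ
    obtain ⟨⟨hκ1, hκ2⟩, hκ3⟩ := hκ
    have hlo : ∀ y : ℝ, 0 ≤ y → -(π / 2) < κ * y + -(κ * a) := by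
      intro y hy
      have := mul_nonneg hκ0.le hy
      nlinarith
    have hhi : ∀ y : ℝ, y ≤ 1 → κ * y + -(κ * a) < κ := by
      intro y hy
      have := mul_le_mul_of_nonneg_left hy hκ0.le
      have := mul_pos hκ0 ha0
      linarith
    have key := grim_compare u (ux u) (uxx u) t κ (-(κ * a)) hκ0.ne'
      (fun y hy => ⟨hlo y hy.1, by linarith [hhi y hy.2]⟩) hwc
      (fun s hs y hy => (B_derivs hu hs.1 (hsub hy)).1)
      (fun s hs y hy => (B_derivs hu hs.1 (hsub hy)).2.1)
      (fun s hs y hy => (B_derivs hu hs.1 (hsub hy)).2.2)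
      (fun s hs => (B_derivs hu hs.1 (by norm_num)).1.hasDerivWithinAt)
      (fun s hs => B_right hu hs.1)
      (fun s hs => by
        rw [hzero s ⟨hs.1.le, hs.2⟩]
        apply aux_tan_lt
        · have := hlo 0 le_rfl
          linarith
        · rw [Real.arctan_zero]
          have := mul_pos hκ0 ha0
          linarith)
      (fun s hs => by
        have h1 := hlo 1 zero_le_one
        have h2 := hhi 1 le_rfl
        rw [mul_one] at h1 h2
        have h3 : tan (κ + -(κ * a)) < 1 / (2 + t) := aux_tan_lt h1 (h2.trans hκ2)
        rw [(hu.2.2.2.1 s hs.1).1]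
        have h4 := B_pos hu hub (T := t) 1 (by simp) s ⟨hs.1.le, hs.2⟩
        have h5 : 1 / (2 + t) ≤ 1 / (2 + s) := by
          have := hs.1
          exact one_div_le_one_div_of_le (by linarith) (by linarith [hs.2])
        linarith)
      (fun y hy => (B_init hu hu0C1 (hsub hy)).1)
      (fun y hy => by
        apply aux_tan_le (hlo y hy.1.le)
        rcases le_total y a with h | h
        · have h1 : 0 < arctan (ux u y 0) := Real.arctan_pos.mpr (hslope' y hy).1
          have := mul_le_mul_of_nonneg_left h hκ0.le
          linarith
        · have h1 : arctan (ux u y0 0) ≤ arctan (ux u y 0) := hmin ⟨h, hy.2.le⟩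
          linarith [hhi y hy.2.le])
    have h1 := key t ⟨ht, le_rfl⟩ x hx
    have h2 : 0 < tan (κ * x + -(κ * a)) := by
      apply Real.tan_pos_of_pos_of_lt_pi_div_two
      · have := mul_lt_mul_of_pos_left hax hκ0
        linarith
      · linarith [hhi x hx.2.le]
    linarith
  have hup : ux u x t < tan (π * x / 2) := by
    obtain ⟨K, hK0, hKb⟩ := B_bound hu t
    have hgc : ContinuousOn (fun y => π * y / 2 - arctan (ux u y 0)) (Set.Icc a 1) :=
      (by fun_prop : ContinuousOn (fun y : ℝ => π * y / 2) _).sub hacont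
    obtain ⟨y0, hy0, hmin⟩ := (isCompact_Icc (a := a) (b := 1)).exists_isMinOn
      ⟨1, ha1.le, le_rfl⟩ hgc
    have hm : 0 < π * y0 / 2 - arctan (ux u y0 0) := by
      rcases hy0.2.lt_or_eq with h | h
      · linarith [hatan y0 ⟨ha0.trans_le hy0.1, h⟩]
      · rw [h, mul_one]
        linarith [arctan_lt_pi_div_two (ux u 1 0)]
    have hn : 0 < π / 2 - arctan K := by linarith [arctan_lt_pi_div_two K]
    obtain ⟨κ, hκ0, hκ⟩ := exists_between (lt_min (lt_min hm hn) one_pos)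
    rw [lt_min_iff, lt_min_iff] at hκ
    obtain ⟨⟨hκ1, hκ2⟩, hκ3⟩ := hκ
    have hκa : 0 < κ * a := mul_pos hκ0 ha0
    have hκa1 : κ * a < κ := mul_lt_of_lt_one_right hκ0 ha1
    have hlo : ∀ y : ℝ, y ≤ 1 → -(π / 2) < -(π / 2 - κ) * y + -(κ * a) := by
      intro y hy
      have := mul_nonneg (by linarith : 0 ≤ π / 2 - κ) (sub_nonneg.mpr hy)
      linarith
    have hhi : ∀ y : ℝ, 0 ≤ y → -(π / 2 - κ) * y + -(κ * a) < 0 := by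
      intro y hy
      have := mul_nonneg (by linarith : 0 ≤ π / 2 - κ) hy
      linarith
    have key := grim_compare (fun y s => -u y s) (fun y s => -ux u y s) (fun y s => -uxx u y s) t
      (-(π / 2 - κ)) (-(κ * a)) (by linarith)
      (fun y hy => ⟨hlo y hy.2, by linarith [hhi y hy.1]⟩) hwc.neg
      (fun s hs y hy => (B_derivs hu hs.1 (hsub hy)).1.neg)
      (fun s hs y hy => (B_derivs hu hs.1 (hsub hy)).2.1.neg)
      (fun s hs y hy => by
        have := (B_derivs hu hs.1 (hsub hy)).2.2.neg
        refine this.congr_deriv ?_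
        rw [neg_sq, neg_div])
      (fun s hs => (B_derivs hu hs.1 (by norm_num)).1.neg.hasDerivWithinAt)
      (fun s hs => (B_right hu hs.1).neg)
      (fun s hs => by
        simp only [hzero s ⟨hs.1.le, hs.2⟩]
        rw [neg_zero]
        apply aux_tan_lt
        · linarith
        · rw [Real.arctan_zero]
          linarith)
      (fun s hs => by
        have h1 := hlo 1 le_rfl
        rw [mul_one] at h1
        apply aux_tan_lt h1
        rw [Real.arctan_neg]
        have h2 := (hKb 1 (by simp) s ⟨hs.1.le, hs.2⟩).2
        have h3 := Real.arctan_strictMono.monotone ((le_abs_self _).trans h2)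
        linarith)
      (fun y hy => (B_init hu hu0C1 (hsub hy)).1.neg)
      (fun y hy => by
        apply aux_tan_le (hlo y hy.2.le)
        rw [Real.arctan_neg]
        rcases le_total y a with h | h
        · have h1 := hatan y hy
          have := mul_le_mul_of_nonneg_left h hκ0.le
          linarith
        · have h1 : π * y0 / 2 - arctan (ux u y0 0) ≤ π * y / 2 - arctan (ux u y 0) :=
            hmin ⟨h, hy.2.le⟩
          have := mul_le_mul_of_nonneg_left hy.2.le hκ0.le
          linarith)
    have h1 := key t ⟨ht, le_rfl⟩ x hx
    have h2 : tan (-(π * x / 2)) < tan (-(π / 2 - κ) * x + -(κ * a)) := by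
      apply Real.strictMonoOn_tan
      · constructor <;> nlinarith [hx.1, hx.2]
      · exact ⟨hlo x hx.2.le, by linarith [hhi x hx.1.le]⟩
      · have := mul_lt_mul_of_pos_left hax hκ0
        linarith
    rw [Real.tan_neg] at h2
    linarith
  have ho := hodd t ⟨ht.le, le_rfl⟩ x (hsub hx)
  refine ⟨⟨hlow, hup⟩, ?_, ?_⟩
  · rw [ho]; linarith
  · rw [ho]; linarith
end

section
/- Let u be a time-global classical solution of problem (B) whose initial data u0 ∈ C^1([-1,1]) satisfies: u0 is even, 1 ≤ u0(x) ≤ M0 on [-1,1], 0 < u0'(x) < tan(πx/2) for x ∈ (0,1), and u0'(1) = u0(1). Then u(x,t+s) − u(0,s) converges, as s → ∞, to φ0(x) + (π/2)·t uniformly, together with its first x-derivative, second x-derivative and first t-derivative, on every compact subset of (-1,1)×ℝ, where φ0(x) := -(2/π)·ln(cos(πx/2)). -/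
open Real

/-- Weak maximum principle in existence form. -/
theorem wmp (F : ℝ → ℝ → ℝ) {α β t1 t2 m x0 t0 : ℝ} (hm : 0 < m)
    (hc : ContinuousOn (fun p : ℝ × ℝ => F p.1 p.2) (Set.Icc α β ×ˢ Set.Icc t1 t2))
    (hint : ∀ t ∈ Set.Ioc t1 t2, ∀ x ∈ Set.Ioo α β, IsLocalMax (fun y => F y t) x →
      ∃ d ≤ 0, HasDerivAt (fun s => F x s) d t)
    (hl : ∀ t ∈ Set.Ioc t1 t2, F α t ≤ 0 ∨ ∃ y ∈ Set.Icc α β, F α t < F y t)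
    (hr : ∀ t ∈ Set.Ioc t1 t2, F β t ≤ 0 ∨ ∃ y ∈ Set.Icc α β, F β t < F y t)
    (hx0 : x0 ∈ Set.Icc α β) (ht0 : t0 ∈ Set.Icc t1 t2) (hF : m ≤ F x0 t0) :
    ∃ x ∈ Set.Icc α β, m ≤ F x t1 := by
  by_contra hcon
  push Not at hcon
  have ht12 : t1 ≤ t2 := ht0.1.trans ht0.2
  -- bottom maximum
  have hcb : ContinuousOn (fun x => F x t1) (Set.Icc α β) := by
    have : ContinuousOn (fun x : ℝ => (x, t1)) (Set.Icc α β) := by fun_prop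
    exact hc.comp this (fun x hx => ⟨hx, le_refl _, ht12⟩)
  obtain ⟨xb, hxb, hxbmax⟩ := isCompact_Icc.exists_isMaxOn ⟨x0, hx0⟩ hcb
  set M := max (F xb t1) 0 with hM
  have hMm : M < m := max_lt (hcon xb hxb) hm
  have hbot : ∀ x ∈ Set.Icc α β, F x t1 ≤ M := fun x hx => (hxbmax hx).trans (le_max_left _ _)
  have hM0 : 0 ≤ M := le_max_right _ _
  set e := (m - M) / (2 * (t2 - t1 + 1)) with he
  have hpos : 0 < t2 - t1 + 1 := by linarith
  have he0 : 0 < e := by apply div_pos <;> linarith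
  have he1 : e * (t2 - t1 + 1) = (m - M) / 2 := by rw [he]; field_simp
  have hcH : ContinuousOn (fun p : ℝ × ℝ => F p.1 p.2 - e * (p.2 - t1))
      (Set.Icc α β ×ˢ Set.Icc t1 t2) := by
    apply hc.sub; fun_prop
  obtain ⟨⟨xs, ts⟩, ⟨hxs, hts⟩, hmax⟩ :=
    (isCompact_Icc.prod isCompact_Icc).exists_isMaxOn ⟨(x0, t0), hx0, ht0⟩ hcH
  simp only at hxs hts
  have hmax' : ∀ x ∈ Set.Icc α β, ∀ t ∈ Set.Icc t1 t2,
      F x t - e * (t - t1) ≤ F xs ts - e * (ts - t1) := fun x hx t ht =>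
    hmax (show (x, t) ∈ Set.Icc α β ×ˢ Set.Icc t1 t2 from ⟨hx, ht⟩)
  have hv : M < F xs ts - e * (ts - t1) := by
    have := hmax' x0 hx0 t0 ht0
    have h2 : e * (t0 - t1) ≤ e * (t2 - t1 + 1) := by
      apply mul_le_mul_of_nonneg_left _ he0.le; linarith [ht0.2]
    linarith
  have hts1 : t1 < ts := by
    rcases hts.1.lt_or_eq with h | h
    · exact h
    · exfalso
      rw [← h] at hv
      have := hbot xs hxs
      simp at hv
      linarith
  have hvF : M < F xs ts := by
    have : 0 ≤ e * (ts - t1) := by apply mul_nonneg he0.le; linarith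
    linarith
  have hspace : ∀ y ∈ Set.Icc α β, F y ts ≤ F xs ts := fun y hy => by
    have := hmax' y hy ts hts; linarith
  have htm : ts ∈ Set.Ioc t1 t2 := ⟨hts1, hts.2⟩
  have hxl : α < xs := by
    rcases hxs.1.lt_or_eq with h | h
    · exact h
    · exfalso
      rw [← h] at hvF hspace
      rcases hl ts htm with h1 | ⟨y, hy, h1⟩
      · linarith
      · linarith [hspace y hy]
  have hxr : xs < β := by
    rcases hxs.2.lt_or_eq with h | h
    · exact h
    · exfalso
      rw [h] at hvF hspace
      rcases hr ts htm with h1 | ⟨y, hy, h1⟩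
      · linarith
      · linarith [hspace y hy]
  have hloc : IsLocalMax (fun y => F y ts) xs := by
    filter_upwards [Icc_mem_nhds hxl hxr] with y hy using hspace y hy
  obtain ⟨d, hd, hder⟩ := hint ts htm xs ⟨hxl, hxr⟩ hloc
  have hslope := hder.hasDerivWithinAt (s := Set.Iio ts)
  rw [hasDerivWithinAt_iff_tendsto_slope' (by simp)] at hslope
  have hev : ∀ᶠ s in nhdsWithin ts (Set.Iio ts), e ≤ slope (fun s => F xs s) ts s := by
    filter_upwards [Ioo_mem_nhdsLT hts1] with s hs
    have := hmax' xs hxs s ⟨hs.1.le, hs.2.le.trans hts.2⟩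
    rw [slope_def_field, le_div_iff_of_neg (by linarith [hs.2])]
    nlinarith
  have := ge_of_tendsto hslope hev
  linarith

/-- Sturm-type lemma: the sign pattern (-,+,-) persists backwards in time. -/
theorem sturm (F : ℝ → ℝ → ℝ) {a b T0 T1 m : ℝ} (hm : 0 < m) (hT : T0 ≤ T1)
    (hc : ContinuousOn (fun p : ℝ × ℝ => F p.1 p.2) (Set.Icc a b ×ˢ Set.Icc T0 T1))
    (hmax : ∀ t ∈ Set.Ioc T0 T1, ∀ x ∈ Set.Ioo a b, IsLocalMax (fun y => F y t) x →
      ∃ d ≤ 0, HasDerivAt (fun s => F x s) d t)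
    (hmin : ∀ t ∈ Set.Ioc T0 T1, ∀ x ∈ Set.Ioo a b, IsLocalMin (fun y => F y t) x →
      ∃ d ≥ 0, HasDerivAt (fun s => F x s) d t)
    (hL : (∀ t ∈ Set.Icc T0 T1, F a t ≤ -m) ∨
      (∀ t ∈ Set.Ioc T0 T1, 0 ≤ F a t ∨ ∀ w > a, ∃ y ∈ Set.Icc a w, F y t < F a t))
    (hR : (∀ t ∈ Set.Icc T0 T1, F b t ≤ -m) ∨
      (∀ t ∈ Set.Ioc T0 T1, 0 ≤ F b t ∨ ∀ w < b, ∃ y ∈ Set.Icc w b, F y t < F b t))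
    (hpat : ∃ x y z, a ≤ x ∧ x < y ∧ y < z ∧ z ≤ b ∧ F x T1 ≤ -m ∧ m ≤ F y T1 ∧ F z T1 ≤ -m) :
    ∃ x y z, a ≤ x ∧ x < y ∧ y < z ∧ z ≤ b ∧ F x T0 ≤ -m ∧ m ≤ F y T0 ∧ F z T0 ≤ -m := by
  have huc := (isCompact_Icc.prod isCompact_Icc).uniformContinuousOn_of_continuous hc
  rw [Metric.uniformContinuousOn_iff] at huc
  obtain ⟨δ, hδ, huc⟩ := huc m hm
  have hosc : ∀ x ∈ Set.Icc a b, ∀ s ∈ Set.Icc T0 T1, ∀ t ∈ Set.Icc T0 T1, |s - t| < δ →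
      |F x s - F x t| < m := by
    intro x hx s hs t ht hst
    have := huc (x, s) ⟨hx, hs⟩ (x, t) ⟨hx, ht⟩ (by
      rw [Prod.dist_eq]; simp [Real.dist_eq, hst])
    simpa [Real.dist_eq] using this
  -- one step
  have step : ∀ t1 t2, T0 ≤ t1 → t1 ≤ t2 → t2 ≤ T1 → t2 - t1 < δ →
      (∃ x y z, a ≤ x ∧ x < y ∧ y < z ∧ z ≤ b ∧ F x t2 ≤ -m ∧ m ≤ F y t2 ∧ F z t2 ≤ -m) →
      ∃ x y z, a ≤ x ∧ x < y ∧ y < z ∧ z ≤ b ∧ F x t1 ≤ -m ∧ m ≤ F y t1 ∧ F z t1 ≤ -m := by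
    rintro t1 t2 h01 h12 h21 hd ⟨x, y, z, hax, hxy, hyz, hzb, hFx, hFy, hFz⟩
    have hy : y ∈ Set.Icc a b := ⟨by linarith, by linarith⟩
    have hsub : Set.Icc t1 t2 ⊆ Set.Icc T0 T1 := Set.Icc_subset_Icc h01 h21
    have hsub' : Set.Ioc t1 t2 ⊆ Set.Ioc T0 T1 := Set.Ioc_subset_Ioc h01 h21
    have hosc2 : ∀ x ∈ Set.Icc a b, ∀ s ∈ Set.Icc t1 t2, ∀ t ∈ Set.Icc t1 t2,
        |F x s - F x t| < m := by
      intro x hx s hs t ht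
      apply hosc x hx s (hsub hs) t (hsub ht)
      rw [abs_lt]; constructor <;> linarith [hs.1, hs.2, ht.1, ht.2]
    have hm1 : t1 ∈ Set.Icc t1 t2 := ⟨le_refl _, h12⟩
    have hm2 : t2 ∈ Set.Icc t1 t2 := ⟨h12, le_refl _⟩
    have hypos : ∀ t ∈ Set.Icc t1 t2, 0 < F y t := by
      intro t ht
      have := abs_lt.1 (hosc2 y hy t ht t2 hm2)
      linarith
    have hmaxN : ∀ t ∈ Set.Ioc t1 t2, ∀ x ∈ Set.Ioo a b, IsLocalMax (fun y => -F y t) x →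
      ∃ d ≤ 0, HasDerivAt (fun s => -F x s) d t := by
      intro t ht x hx hloc
      have : IsLocalMin (fun y => F y t) x := by
        have := hloc.neg
        simpa using this
      obtain ⟨d, hd, hder⟩ := hmin t (hsub' ht) x hx this
      exact ⟨-d, by linarith, hder.neg⟩
    have hX : ∃ x' ∈ Set.Icc a y, F x' t1 ≤ -m := by
      rcases hL with hL | hL
      · exact ⟨a, ⟨le_refl _, hy.1⟩, hL t1 (hsub hm1)⟩
      · have := wmp (fun x t => -F x t) (α := a) (β := y) (t1 := t1) (t2 := t2) (x0 := x) (t0 := t2)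
          hm
          ((hc.mono (Set.prod_mono (Set.Icc_subset_Icc_right hy.2) hsub)).neg)
          (fun t ht x hx => hmaxN t ht x ⟨hx.1, hx.2.trans_le hy.2⟩) ?_ ?_
          ⟨hax, hxy.le⟩ hm2 (by linarith)
        · obtain ⟨x', hx', h⟩ := this
          exact ⟨x', hx', by linarith⟩
        · intro t ht
          rcases hL t (hsub' ht) with h | h
          · left; linarith
          · right
            obtain ⟨w, hw, hw2⟩ := h y (by linarith)
            exact ⟨w, hw, by linarith⟩
        · intro t ht
          left
          linarith [hypos t ⟨ht.1.le, ht.2⟩]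
    have hZ : ∃ z' ∈ Set.Icc y b, F z' t1 ≤ -m := by
      rcases hR with hR | hR
      · exact ⟨b, ⟨hy.2, le_refl _⟩, hR t1 (hsub hm1)⟩
      · have := wmp (fun x t => -F x t) (α := y) (β := b) (t1 := t1) (t2 := t2) (x0 := z) (t0 := t2)
          hm
          ((hc.mono (Set.prod_mono (Set.Icc_subset_Icc_left hy.1) hsub)).neg)
          (fun t ht x hx => hmaxN t ht x ⟨hy.1.trans_lt hx.1, hx.2⟩) ?_ ?_
          ⟨hyz.le, hzb⟩ hm2 (by linarith)
        · obtain ⟨x', hx', h⟩ := this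
          exact ⟨x', hx', by linarith⟩
        · intro t ht
          left
          linarith [hypos t ⟨ht.1.le, ht.2⟩]
        · intro t ht
          rcases hR t (hsub' ht) with h | h
          · left; linarith
          · right
            obtain ⟨w, hw, hw2⟩ := h y (by linarith)
            exact ⟨w, hw, by linarith⟩
    obtain ⟨x', hx', hFx'⟩ := hX
    obtain ⟨z', hz', hFz'⟩ := hZ
    have hneg : ∀ w ∈ Set.Icc a b, F w t1 ≤ -m → ∀ t ∈ Set.Icc t1 t2, F w t ≤ 0 := by
      intro w hw h t ht
      have := abs_lt.1 (hosc2 w hw t ht t1 hm1)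
      linarith
    have hx'm : x' ∈ Set.Icc a b := ⟨hx'.1, hx'.2.trans hy.2⟩
    have hz'm : z' ∈ Set.Icc a b := ⟨hy.1.trans hz'.1, hz'.2⟩
    obtain ⟨y', hy', hFy'⟩ := wmp F (α := x') (β := z') (t1 := t1) (t2 := t2) (x0 := y) (t0 := t2)
      hm (hc.mono (Set.prod_mono (Set.Icc_subset_Icc hx'.1 hz'.2) hsub))
      (fun t ht x hx => hmax t (hsub' ht) x ⟨hx'.1.trans_lt hx.1, hx.2.trans_le hz'.2⟩)
      (fun t ht => Or.inl (hneg x' hx'm hFx' t ⟨ht.1.le, ht.2⟩))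
      (fun t ht => Or.inl (hneg z' hz'm hFz' t ⟨ht.1.le, ht.2⟩))
      ⟨hx'.2, hz'.1⟩ hm2 hFy
    refine ⟨x', y', z', hx'.1, lt_of_le_of_ne hy'.1 ?_, lt_of_le_of_ne hy'.2 ?_, hz'.2, hFx', hFy', hFz'⟩
    · rintro rfl; linarith
    · rintro rfl; linarith
  -- iterate
  have iter : ∀ n : ℕ, ∃ x y z, a ≤ x ∧ x < y ∧ y < z ∧ z ≤ b ∧
      F x (max T0 (T1 - n * (δ / 2))) ≤ -m ∧ m ≤ F y (max T0 (T1 - n * (δ / 2))) ∧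
      F z (max T0 (T1 - n * (δ / 2))) ≤ -m := by
    intro n
    induction n with
    | zero => simpa [hT] using hpat
    | succ n ih =>
      refine step _ _ (le_max_left _ _) ?_ ?_ ?_ ih
      · apply max_le_max le_rfl; push_cast; linarith
      · apply max_le hT
        have : 0 ≤ (n : ℝ) * (δ / 2) := by positivity
        linarith
      · have : max T0 (T1 - n * (δ / 2)) ≤ max T0 (T1 - (n + 1 : ℕ) * (δ / 2)) + δ / 2 := by
          apply max_le
          · linarith [le_max_left T0 (T1 - (n + 1 : ℕ) * (δ / 2))]
          · have := le_max_right T0 (T1 - (n + 1 : ℕ) * (δ / 2))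
            push_cast at this ⊢
            linarith
        linarith
  obtain ⟨n, hn⟩ := exists_nat_gt ((T1 - T0) / (δ / 2))
  rw [div_lt_iff₀ (by linarith)] at hn
  have := iter n
  rwa [max_eq_left (by linarith)] at this

/-- strict local maximum from the second derivative -/
theorem strict_max_of_second (f f' : ℝ → ℝ) (x f'' : ℝ)
    (h1 : ∀ᶠ y in nhds x, HasDerivAt f (f' y) y) (h2 : HasDerivAt f' f'' x)
    (h0 : f' x = 0) (hneg : f'' < 0) :
    ∃ e > 0, ∀ y, y ≠ x → |y - x| < e → f y < f x := by
  have hs := hasDerivAt_iff_tendsto_slope.1 h2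
  have hev : ∀ᶠ y in nhdsWithin x {x}ᶜ, slope f' x y < 0 := hs.eventually_lt_const hneg
  rw [eventually_nhdsWithin_iff] at hev
  obtain ⟨e, he, hb⟩ := Metric.eventually_nhds_iff.1 (hev.and h1)
  refine ⟨e, he, fun y hy hye => ?_⟩
  have hder : ∀ z, |z - x| < e → HasDerivAt f (f' z) z := fun z hz =>
    (hb (by rwa [Real.dist_eq])).2
  have hsl : ∀ z, |z - x| < e → z ≠ x → (f' z) / (z - x) < 0 := fun z hz hzx => by
    have := (hb (y := z) (by rwa [Real.dist_eq])).1 hzx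
    rwa [slope_def_field, h0, sub_zero] at this
  rcases lt_or_gt_of_ne hy with hlt | hgt
  · have hin : ∀ z ∈ Set.Icc y x, |z - x| < e := fun z hz => by
      rw [abs_lt] at hye ⊢; constructor <;> linarith [hz.1, hz.2]
    have : StrictMonoOn f (Set.Icc y x) := by
      apply strictMonoOn_of_deriv_pos (convex_Icc _ _)
      · exact fun z hz => (hder z (hin z hz)).continuousAt.continuousWithinAt
      · intro z hz
        rw [interior_Icc] at hz
        have hz' := hin z ⟨hz.1.le, hz.2.le⟩
        rw [(hder z hz').deriv]
        have := hsl z hz' hz.2.ne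
        rw [div_neg_iff] at this
        rcases this with h | h
        · exact h.1
        · linarith [hz.2, h.2]
    exact this ⟨le_refl _, hlt.le⟩ ⟨hlt.le, le_refl _⟩ hlt
  · have hin : ∀ z ∈ Set.Icc x y, |z - x| < e := fun z hz => by
      rw [abs_lt] at hye ⊢; constructor <;> linarith [hz.1, hz.2]
    have : StrictAntiOn f (Set.Icc x y) := by
      apply strictAntiOn_of_deriv_neg (convex_Icc _ _)
      · exact fun z hz => (hder z (hin z hz)).continuousAt.continuousWithinAt
      · intro z hz
        rw [interior_Icc] at hz
        have hz' := hin z ⟨hz.1.le, hz.2.le⟩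
        rw [(hder z hz').deriv]
        have := hsl z hz' hz.1.ne'
        rw [div_neg_iff] at this
        rcases this with h | h
        · linarith [hz.1, h.2]
        · exact h.1
    exact this ⟨le_refl _, hgt.le⟩ ⟨hgt.le, le_refl _⟩ hgt

theorem second_nonneg_of_localMin (f f' : ℝ → ℝ) (x f'' : ℝ)
    (h1 : ∀ᶠ y in nhds x, HasDerivAt f (f' y) y) (h2 : HasDerivAt f' f'' x)
    (h : IsLocalMin f x) : f' x = 0 ∧ 0 ≤ f'' := by
  have h0 := h.hasDerivAt_eq_zero h1.self_of_nhds
  refine ⟨h0, ?_⟩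
  by_contra hneg
  push Not at hneg
  obtain ⟨e, he, hb⟩ := strict_max_of_second f f' x f'' h1 h2 h0 hneg
  obtain ⟨e2, he2, hb2⟩ := Metric.eventually_nhds_iff.1 h
  have hm : 0 < min e e2 := lt_min he he2
  have ha : |x + min e e2 / 2 - x| = min e e2 / 2 := by
    rw [add_sub_cancel_left, abs_of_pos (by linarith)]
  have h3 := hb (x + min e e2 / 2) (by linarith) (by rw [ha]; linarith [min_le_left e e2])
  have h4 := hb2 (y := x + min e e2 / 2) (by rw [Real.dist_eq, ha]; linarith [min_le_right e e2])
  linarith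

theorem second_nonpos_of_localMax (f f' : ℝ → ℝ) (x f'' : ℝ)
    (h1 : ∀ᶠ y in nhds x, HasDerivAt f (f' y) y) (h2 : HasDerivAt f' f'' x)
    (h : IsLocalMax f x) : f' x = 0 ∧ f'' ≤ 0 := by
  have := second_nonneg_of_localMin (fun y => -f y) (fun y => -f' y) x (-f'')
    (h1.mono fun y hy => hy.neg) h2.neg h.neg
  constructor <;> linarith [this.1, this.2]

theorem right_end (f f' : ℝ → ℝ) {p q : ℝ} (hpq : p < q) (hf : ContinuousOn f (Set.Icc p q))
    (hf' : ContinuousOn f' (Set.Icc p q)) (hd : ∀ x ∈ Set.Ioo p q, HasDerivAt f (f' x) x)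
    (hq : 0 < f' q) : ∀ w < q, ∃ y ∈ Set.Icc w q, f y < f q := by
  intro w hw
  have h1 : ∀ᶠ y in nhdsWithin q (Set.Icc p q), 0 < f' y :=
    (hf' q ⟨hpq.le, le_refl _⟩).eventually_const_lt hq
  rw [nhdsWithin_Icc_eq_nhdsLE hpq] at h1
  obtain ⟨l, hl, hl2⟩ := (mem_nhdsLE_iff_exists_Ioc_subset).1 h1
  simp only [Set.mem_Iio] at hl
  set y := max (max w p) ((l + q) / 2) with hy
  have hyq : y < q := by
    rw [hy]; apply max_lt (max_lt hw hpq); linarith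
  have hyp : p ≤ y := (le_max_right _ _).trans (le_max_left _ _)
  have hyw : w ≤ y := (le_max_left _ _).trans (le_max_left _ _)
  have hyl : l < y := by
    have := le_max_right (max w p) ((l + q) / 2)
    rw [← hy] at this; linarith
  refine ⟨y, ⟨hyw, hyq.le⟩, ?_⟩
  have : StrictMonoOn f (Set.Icc y q) := by
    apply strictMonoOn_of_deriv_pos (convex_Icc _ _) (hf.mono (Set.Icc_subset_Icc_left hyp))
    intro z hz
    rw [interior_Icc] at hz
    rw [(hd z ⟨hyp.trans_lt hz.1, hz.2⟩).deriv]
    exact hl2 ⟨hyl.trans hz.1, hz.2.le⟩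
  exact this ⟨le_refl _, hyq.le⟩ ⟨hyq.le, le_refl _⟩ hyq

theorem left_end (f f' : ℝ → ℝ) {p q : ℝ} (hpq : p < q) (hf : ContinuousOn f (Set.Icc p q))
    (hf' : ContinuousOn f' (Set.Icc p q)) (hd : ∀ x ∈ Set.Ioo p q, HasDerivAt f (f' x) x)
    (hq : f' p < 0) : ∀ w > p, ∃ y ∈ Set.Icc p w, f y < f p := by
  intro w hw
  have hmaps : Set.MapsTo (fun x : ℝ => -x) (Set.Icc (-q) (-p)) (Set.Icc p q) := fun x hx =>
    ⟨by linarith [hx.2], by linarith [hx.1]⟩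
  obtain ⟨y, hy, h⟩ := right_end (fun x => f (-x)) (fun x => -f' (-x)) (p := -q) (q := -p)
    (by linarith) (hf.comp (by fun_prop) hmaps) ((hf'.comp (by fun_prop) hmaps).neg)
    (fun x hx => by
      have := (hd (-x) ⟨by linarith [hx.2], by linarith [hx.1]⟩).comp x (hasDerivAt_neg x)
      simpa [Function.comp_def] using this) (by simpa using hq) (-w) (by linarith)
  exact ⟨-y, ⟨by linarith [hy.2], by linarith [hy.1]⟩, by simpa using h⟩

/-- grim reaper profile -/
noncomputable def gr (k b x : ℝ) : ℝ := -(1 / k) * Real.log (Real.cos (k * x + b))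

theorem gr_nonneg {k : ℝ} (hk : 0 < k) (b x : ℝ) : 0 ≤ gr k b x := by
  unfold gr
  rw [neg_mul, neg_nonneg]
  apply mul_nonpos_of_nonneg_of_nonpos (by positivity)
  rw [← Real.log_abs]
  exact Real.log_nonpos (abs_nonneg _) (Real.abs_cos_le_one _)

theorem gr_le {k q : ℝ} (hk : 0 < k) (b x : ℝ) (hq : 0 < q) (h : q ≤ Real.cos (k * x + b)) :
    gr k b x ≤ -(1 / k) * Real.log q := by
  unfold gr
  rw [neg_mul, neg_mul, neg_le_neg_iff]
  exact mul_le_mul_of_nonneg_left (Real.log_le_log hq h) (by positivity)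

theorem cos_ge {y κ : ℝ} (h : |y| ≤ κ) (hκ : κ ≤ π) : Real.cos κ ≤ Real.cos y := by
  rw [← Real.cos_abs y]
  exact Real.cos_le_cos_of_nonneg_of_le_pi (abs_nonneg _) hκ h

theorem gr_hasDerivAt {k : ℝ} (hk : 0 < k) (b x : ℝ) (h : Real.cos (k * x + b) ≠ 0) :
    HasDerivAt (gr k b) (Real.tan (k * x + b)) x := by
  have h1 : HasDerivAt (fun x => k * x + b) k x := by
    simpa using ((hasDerivAt_id x).const_mul k).add_const b
  have := ((h1.cos).log h).const_mul (-(1 / k))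
  refine HasDerivAt.congr_deriv (f := gr k b) this ?_
  rw [Real.tan_eq_sin_div_cos]; field_simp

theorem tan_hasDerivAt (k b x : ℝ) (h : Real.cos (k * x + b) ≠ 0) :
    HasDerivAt (fun x => Real.tan (k * x + b)) (k * (1 + Real.tan (k * x + b) ^ 2)) x := by
  have h1 : HasDerivAt (fun x => k * x + b) k x := by
    simpa using ((hasDerivAt_id x).const_mul k).add_const b
  have := (Real.hasDerivAt_tan h).comp x h1
  refine HasDerivAt.congr_deriv this ?_
  rw [Real.tan_eq_sin_div_cos]
  have := Real.sin_sq_add_cos_sq (k * x + b)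
  field_simp
  linear_combination -k * this

noncomputable def DD (u : ℝ → ℝ → ℝ) (k b c x t : ℝ) : ℝ := u x t - (gr k b x + k * t + c)

section
variable {u : ℝ → ℝ → ℝ} {u0 : ℝ → ℝ}

theorem DD_x (hu : IsGlobalSolB u u0) {k b : ℝ} (c : ℝ) {x t : ℝ} (hk : 0 < k) (ht : 0 < t)
    (hx : x ∈ Set.Ioo (-1 : ℝ) 1) (h : Real.cos (k * x + b) ≠ 0) :
    HasDerivAt (fun y => DD u k b c y t) (ux u x t - Real.tan (k * x + b)) x := by
  have h1 : HasDerivAt (fun y => u y t) (ux u x t) x := (hu.2.2.1 t ht x hx).1.hasDerivAt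
  exact h1.sub (((gr_hasDerivAt hk b x h).add_const _).add_const _)

theorem DD_xx (hu : IsGlobalSolB u u0) {k b : ℝ} {x t : ℝ} (ht : 0 < t)
    (hx : x ∈ Set.Ioo (-1 : ℝ) 1) (h : Real.cos (k * x + b) ≠ 0) :
    HasDerivAt (fun y => ux u y t - Real.tan (k * y + b))
      (uxx u x t - k * (1 + Real.tan (k * x + b) ^ 2)) x := by
  have h1 : HasDerivAt (fun y => ux u y t) (uxx u x t) x := (hu.2.2.1 t ht x hx).2.1.hasDerivAt
  exact h1.sub (tan_hasDerivAt k b x h)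

theorem DD_t (hu : IsGlobalSolB u u0) {k b c : ℝ} {x t : ℝ} (ht : 0 < t)
    (hx : x ∈ Set.Ioo (-1 : ℝ) 1) :
    HasDerivAt (fun s => DD u k b c x s) (ut u x t - k) t := by
  have h1 : HasDerivAt (fun s => u x s) (ut u x t) t := (hu.2.2.1 t ht x hx).2.2.1.hasDerivAt
  have h2 : HasDerivAt (fun s => gr k b x + k * s + c) k t := by
    simpa using (((hasDerivAt_id t).const_mul k).const_add (gr k b x)).add_const c
  exact h1.sub h2

theorem DD_x_ev (hu : IsGlobalSolB u u0) {k b : ℝ} (c : ℝ) {x t : ℝ} (hk : 0 < k) (ht : 0 < t)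
    (hx : x ∈ Set.Ioo (-1 : ℝ) 1) (h : Real.cos (k * x + b) ≠ 0) :
    ∀ᶠ z in nhds x, HasDerivAt (fun y => DD u k b c y t) (ux u z t - Real.tan (k * z + b)) z := by
  have h1 : ∀ᶠ z in nhds x, Real.cos (k * z + b) ≠ 0 := by
    have : Continuous fun z : ℝ => Real.cos (k * z + b) := by fun_prop
    exact this.continuousAt.eventually_ne h
  filter_upwards [h1, Ioo_mem_nhds hx.1 hx.2] with z hz hz2
  exact DD_x hu c hk ht hz2 hz

theorem ut_eq (hu : IsGlobalSolB u u0) {x t : ℝ} (ht : 0 < t) (hx : x ∈ Set.Ioo (-1 : ℝ) 1) :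
    uxx u x t = ut u x t * (1 + ux u x t ^ 2) := by
  rw [(hu.2.2.1 t ht x hx).2.2.2]
  have : 1 + ux u x t ^ 2 ≠ 0 := by positivity
  field_simp

theorem DD_max (hu : IsGlobalSolB u u0) {k b c : ℝ} {x t : ℝ} (hk : 0 < k) (ht : 0 < t)
    (hx : x ∈ Set.Ioo (-1 : ℝ) 1) (h : Real.cos (k * x + b) ≠ 0)
    (hm : IsLocalMax (fun y => DD u k b c y t) x) :
    ∃ d ≤ 0, HasDerivAt (fun s => DD u k b c x s) d t := by
  refine ⟨_, ?_, DD_t hu ht hx⟩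
  obtain ⟨h1, h2⟩ := second_nonpos_of_localMax _ _ x _ (DD_x_ev hu c hk ht hx h)
    (DD_xx hu ht hx h) hm
  have h3 : ux u x t = Real.tan (k * x + b) := by linarith
  rw [ut_eq hu ht hx, h3] at h2
  have : 0 < 1 + Real.tan (k * x + b) ^ 2 := by positivity
  nlinarith

theorem DD_min (hu : IsGlobalSolB u u0) {k b c : ℝ} {x t : ℝ} (hk : 0 < k) (ht : 0 < t)
    (hx : x ∈ Set.Ioo (-1 : ℝ) 1) (h : Real.cos (k * x + b) ≠ 0)
    (hm : IsLocalMin (fun y => DD u k b c y t) x) :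
    ∃ d ≥ 0, HasDerivAt (fun s => DD u k b c x s) d t := by
  refine ⟨_, ?_, DD_t hu ht hx⟩
  obtain ⟨h1, h2⟩ := second_nonneg_of_localMin _ _ x _ (DD_x_ev hu c hk ht hx h)
    (DD_xx hu ht hx h) hm
  have h3 : ux u x t = Real.tan (k * x + b) := by linarith
  rw [ut_eq hu ht hx, h3] at h2
  have : 0 < 1 + Real.tan (k * x + b) ^ 2 := by positivity
  by_contra hc
  push Not at hc
  nlinarith

theorem gr_contOn {k b : ℝ} (hk : 0 < k) {s : Set ℝ} (h : ∀ x ∈ s, Real.cos (k * x + b) ≠ 0) :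
    ContinuousOn (gr k b) s := fun x hx =>
  (gr_hasDerivAt hk b x (h x hx)).continuousAt.continuousWithinAt

theorem DD_cont (hu : IsGlobalSolB u u0) {k b c p q T0 T1 : ℝ} (hk : 0 < k) (hp : -1 ≤ p)
    (hq : q ≤ 1) (hT : 0 ≤ T0)
    (h : ∀ x ∈ Set.Icc p q, Real.cos (k * x + b) ≠ 0) :
    ContinuousOn (fun z : ℝ × ℝ => DD u k b c z.1 z.2) (Set.Icc p q ×ˢ Set.Icc T0 T1) := by
  have h1 : ContinuousOn (fun z : ℝ × ℝ => u z.1 z.2) (Set.Icc p q ×ˢ Set.Icc T0 T1) :=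
    hu.1.mono (Set.prod_mono (Set.Icc_subset_Icc hp hq) (fun t ht => hT.trans ht.1))
  have h2 : ContinuousOn (fun z : ℝ × ℝ => gr k b z.1) (Set.Icc p q ×ˢ Set.Icc T0 T1) :=
    (gr_contOn hk h).comp continuousOn_fst (fun z hz => hz.1)
  have h3 : ContinuousOn (fun z : ℝ × ℝ => k * z.2) (Set.Icc p q ×ˢ Set.Icc T0 T1) := by fun_prop
  exact h1.sub ((h2.add h3).add continuousOn_const)

theorem u_slice (hu : IsGlobalSolB u u0) {t : ℝ} (ht : 0 ≤ t) :
    ContinuousOn (fun x => u x t) (Set.Icc (-1 : ℝ) 1) := by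
  have h0 : ContinuousOn (fun x : ℝ => (x, t)) (Set.Icc (-1 : ℝ) 1) := by fun_prop
  exact hu.1.comp h0 (fun x hx => ⟨hx, ht⟩)

theorem ux_slice (hu : IsGlobalSolB u u0) {t : ℝ} (ht : 0 ≤ t) :
    ContinuousOn (fun x => ux u x t) (Set.Icc (-1 : ℝ) 1) := by
  have h0 : ContinuousOn (fun x : ℝ => (x, t)) (Set.Icc (-1 : ℝ) 1) := by fun_prop
  exact hu.2.1.comp h0 (fun x hx => ⟨hx, ht⟩)

theorem DD_end_aux (hu : IsGlobalSolB u u0) {k b c p q t : ℝ} (hk : 0 < k) (ht : 0 < t)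
    (hp : -1 ≤ p) (hq : q ≤ 1)
    (h : ∀ x ∈ Set.Icc p q, Real.cos (k * x + b) ≠ 0) :
    ContinuousOn (fun x => DD u k b c x t) (Set.Icc p q) ∧
    ContinuousOn (fun x => ux u x t - Real.tan (k * x + b)) (Set.Icc p q) ∧
    ∀ x ∈ Set.Ioo p q, HasDerivAt (fun x => DD u k b c x t) (ux u x t - Real.tan (k * x + b)) x := by
  have hs : Set.Icc p q ⊆ Set.Icc (-1 : ℝ) 1 := Set.Icc_subset_Icc hp hq
  refine ⟨?_, ?_, ?_⟩
  · exact ((u_slice hu ht.le).mono hs).sub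
      (((gr_contOn hk h).add continuousOn_const).add continuousOn_const)
  · exact ((ux_slice hu ht.le).mono hs).sub
      (fun x hx => (tan_hasDerivAt k b x (h x hx)).continuousAt.continuousWithinAt)
  · intro x hx
    exact DD_x hu c hk ht ⟨hp.trans_lt hx.1, hx.2.trans_le hq⟩ (h x ⟨hx.1.le, hx.2.le⟩)

theorem DD_right (hu : IsGlobalSolB u u0) {k b c p t : ℝ} (hk : 0 < k) (ht : 0 < t)
    (hp : -1 ≤ p) (hp1 : p < 1)
    (h : ∀ x ∈ Set.Icc p 1, Real.cos (k * x + b) ≠ 0) (hb : Real.tan (k + b) < u 1 t) :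
    ∀ w < 1, ∃ y ∈ Set.Icc w 1, DD u k b c y t < DD u k b c 1 t := by
  obtain ⟨h1, h2, h3⟩ := DD_end_aux (c := c) hu hk ht hp le_rfl h
  apply right_end _ _ hp1 h1 h2 h3
  rw [(hu.2.2.2.1 t ht).1, mul_one]; linarith

theorem DD_left (hu : IsGlobalSolB u u0) {k b c q t : ℝ} (hk : 0 < k) (ht : 0 < t)
    (hq : q ≤ 1) (hq1 : -1 < q)
    (h : ∀ x ∈ Set.Icc (-1) q, Real.cos (k * x + b) ≠ 0) (hb : - u (-1) t < Real.tan (-k + b)) :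
    ∀ w > -1, ∃ y ∈ Set.Icc (-1) w, DD u k b c y t < DD u k b c (-1) t := by
  obtain ⟨h1, h2, h3⟩ := DD_end_aux (c := c) hu hk ht le_rfl hq h
  apply left_end _ _ hq1 h1 h2 h3
  rw [(hu.2.2.2.1 t ht).2, mul_neg_one]; linarith

end

theorem wmp2 (F : ℝ → ℝ → ℝ) {α β t1 t2 m x0 t0 : ℝ} (hm : 0 < m)
    (hc : ContinuousOn (fun p : ℝ × ℝ => F p.1 p.2) (Set.Icc α β ×ˢ Set.Icc t1 t2))
    (hint : ∀ t ∈ Set.Ioc t1 t2, ∀ x ∈ Set.Ioo α β, IsLocalMax (fun y => F y t) x →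
      ∃ d ≤ 0, HasDerivAt (fun s => F x s) d t)
    (hl : ∀ t ∈ Set.Ioc t1 t2, m < F α t ∨ ∃ y ∈ Set.Icc α β, F α t < F y t)
    (hr : ∀ t ∈ Set.Ioc t1 t2, m < F β t ∨ ∃ y ∈ Set.Icc α β, F β t < F y t)
    (hx0 : x0 ∈ Set.Icc α β) (ht0 : t0 ∈ Set.Icc t1 t2) (hF : m ≤ F x0 t0) :
    ∃ x ∈ Set.Icc α β, m ≤ F x t1 := by
  set K : Set (ℝ × ℝ) := (Set.Icc α β ×ˢ Set.Icc t1 t2) ∩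
    (fun p : ℝ × ℝ => F p.1 p.2) ⁻¹' (Set.Ici m) with hK
  have hKc : IsCompact K := by
    have hcl : IsClosed K := hc.preimage_isClosed_of_isClosed
      (isClosed_Icc.prod isClosed_Icc) isClosed_Ici
    exact (isCompact_Icc.prod isCompact_Icc).of_isClosed_subset hcl Set.inter_subset_left
  have hne : (Prod.snd '' K).Nonempty := ⟨t0, (x0, t0), ⟨⟨hx0, ht0⟩, hF⟩, rfl⟩
  obtain ⟨ts, ⟨⟨xs, ts'⟩, ⟨⟨hxs, hts⟩, hFs⟩, rfl⟩, hleast⟩ :=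
    (hKc.image continuous_snd).exists_isLeast hne
  simp only [Set.mem_preimage, Set.mem_Ici] at hxs hts hFs
  simp only at hleast
  have hle : ∀ t ∈ Set.Ioc t1 ts', ∀ x ∈ Set.Icc α β, F x t ≤ m := by
    have hlt : ∀ t, t1 ≤ t → t < ts' → ∀ x ∈ Set.Icc α β, F x t < m := by
      intro t h1 h2 x hx
      by_contra h
      push Not at h
      have := hleast ⟨(x, t), ⟨⟨hx, h1, (h2.le.trans hts.2)⟩, h⟩, rfl⟩
      exact absurd this (not_le.2 h2)
    intro t ht x hx
    rcases ht.2.lt_or_eq with h | h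
    · exact (hlt t ht.1.le h x hx).le
    · rw [h] at ht ⊢
      by_contra hcon
      push Not at hcon
      have hcx : ContinuousOn (fun s => F x s) (Set.Icc t1 ts') := by
        have h0 : ContinuousOn (fun s : ℝ => (x, s)) (Set.Icc t1 ts') := by fun_prop
        exact hc.comp h0 (fun s hs => ⟨hx, hs.1, hs.2.trans hts.2⟩)
      have hev : ∀ᶠ s in nhdsWithin ts' (Set.Icc t1 ts'), m < F x s :=
        (hcx ts' ⟨ht.1.le, le_refl _⟩).eventually_const_lt hcon
      rw [nhdsWithin_Icc_eq_nhdsLE ht.1] at hev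
      have hev2 := hev.filter_mono (nhdsWithin_mono _ Set.Iio_subset_Iic_self)
      obtain ⟨s, hs1, hs2⟩ := (hev2.and (Ioo_mem_nhdsLT ht.1)).exists
      linarith [hlt s hs2.1.le hs2.2 x hx]
  have hsub : Set.Ioc t1 ts' ⊆ Set.Ioc t1 t2 := Set.Ioc_subset_Ioc_right hts.2
  by_cases hαβ : α ≤ β
  · refine wmp F hm (hc.mono (Set.prod_mono le_rfl (Set.Icc_subset_Icc_right hts.2)))
      (fun t ht => hint t (hsub ht)) ?_ ?_ hxs ⟨hts.1, le_refl _⟩ hFs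
    · intro t ht
      right
      rcases hl t (hsub ht) with h | h
      · linarith [hle t ht α ⟨le_refl _, hαβ⟩]
      · exact h
    · intro t ht
      right
      rcases hr t (hsub ht) with h | h
      · linarith [hle t ht β ⟨hαβ, le_refl _⟩]
      · exact h
  · exact absurd (hx0.1.trans hx0.2) hαβ

theorem gr_blow_left {k b e : ℝ} (hk : 0 < k) (he : k * e + b = -(π / 2)) (B x : ℝ) (hx : e < x) :
    ∃ a, e < a ∧ a < x ∧ B ≤ gr k b a := by
  set s := min (min (Real.exp (-(k * B)) / k) (1 / k)) ((x - e) / 2) with hs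
  have hs0 : 0 < s := by
    rw [hs]; apply lt_min (lt_min (by positivity) (by positivity)); linarith
  have h1 : s ≤ Real.exp (-(k * B)) / k := (min_le_left _ _).trans (min_le_left _ _)
  have h2 : s ≤ 1 / k := (min_le_left _ _).trans (min_le_right _ _)
  have h3 : s ≤ (x - e) / 2 := min_le_right _ _
  refine ⟨e + s, by linarith, by linarith, ?_⟩
  rw [le_div_iff₀ hk] at h1 h2
  have hc : Real.cos (k * (e + s) + b) = Real.sin (s * k) := by
    rw [← Real.cos_sub_pi_div_two]; congr 1; linarith
  have hks : 0 < s * k := by positivity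
  have hsin : 0 < Real.sin (s * k) := Real.sin_pos_of_pos_of_lt_pi hks (by linarith [Real.pi_gt_three])
  unfold gr
  rw [hc]
  have hl : Real.log (Real.sin (s * k)) ≤ -(k * B) := by
    rw [Real.log_le_iff_le_exp hsin]
    exact (Real.sin_lt hks).le.trans h1
  have : -(1 / k) * Real.log (Real.sin (s * k)) = (-Real.log (Real.sin (s * k))) / k := by ring
  rw [this, le_div_iff₀ hk]
  linarith

theorem gr_neg (k b x : ℝ) : gr k b (-x) = gr k (-b) x := by
  unfold gr
  rw [← Real.cos_neg]; congr 3; ring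

theorem gr_blow_right {k b e : ℝ} (hk : 0 < k) (he : k * e + b = π / 2) (B x : ℝ) (hx : x < e) :
    ∃ a, x < a ∧ a < e ∧ B ≤ gr k b a := by
  obtain ⟨a, h1, h2, h3⟩ := gr_blow_left (k := k) (b := -b) (e := -e) hk (by linarith) B (-x)
    (by linarith)
  refine ⟨-a, by linarith, by linarith, ?_⟩
  rwa [gr_neg]

section
variable {u : ℝ → ℝ → ℝ} {u0 : ℝ → ℝ}

theorem cos_pos_abs {y : ℝ} (h : |y| < π / 2) : 0 < Real.cos y :=
  Real.cos_pos_of_mem_Ioo ⟨(abs_lt.1 h).1, (abs_lt.1 h).2⟩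

theorem DD_negmax (hu : IsGlobalSolB u u0) {k b c : ℝ} {x t : ℝ} (hk : 0 < k) (ht : 0 < t)
    (hx : x ∈ Set.Ioo (-1 : ℝ) 1) (h : Real.cos (k * x + b) ≠ 0)
    (hm : IsLocalMax (fun y => -DD u k b c y t) x) :
    ∃ d ≤ 0, HasDerivAt (fun s => -DD u k b c x s) d t := by
  have : IsLocalMin (fun y => DD u k b c y t) x := by simpa using hm.neg
  obtain ⟨d, hd, h⟩ := DD_min hu hk ht hx h this
  exact ⟨-d, by linarith, h.neg⟩

theorem DD_negmin (hu : IsGlobalSolB u u0) {k b c : ℝ} {x t : ℝ} (hk : 0 < k) (ht : 0 < t)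
    (hx : x ∈ Set.Ioo (-1 : ℝ) 1) (h : Real.cos (k * x + b) ≠ 0)
    (hm : IsLocalMin (fun y => -DD u k b c y t) x) :
    ∃ d ≥ 0, HasDerivAt (fun s => -DD u k b c x s) d t := by
  have : IsLocalMax (fun y => DD u k b c y t) x := by simpa using hm.neg
  obtain ⟨d, hd, h⟩ := DD_max hu hk ht hx h this
  exact ⟨-d, by linarith, h.neg⟩

theorem lower_growth (hu : IsGlobalSolB u u0) {k T0 A : ℝ} (hk : 0 < k) (hk2 : k < π / 2)
    (hT : 0 ≤ T0) (hA : Real.tan k < A) (h0 : ∀ x ∈ Set.Icc (-1 : ℝ) 1, A ≤ u x T0) :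
    ∀ t, T0 ≤ t → ∀ x ∈ Set.Icc (-1 : ℝ) 1, k * (t - T0) + A - gr k 0 1 ≤ u x t := by
  intro t0 ht0 x0 hx0
  set c := A - gr k 0 1 - k * T0 with hc
  have hck : 0 < Real.cos k := Real.cos_pos_of_mem_Ioo ⟨by linarith, hk2⟩
  have habs : ∀ x ∈ Set.Icc (-1 : ℝ) 1, Real.cos k ≤ Real.cos (k * x + 0) := by
    intro x hx
    apply cos_ge
    · rw [add_zero, abs_mul, abs_of_pos hk]
      have : |x| ≤ 1 := abs_le.2 hx
      nlinarith
    · linarith [Real.pi_pos]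
  have hcos : ∀ x ∈ Set.Icc (-1 : ℝ) 1, Real.cos (k * x + 0) ≠ 0 := fun x hx =>
    (hck.trans_le (habs x hx)).ne'
  have hgr : ∀ x ∈ Set.Icc (-1 : ℝ) 1, gr k 0 x ≤ gr k 0 1 := by
    intro x hx
    have := gr_le hk 0 x hck (habs x hx)
    simpa [gr] using this
  have hgr' : gr k 0 (-1) = gr k 0 1 := by rw [gr_neg]; simp
  by_contra hcon
  push Not at hcon
  set m0 := -DD u k 0 c x0 t0 with hm0
  have hm0p : 0 < m0 := by
    rw [hm0]; unfold DD
    have := gr_nonneg hk 0 x0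
    rw [hc]; linarith
  set m := min m0 ((A - Real.tan k) / 2) with hm
  have hmp : 0 < m := lt_min hm0p (by linarith)
  have hmA : m < A - Real.tan k := (min_le_right _ _).trans_lt (by linarith)
  obtain ⟨x, hx, hFx⟩ := wmp2 (fun x t => -DD u k 0 c x t) (α := -1) (β := 1) (t1 := T0) (t2 := t0)
    (m := m) (x0 := x0) (t0 := t0) hmp ((DD_cont hu hk le_rfl le_rfl hT hcos).neg)
    (fun t ht x hx hm => DD_negmax hu hk (hT.trans_lt ht.1) hx (hcos x ⟨hx.1.le, hx.2.le⟩) hm)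
    (by
      intro t ht
      by_cases hlt : m < -DD u k 0 c (-1) t
      · exact Or.inl hlt
      · right
        obtain ⟨y, hy, h⟩ := DD_left (c := c) hu hk (hT.trans_lt ht.1) le_rfl (by norm_num) hcos
          (by
            rw [add_zero, Real.tan_neg]
            unfold DD at hlt
            rw [hgr', hc] at hlt
            nlinarith [ht.1]) 1 (by norm_num)
        exact ⟨y, hy, by linarith⟩)
    (by
      intro t ht
      by_cases hlt : m < -DD u k 0 c 1 t
      · exact Or.inl hlt
      · right
        obtain ⟨y, hy, h⟩ := DD_right (c := c) hu hk (hT.trans_lt ht.1) le_rfl (by norm_num) hcos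
          (by
            rw [add_zero]
            unfold DD at hlt
            rw [hc] at hlt
            nlinarith [ht.1]) (-1) (by norm_num)
        exact ⟨y, hy, by linarith⟩)
    hx0 ⟨ht0, le_refl _⟩ (min_le_left _ _)
  simp only [DD, hc] at hFx
  linarith [h0 x hx, hgr x hx]

theorem u_large (hu : IsGlobalSolB u u0) (h1 : ∀ x ∈ Set.Icc (-1 : ℝ) 1, 1 ≤ u0 x) (R : ℝ) :
    ∃ T > 0, ∀ t ≥ T, ∀ x ∈ Set.Icc (-1 : ℝ) 1, R ≤ u x t := by
  have hpi := Real.pi_pos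
  have htan : Real.tan (π / 8) < 1 := by
    rw [← Real.tan_pi_div_four]
    exact Real.tan_lt_tan_of_nonneg_of_lt_pi_div_two (by linarith) (by linarith) (by linarith)
  have := lower_growth hu (k := π / 8) (T0 := 0) (A := 1) (by linarith) (by linarith) le_rfl htan
    (fun x hx => by rw [hu.2.2.2.2 x hx]; exact h1 x hx)
  set C := gr (π / 8) 0 1
  refine ⟨max 1 ((R + C) / (π / 8)), by positivity, fun t ht x hx => ?_⟩
  have ht1 : 1 ≤ t := (le_max_left _ _).trans ht
  have ht2 : (R + C) / (π / 8) ≤ t := (le_max_right _ _).trans ht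
  rw [div_le_iff₀ (by linarith)] at ht2
  have := this t (by linarith) x hx
  linarith

theorem growth (hu : IsGlobalSolB u u0) (h1 : ∀ x ∈ Set.Icc (-1 : ℝ) 1, 1 ≤ u0 x) {k : ℝ}
    (hk : 0 < k) (hk2 : k < π / 2) :
    ∃ C T : ℝ, ∀ t ≥ T, ∀ x ∈ Set.Icc (-1 : ℝ) 1, k * t - C ≤ u x t := by
  obtain ⟨T, hT, h⟩ := u_large hu h1 (Real.tan k + 1)
  refine ⟨k * T - (Real.tan k + 1) + gr k 0 1, T, fun t ht x hx => ?_⟩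
  have := lower_growth hu hk hk2 hT.le (by linarith : Real.tan k < Real.tan k + 1) (h T le_rfl)
    t ht x hx
  linarith

theorem u_bdd (hu : IsGlobalSolB u u0) {T0 T1 : ℝ} (hT0 : 0 ≤ T0) :
    ∃ B > 0, ∀ t ∈ Set.Icc T0 T1, ∀ x ∈ Set.Icc (-1 : ℝ) 1, |u x t| ≤ B := by
  have hc : ContinuousOn (fun p : ℝ × ℝ => u p.1 p.2) (Set.Icc (-1 : ℝ) 1 ×ˢ Set.Icc T0 T1) :=
    hu.1.mono (Set.prod_mono le_rfl (fun t ht => hT0.trans ht.1))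
  obtain ⟨B, hB⟩ := (isCompact_Icc.prod isCompact_Icc).exists_bound_of_continuousOn hc
  refine ⟨max B 1, by positivity, fun t ht x hx => ?_⟩
  have := hB (x, t) ⟨hx, ht⟩
  rw [Real.norm_eq_abs] at this
  exact this.trans (le_max_left _ _)

theorem ux_bdd (hu : IsGlobalSolB u u0) {t : ℝ} (ht : 0 ≤ t) :
    ∃ B > 0, ∀ x ∈ Set.Icc (-1 : ℝ) 1, |ux u x t| ≤ B := by
  obtain ⟨B, hB⟩ := isCompact_Icc.exists_bound_of_continuousOn (ux_slice hu ht)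
  refine ⟨max B 1, by positivity, fun x hx => ?_⟩
  have := hB x hx
  rw [Real.norm_eq_abs] at this
  exact this.trans (le_max_left _ _)

theorem upper_bound (hu : IsGlobalSolB u u0) {M0 : ℝ}
    (h1 : ∀ x ∈ Set.Icc (-1 : ℝ) 1, u0 x ≤ M0) :
    ∀ t ≥ 0, ∀ x ∈ Set.Ioo (-1 : ℝ) 1, u x t ≤ gr (π / 2) 0 x + π / 2 * t + M0 := by
  intro t0 ht0 x0 hx0
  have hpi := Real.pi_pos
  have hk : 0 < π / 2 := by linarith
  by_contra hcon
  push Not at hcon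
  obtain ⟨B, hB0, hB⟩ := u_bdd hu (T0 := 0) (T1 := t0) le_rfl
  obtain ⟨a, ha1, ha2, ha3⟩ := gr_blow_left (k := π / 2) (b := 0) (e := -1) hk (by ring) (B - M0)
    x0 hx0.1
  obtain ⟨b, hb1, hb2, hb3⟩ := gr_blow_right (k := π / 2) (b := 0) (e := 1) hk (by ring) (B - M0)
    x0 hx0.2
  have hcos : ∀ x ∈ Set.Icc a b, Real.cos (π / 2 * x + 0) ≠ 0 := by
    intro x hx
    apply ne_of_gt
    apply Real.cos_pos_of_mem_Ioo
    constructor <;> nlinarith [hx.1, hx.2]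
  obtain ⟨x, hx, hF⟩ := wmp (fun x t => DD u (π / 2) 0 M0 x t) (α := a) (β := b) (t1 := 0) (t2 := t0)
    (m := DD u (π / 2) 0 M0 x0 t0) (x0 := x0) (t0 := t0) (by unfold DD; linarith)
    (DD_cont hu hk ha1.le hb2.le le_rfl hcos)
    (fun t ht x hx hm => DD_max hu hk ht.1 ⟨ha1.trans hx.1, hx.2.trans hb2⟩
      (hcos x ⟨hx.1.le, hx.2.le⟩) hm)
    (by
      intro t ht
      left
      have := (abs_le.1 (hB t ⟨ht.1.le, ht.2⟩ a ⟨ha1.le, by linarith⟩)).2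
      unfold DD
      have := mul_pos hk ht.1
      linarith)
    (by
      intro t ht
      left
      have := (abs_le.1 (hB t ⟨ht.1.le, ht.2⟩ b ⟨by linarith, hb2.le⟩)).2
      unfold DD
      have := mul_pos hk ht.1
      linarith)
    ⟨ha2.le, hb1.le⟩ ⟨ht0, le_refl _⟩ le_rfl
  have hx1 : x ∈ Set.Icc (-1 : ℝ) 1 := ⟨by linarith [hx.1], by linarith [hx.2]⟩
  have h2 := h1 x hx1
  rw [← hu.2.2.2.2 x hx1] at h2
  have h3 := gr_nonneg hk 0 x
  simp only [DD] at hF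
  linarith

end

theorem neg_deriv_pts {f : ℝ → ℝ} {f' x l r : ℝ} (h : HasDerivAt f f' x) (hneg : f' < 0)
    (h0 : f x = 0) (hl : l < x) (hr : x < r) :
    ∃ x1 x2, l < x1 ∧ x1 < x ∧ x < x2 ∧ x2 < r ∧ 0 < f x1 ∧ f x2 < 0 := by
  have hs := hasDerivAt_iff_tendsto_slope.1 h
  have hev : ∀ᶠ y in nhdsWithin x {x}ᶜ, slope f x y < 0 := hs.eventually_lt_const hneg
  have hevl : ∀ᶠ y in nhdsWithin x (Set.Iio x), slope f x y < 0 :=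
    hev.filter_mono (nhdsWithin_mono x (fun y hy => ne_of_lt hy))
  have hevr : ∀ᶠ y in nhdsWithin x (Set.Ioi x), slope f x y < 0 :=
    hev.filter_mono (nhdsWithin_mono x (fun y hy => ne_of_gt hy))
  obtain ⟨x1, h1, h2⟩ := (hevl.and (Ioo_mem_nhdsLT hl)).exists
  obtain ⟨x2, h3, h4⟩ := (hevr.and (Ioo_mem_nhdsGT hr)).exists
  rw [slope_def_field, h0, sub_zero, div_neg_iff] at h1 h3
  refine ⟨x1, x2, h2.1, h2.2, h4.1, h4.2, ?_, ?_⟩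
  · rcases h1 with h | h
    · exact h.1
    · linarith [h.2, h2.2]
  · rcases h3 with h | h
    · linarith [h.2, h4.1]
    · exact h.1

section
variable {u : ℝ → ℝ → ℝ} {u0 : ℝ → ℝ}

theorem slope_lower (hu : IsGlobalSolB u u0) (h1 : ∀ x ∈ Set.Icc (-1 : ℝ) 1, 1 ≤ u0 x)
    {d ε : ℝ} (hd : 0 < d) (hε : 0 < ε) :
    ∃ T > 0, ∀ t ≥ T, ∀ x, -1 + d ≤ x → x < 1 → π / 2 * x - ε ≤ Real.arctan (ux u x t) := by
  obtain ⟨η, hη, hη1, hη2, hη3⟩ : ∃ η : ℝ, 0 < η ∧ η ≤ ε / 4 ∧ η ≤ d / 4 ∧ η ≤ 1 / 4 :=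
    ⟨min (min (ε / 4) (d / 4)) (1 / 4), lt_min (lt_min (by positivity) (by positivity)) (by norm_num),
      (min_le_left _ _).trans (min_le_left _ _), (min_le_left _ _).trans (min_le_right _ _),
      min_le_right _ _⟩
  have hpi := Real.pi_gt_three
  set k := π / 2 - η with hk
  set b := -(2 * η) with hb
  have hk1 : 1 < k := by rw [hk]; linarith
  have hk0 : 0 < k := by linarith
  obtain ⟨T0, hT0, hT0u⟩ := u_large hu h1 (Real.tan (k + b) + 1)
  obtain ⟨C1, T', hgrow⟩ := growth hu h1 (k := π / 2 - η / 2) (by linarith) (by linarith)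
  obtain ⟨B, hB, hBu⟩ := u_bdd hu (T1 := T0) hT0.le
  set q := Real.cos (π / 2 - η) with hq
  have hq0 : 0 < q := Real.cos_pos_of_mem_Ioo ⟨by linarith, by linarith⟩
  set Q := -(1 / k) * Real.log q with hQ
  -- time beyond which everything works
  set T2 := (B + C1 + Q + 1) / (η / 2) with hT2
  refine ⟨max (max T0 T') T2 + 1, by linarith [le_max_left T0 T', le_max_left (max T0 T') T2], ?_⟩
  intro t0 ht0 x0 hx0 hx01
  have htT0 : T0 < t0 := by linarith [le_max_left T0 T', le_max_left (max T0 T') T2]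
  have htT' : T' ≤ t0 := by linarith [le_max_right T0 T', le_max_left (max T0 T') T2]
  have htT2 : T2 < t0 := by linarith [le_max_right (max T0 T') T2]
  rw [hT2, div_lt_iff₀ (by positivity)] at htT2
  have hxI : x0 ∈ Set.Icc (-1 : ℝ) 1 := ⟨by linarith, hx01.le⟩
  have hxI' : x0 ∈ Set.Ioo (-1 : ℝ) 1 := ⟨by linarith, hx01⟩
  have hlow : -(π / 2) + η ≤ k * x0 + b := by
    have : 0 ≤ k * (x0 - (-1 + d)) := mul_nonneg hk0.le (by linarith)
    have : d ≤ k * d := by nlinarith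
    rw [hb]; nlinarith
  have hup : k * x0 + b ≤ π / 2 - η := by
    have : k * x0 ≤ k := by nlinarith
    rw [hb]; linarith
  by_contra hcon
  push Not at hcon
  have hcmp : π / 2 * x0 - ε ≤ k * x0 + b := by
    rw [hk, hb]; nlinarith
  have hux : ux u x0 t0 < Real.tan (k * x0 + b) := by
    have h2 : Real.arctan (ux u x0 t0) < k * x0 + b := hcon.trans_le hcmp
    have h3 := Real.tan_lt_tan_of_lt_of_lt_pi_div_two (Real.neg_pi_div_two_lt_arctan _)
      (by linarith) h2
    rwa [Real.tan_arctan] at h3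
  have hgr0 : gr k b x0 ≤ Q := gr_le hk0 b x0 hq0
    (cos_ge (abs_le.2 ⟨by linarith, hup⟩) (by linarith))
  set c := u x0 t0 - gr k b x0 - k * t0 with hc
  have hDD0 : DD u k b c x0 t0 = 0 := by unfold DD; rw [hc]; ring
  set e := (-(π / 2) - b) / k with he
  have hke : k * e + b = -(π / 2) := by rw [he]; field_simp; ring
  have he1 : -1 < e := by
    rw [he, lt_div_iff₀ hk0, hb, hk]; linarith
  have hex : e < x0 := by
    by_contra hh
    push Not at hh
    have := mul_le_mul_of_nonneg_left hh hk0.le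
    linarith
  have hcosI : ∀ x, e < x → x ≤ 1 → Real.cos (k * x + b) ≠ 0 := by
    intro x hx hx1
    have h2 := mul_lt_mul_of_pos_left hx hk0
    have h3 := mul_le_mul_of_nonneg_left hx1 hk0.le
    exact (Real.cos_pos_of_mem_Ioo ⟨by linarith, by rw [hb]; linarith⟩).ne'
  have ht00 : 0 < t0 := hT0.trans htT0
  obtain ⟨x1, x2, hx1, hx1', hx2, hx2', hf1, hf2⟩ :=
    neg_deriv_pts (DD_x hu c hk0 ht00 hxI' (hcosI x0 hex hx01.le)) (by linarith) hDD0 hex hx01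
  obtain ⟨B2, hB2, hB2u⟩ := u_bdd hu (T1 := t0) hT0.le
  obtain ⟨a, ha1, ha2, ha3⟩ := gr_blow_left hk0 hke (B2 + 1 - c) x1 hx1
  set m := min 1 (min (DD u k b c x1 t0) (-DD u k b c x2 t0)) with hm
  have hm0 : 0 < m := lt_min one_pos (lt_min hf1 (by linarith))
  have hm1 : m ≤ 1 := min_le_left _ _
  have hm2 : m ≤ DD u k b c x1 t0 := (min_le_right _ _).trans (min_le_left _ _)
  have hm3 : m ≤ -DD u k b c x2 t0 := (min_le_right _ _).trans (min_le_right _ _)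
  have hLa : ∀ t ∈ Set.Icc T0 t0, DD u k b c a t ≤ -m := by
    intro t ht
    have := (abs_le.1 (hB2u t ht a ⟨by linarith, by linarith⟩)).2
    have h5 : 0 ≤ k * t := mul_nonneg hk0.le (hT0.le.trans ht.1)
    unfold DD; linarith
  obtain ⟨x, y, z, hax, hxy, hyz, hz1, hFx, hFy, hFz⟩ := sturm (fun x t => DD u k b c x t) (a := a)
    (b := 1) (T0 := T0) (T1 := t0) (m := m) hm0 htT0.le
    (DD_cont hu hk0 (by linarith) le_rfl hT0.le (fun x hx => hcosI x (by linarith [hx.1]) hx.2))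
    (fun t ht x hx => DD_max hu hk0 (hT0.trans ht.1) ⟨by linarith [hx.1], hx.2⟩
      (hcosI x (by linarith [hx.1]) hx.2.le))
    (fun t ht x hx => DD_min hu hk0 (hT0.trans ht.1) ⟨by linarith [hx.1], hx.2⟩
      (hcosI x (by linarith [hx.1]) hx.2.le))
    (Or.inl hLa)
    (Or.inr (fun t ht => Or.inr (DD_right hu hk0 (hT0.trans ht.1) (by linarith : -1 ≤ a)
      (by linarith) (fun x hx => hcosI x (by linarith [hx.1]) hx.2)
      (by linarith [hT0u t ht.1.le 1 ⟨by norm_num, le_rfl⟩]))))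
    ⟨a, x1, x2, le_rfl, ha2, hx1'.trans hx2, hx2'.le, hLa t0 ⟨htT0.le, le_rfl⟩, hm2, by
      show DD u k b c x2 t0 ≤ -m
      linarith⟩
  have hyB := (abs_le.1 (hBu T0 ⟨le_rfl, le_rfl⟩ y ⟨by linarith, by linarith⟩)).2
  have hg := hgrow t0 htT' x0 hxI
  have hgy := gr_nonneg hk0 b y
  have hkT : 0 ≤ k * T0 := by positivity
  simp only [DD] at hFy
  have : (π / 2 - η / 2) * t0 = k * t0 + t0 * (η / 2) := by rw [hk]; ring
  linarith

theorem reflect_sol (hu : IsGlobalSolB u u0) :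
    IsGlobalSolB (fun x t => u (-x) t) (fun x => u0 (-x)) ∧
    ∀ x t, ux (fun x t => u (-x) t) x t = -ux u (-x) t := by
  have hux : ∀ x t, ux (fun x t => u (-x) t) x t = -ux u (-x) t := by
    intro x t
    unfold ux
    exact deriv_comp_neg (fun y => u y t) x
  have huxx : ∀ x t, uxx (fun x t => u (-x) t) x t = uxx u (-x) t := by
    intro x t
    unfold uxx
    simp only [hux]
    have := deriv_comp_neg (fun y => -ux u y t) x
    rw [this]
    simp
  refine ⟨⟨?_, ?_, ?_, ?_, ?_⟩, hux⟩
  · have h0 : ContinuousOn (fun p : ℝ × ℝ => (-p.1, p.2)) (Set.Icc (-1 : ℝ) 1 ×ˢ Set.Ici (0 : ℝ)) := by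
      fun_prop
    exact hu.1.comp h0 (fun p hp => ⟨⟨by linarith [hp.1.2], by linarith [hp.1.1]⟩, hp.2⟩)
  · have h0 : ContinuousOn (fun p : ℝ × ℝ => (-p.1, p.2)) (Set.Icc (-1 : ℝ) 1 ×ˢ Set.Ici (0 : ℝ)) := by
      fun_prop
    simp only [hux]
    exact (hu.2.1.comp h0 (fun p hp => ⟨⟨by linarith [hp.1.2], by linarith [hp.1.1]⟩, hp.2⟩)).neg
  · intro t ht x hx
    obtain ⟨h1, h2, h3, h4⟩ := hu.2.2.1 t ht (-x) ⟨by linarith [hx.2], by linarith [hx.1]⟩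
    refine ⟨?_, ?_, h3, ?_⟩
    · exact h1.comp x differentiableAt_id.neg
    · simp only [hux]
      exact (h2.comp x differentiableAt_id.neg).neg
    · rw [huxx, hux, neg_sq]
      exact h4
  · intro t ht
    obtain ⟨h1, h2⟩ := hu.2.2.2.1 t ht
    constructor
    · rw [hux, h2]; simp
    · rw [hux, neg_neg, h1]; simp
  · intro x hx
    exact hu.2.2.2.2 (-x) ⟨by linarith [hx.2], by linarith [hx.1]⟩

theorem slope_lim (hu : IsGlobalSolB u u0) (h1 : ∀ x ∈ Set.Icc (-1 : ℝ) 1, 1 ≤ u0 x)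
    {d ε : ℝ} (hd : 0 < d) (hε : 0 < ε) :
    ∃ T > 0, ∀ t ≥ T, ∀ x, |x| ≤ 1 - d → |Real.arctan (ux u x t) - π / 2 * x| ≤ ε := by
  obtain ⟨T1, hT1, H1⟩ := slope_lower hu h1 hd hε
  obtain ⟨hv, hvx⟩ := reflect_sol hu
  obtain ⟨T2, hT2, H2⟩ := slope_lower hv
    (fun x hx => h1 (-x) ⟨by linarith [hx.2], by linarith [hx.1]⟩) hd hε
  refine ⟨max T1 T2, lt_max_of_lt_left hT1, fun t ht x hx => ?_⟩
  rw [abs_le] at hx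
  have a1 := H1 t ((le_max_left _ _).trans ht) x (by linarith) (by linarith)
  have a2 := H2 t ((le_max_right _ _).trans ht) (-x) (by linarith) (by linarith)
  rw [hvx, neg_neg, Real.arctan_neg] at a2
  rw [abs_le]; constructor <;> linarith
end
section
variable {u : ℝ → ℝ → ℝ} {u0 : ℝ → ℝ}

theorem strict_pts {f : ℝ → ℝ} {x e d : ℝ} (he : 0 < e) (hd : 0 < d)
    (h : ∀ y, y ≠ x → |y - x| < e → f y < f x) :
    ∃ r, 0 < r ∧ r < d ∧ f (x - r) < f x ∧ f (x + r) < f x := by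
  have hm : 0 < min e d := lt_min he hd
  have h1 := min_le_left e d
  have h2 := min_le_right e d
  refine ⟨min e d / 2, by linarith, by linarith, h _ (by linarith) ?_, h _ (by linarith) ?_⟩ <;>
  · rw [abs_lt]; constructor <;> linarith

theorem ut_lower (hu : IsGlobalSolB u u0) (h1 : ∀ x ∈ Set.Icc (-1 : ℝ) 1, 1 ≤ u0 x)
    {d η : ℝ} (hd : 0 < d) (hη : 0 < η) (hη1 : η < π / 4) :
    ∃ T > 0, ∀ t ≥ T, ∀ x, |x| ≤ 1 - d → π / 2 - η ≤ ut u x t := by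
  by_cases hd1 : 1 < d
  · exact ⟨1, one_pos, fun t _ x hx => absurd (abs_nonneg x) (by linarith)⟩
  push Not at hd1
  have hpi := Real.pi_gt_three
  have hηd : 0 < η * d := by positivity
  have hηd1 : η * d ≤ η := by nlinarith
  set k := π / 2 - η with hk
  have hk0 : 0 < k := by linarith
  set κ := π / 2 - η * d / 2 with hκ
  obtain ⟨T3, hT3, hslope⟩ := slope_lim hu h1 hd (ε := η * d / 2) (by positivity)
  obtain ⟨T0, hT0, hT0u⟩ := u_large hu h1 (Real.tan κ + 1)
  obtain ⟨C1, T', hgrow⟩ := growth hu h1 (k := π / 2 - η / 2) (by linarith) (by linarith)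
  obtain ⟨B, hB, hBu⟩ := u_bdd hu (T1 := T0) hT0.le
  set q := Real.cos κ with hq
  have hq0 : 0 < q := Real.cos_pos_of_mem_Ioo ⟨by linarith, by linarith⟩
  set Q := -(1 / k) * Real.log q with hQ
  set T2 := (B + C1 + Q + 1) / (η / 2) with hT2
  refine ⟨max (max T0 T') (max T2 T3) + 1, by
    linarith [le_max_left T0 T', le_max_left (max T0 T') (max T2 T3)], ?_⟩
  intro t0 ht0 x0 hx0
  have htT0 : T0 < t0 := by linarith [le_max_left T0 T', le_max_left (max T0 T') (max T2 T3)]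
  have htT' : T' ≤ t0 := by linarith [le_max_right T0 T', le_max_left (max T0 T') (max T2 T3)]
  have htT2 : T2 < t0 := by linarith [le_max_left T2 T3, le_max_right (max T0 T') (max T2 T3)]
  have htT3 : T3 ≤ t0 := by linarith [le_max_right T2 T3, le_max_right (max T0 T') (max T2 T3)]
  rw [hT2, div_lt_iff₀ (by positivity)] at htT2
  have hx0' := abs_le.1 hx0
  have hxI : x0 ∈ Set.Icc (-1 : ℝ) 1 := ⟨by linarith, by linarith⟩
  have hxI' : x0 ∈ Set.Ioo (-1 : ℝ) 1 := ⟨by linarith, by linarith⟩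
  have hsl := abs_le.1 (hslope t0 htT3 x0 hx0)
  by_contra hcon
  push Not at hcon
  set b := Real.arctan (ux u x0 t0) - k * x0 with hb
  have hb1 : |b| ≤ η - η * d / 2 := by
    have e1 : b = (Real.arctan (ux u x0 t0) - π / 2 * x0) + η * x0 := by rw [hb, hk]; ring
    have e2 : η * x0 ≤ η * (1 - d) := mul_le_mul_of_nonneg_left hx0'.2 hη.le
    have e3 : η * (-(1 - d)) ≤ η * x0 := mul_le_mul_of_nonneg_left hx0'.1 hη.le
    rw [abs_le, e1]; constructor <;> linarith
  have hb2 := abs_le.1 hb1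
  have hang : ∀ x ∈ Set.Icc (-1 : ℝ) 1, |k * x + b| ≤ κ := by
    intro x hx
    have e2 := mul_le_mul_of_nonneg_left hx.2 hk0.le
    have e3 := mul_le_mul_of_nonneg_left hx.1 hk0.le
    rw [abs_le, hκ]; constructor <;> linarith
  have hcosq : ∀ x ∈ Set.Icc (-1 : ℝ) 1, q ≤ Real.cos (k * x + b) := fun x hx =>
    cos_ge (hang x hx) (by linarith)
  have hcosI : ∀ x ∈ Set.Icc (-1 : ℝ) 1, Real.cos (k * x + b) ≠ 0 := fun x hx =>
    (hq0.trans_le (hcosq x hx)).ne'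
  have hgr0 : gr k b x0 ≤ Q := gr_le hk0 b x0 hq0 (hcosq x0 hxI)
  have htan0 : Real.tan (k * x0 + b) = ux u x0 t0 := by
    rw [hb, add_sub_cancel, Real.tan_arctan]
  have ht00 : 0 < t0 := hT0.trans htT0
  set c0 := u x0 t0 - gr k b x0 - k * t0 with hc0
  have hneg : uxx u x0 t0 - k * (1 + Real.tan (k * x0 + b) ^ 2) < 0 := by
    rw [htan0, ut_eq hu ht00 hxI']
    have : 0 < 1 + ux u x0 t0 ^ 2 := by positivity
    nlinarith
  obtain ⟨e, he, hmax⟩ := strict_max_of_second _ _ x0 _ (DD_x_ev hu c0 hk0 ht00 hxI' (hcosI x0 hxI))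
    (DD_xx hu ht00 hxI' (hcosI x0 hxI)) (by rw [htan0, sub_self]) hneg
  obtain ⟨r, hr0, hrd, hf1, hf2⟩ := strict_pts he hd hmax
  have hDD0 : DD u k b c0 x0 t0 = 0 := by unfold DD; rw [hc0]; ring
  rw [hDD0] at hf1 hf2
  set m := min (-DD u k b c0 (x0 - r) t0) (-DD u k b c0 (x0 + r) t0) / 2 with hm
  have hm0 : 0 < m := by
    have : 0 < min (-DD u k b c0 (x0 - r) t0) (-DD u k b c0 (x0 + r) t0) :=
      lt_min (by linarith) (by linarith)
    linarith
  have hm1 : 2 * m ≤ -DD u k b c0 (x0 - r) t0 := by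
    have := min_le_left (-DD u k b c0 (x0 - r) t0) (-DD u k b c0 (x0 + r) t0)
    linarith
  have hm2 : 2 * m ≤ -DD u k b c0 (x0 + r) t0 := by
    have := min_le_right (-DD u k b c0 (x0 - r) t0) (-DD u k b c0 (x0 + r) t0)
    linarith
  have hshift : ∀ x t, DD u k b (c0 - m) x t = DD u k b c0 x t + m := by
    intro x t; unfold DD; ring
  have htanκ : ∀ x ∈ Set.Icc (-1 : ℝ) 1, |Real.tan (k * x + b)| ≤ Real.tan κ := by
    intro x hx
    have hh := abs_le.1 (hang x hx)
    have hmono : ∀ y z : ℝ, -(π / 2) < y → z < π / 2 → y ≤ z → Real.tan y ≤ Real.tan z := by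
      intro y z hy hz hyz
      rcases hyz.eq_or_lt with h | h
      · rw [h]
      · exact (Real.tan_lt_tan_of_lt_of_lt_pi_div_two hy hz h).le
    rw [abs_le, ← Real.tan_neg]
    exact ⟨hmono _ _ (by linarith) (by linarith) hh.1, hmono _ _ (by linarith) (by linarith) hh.2⟩
  obtain ⟨x, y, z, hax, hxy, hyz, hz1, hFx, hFy, hFz⟩ := sturm (fun x t => DD u k b (c0 - m) x t)
    (a := -1) (b := 1) (T0 := T0) (T1 := t0) (m := m) hm0 htT0.le
    (DD_cont hu hk0 le_rfl le_rfl hT0.le hcosI)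
    (fun t ht x hx => DD_max hu hk0 (hT0.trans ht.1) hx (hcosI x ⟨hx.1.le, hx.2.le⟩))
    (fun t ht x hx => DD_min hu hk0 (hT0.trans ht.1) hx (hcosI x ⟨hx.1.le, hx.2.le⟩))
    (Or.inr (fun t ht => Or.inr (DD_left hu hk0 (hT0.trans ht.1) le_rfl (by norm_num) hcosI (by
      have e1 := hT0u t ht.1.le (-1) ⟨le_rfl, by norm_num⟩
      have e2 := (abs_le.1 (htanκ (-1) ⟨le_rfl, by norm_num⟩)).1
      rw [mul_neg_one] at e2
      linarith))))
    (Or.inr (fun t ht => Or.inr (DD_right hu hk0 (hT0.trans ht.1) le_rfl (by norm_num) hcosI (by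
      have e1 := hT0u t ht.1.le 1 ⟨by norm_num, le_rfl⟩
      have e2 := (abs_le.1 (htanκ 1 ⟨by norm_num, le_rfl⟩)).2
      rw [mul_one] at e2
      linarith))))
    ⟨x0 - r, x0, x0 + r, by linarith, by linarith, by linarith, by linarith, by
      simp only [hshift]; linarith, by simp only [hshift]; linarith, by
      simp only [hshift]; linarith⟩
  have hyB := (abs_le.1 (hBu T0 ⟨le_rfl, le_rfl⟩ y ⟨by linarith, by linarith⟩)).2
  have hg := hgrow t0 htT' x0 hxI
  have hgy := gr_nonneg hk0 b y
  have hkT : 0 ≤ k * T0 := by positivity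
  simp only [DD] at hFy
  have : (π / 2 - η / 2) * t0 = k * t0 + t0 * (η / 2) := by rw [hk]; ring
  linarith
end
section
variable {u : ℝ → ℝ → ℝ} {u0 : ℝ → ℝ}

set_option maxHeartbeats 1600000 in
theorem ut_upper (hu : IsGlobalSolB u u0) (h1 : ∀ x ∈ Set.Icc (-1 : ℝ) 1, 1 ≤ u0 x) {M0 : ℝ}
    (hM : ∀ x ∈ Set.Icc (-1 : ℝ) 1, u0 x ≤ M0)
    {d η : ℝ} (hd : 0 < d) (hη : 0 < η) :
    ∃ T > 0, ∀ t ≥ T, ∀ x, |x| ≤ 1 - d → ut u x t ≤ π / 2 + η := by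
  by_cases hd1 : 1 < d
  · exact ⟨1, one_pos, fun t _ x hx => absurd (abs_nonneg x) (by linarith)⟩
  push Not at hd1
  have hpi := Real.pi_gt_three
  have hηd : 0 < η * d := by positivity
  have hηd1 : η * d ≤ η := by nlinarith
  set k := π / 2 + η with hk
  have hk0 : 0 < k := by linarith
  obtain ⟨T3, hT3, hslope⟩ := slope_lim hu h1 hd (ε := η * d / 2) (by positivity)
  obtain ⟨B, hB, hBu⟩ := u_bdd hu (T1 := 1) (zero_le_one (α := ℝ))
  obtain ⟨L, hL, hLu⟩ := ux_bdd hu (zero_le_one (α := ℝ))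
  set α := Real.arctan L with hα
  have hα1 : α < π / 2 := Real.arctan_lt_pi_div_two _
  have hα0 : 0 < α := Real.arctan_pos.2 hL
  have hcα : 0 < Real.cos α := Real.cos_arctan_pos L
  set Qα := -(1 / k) * Real.log (Real.cos α) with hQα
  have hqd : 0 < Real.cos (π / 2 * (1 - d)) :=
    Real.cos_pos_of_mem_Ioo ⟨by nlinarith, by nlinarith⟩
  set Q0 := -(1 / (π / 2)) * Real.log (Real.cos (π / 2 * (1 - d))) with hQ0
  set T2 := (Qα + B + k + Q0 + M0 + 1) / η with hT2
  refine ⟨max (max 1 T3) T2 + 1, by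
    linarith [le_max_left 1 T3, le_max_left (max 1 T3) T2], ?_⟩
  intro t0 ht0 x0 hx0
  have htT0 : 1 < t0 := by linarith [le_max_left 1 T3, le_max_left (max 1 T3) T2]
  have htT3 : T3 ≤ t0 := by linarith [le_max_right 1 T3, le_max_left (max 1 T3) T2]
  have htT2 : T2 < t0 := by linarith [le_max_right (max 1 T3) T2]
  rw [hT2, div_lt_iff₀ hη] at htT2
  have hx0' := abs_le.1 hx0
  have hxI : x0 ∈ Set.Icc (-1 : ℝ) 1 := ⟨by linarith, by linarith⟩
  have hxI' : x0 ∈ Set.Ioo (-1 : ℝ) 1 := ⟨by linarith, by linarith⟩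
  have hsl := abs_le.1 (hslope t0 htT3 x0 hx0)
  by_contra hcon
  push Not at hcon
  set b := Real.arctan (ux u x0 t0) - k * x0 with hb
  have hb1 : |b| ≤ η - η * d / 2 := by
    have e1 : b = (Real.arctan (ux u x0 t0) - π / 2 * x0) - η * x0 := by rw [hb, hk]; ring
    have e2 : η * x0 ≤ η * (1 - d) := mul_le_mul_of_nonneg_left hx0'.2 hη.le
    have e3 : η * (-(1 - d)) ≤ η * x0 := mul_le_mul_of_nonneg_left hx0'.1 hη.le
    rw [abs_le, e1]; constructor <;> linarith
  have hb2 := abs_le.1 hb1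
  set xl := (-(π / 2) - b) / k with hxl
  set xr := (π / 2 - b) / k with hxr
  have hkl : k * xl + b = -(π / 2) := by rw [hxl]; field_simp; ring
  have hkr : k * xr + b = π / 2 := by rw [hxr]; field_simp; ring
  have hxl1 : -1 < xl := by rw [hxl, lt_div_iff₀ hk0, hk]; linarith
  have hxr1 : xr < 1 := by rw [hxr, div_lt_iff₀ hk0, hk]; linarith
  have hθ : k * x0 + b = Real.arctan (ux u x0 t0) := by rw [hb]; ring
  have hxlx : xl < x0 := by
    rw [hxl, div_lt_iff₀ hk0]
    linarith [Real.neg_pi_div_two_lt_arctan (ux u x0 t0)]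
  have hxrx : x0 < xr := by
    rw [hxr, lt_div_iff₀ hk0]
    linarith [Real.arctan_lt_pi_div_two (ux u x0 t0)]
  have hangl : ∀ x, xl < x → -(π / 2) < k * x + b := by
    intro x h2
    have := mul_lt_mul_of_pos_left h2 hk0
    linarith
  have hangr : ∀ x, x < xr → k * x + b < π / 2 := by
    intro x h2
    have := mul_lt_mul_of_pos_left h2 hk0
    linarith
  have hcosI : ∀ x, xl < x → x < xr → Real.cos (k * x + b) ≠ 0 := fun x h2 h3 =>
    (Real.cos_pos_of_mem_Ioo ⟨hangl x h2, hangr x h3⟩).ne'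
  have htan0 : Real.tan (k * x0 + b) = ux u x0 t0 := by rw [hθ, Real.tan_arctan]
  have ht00 : 0 < t0 := by linarith
  set c0 := u x0 t0 - gr k b x0 - k * t0 with hc0
  have hneg : -(uxx u x0 t0 - k * (1 + Real.tan (k * x0 + b) ^ 2)) < 0 := by
    rw [htan0, ut_eq hu ht00 hxI']
    have : 0 < 1 + ux u x0 t0 ^ 2 := by positivity
    nlinarith
  have hc00 := hcosI x0 hxlx hxrx
  obtain ⟨e, he, hmax⟩ := strict_max_of_second (fun y => -DD u k b c0 y t0)
    (fun y => -(ux u y t0 - Real.tan (k * y + b))) x0 _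
    ((DD_x_ev hu c0 hk0 ht00 hxI' hc00).mono fun y hy => hy.neg)
    (DD_xx hu ht00 hxI' hc00).neg (by rw [htan0, sub_self, neg_zero]) hneg
  obtain ⟨r, hr0, hrd, hf1, hf2⟩ := strict_pts he (d := min (x0 - xl) (xr - x0))
    (lt_min (by linarith) (by linarith)) hmax
  have hr1 : r < x0 - xl := hrd.trans_le (min_le_left _ _)
  have hr2 : r < xr - x0 := hrd.trans_le (min_le_right _ _)
  have hDD0 : DD u k b c0 x0 t0 = 0 := by unfold DD; rw [hc0]; ring
  simp only [hDD0] at hf1 hf2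
  obtain ⟨m, hm0, hm1, hm2⟩ : ∃ m > 0, 2 * m ≤ DD u k b c0 (x0 - r) t0 ∧
      2 * m ≤ DD u k b c0 (x0 + r) t0 := by
    have h3 := min_le_left (DD u k b c0 (x0 - r) t0) (DD u k b c0 (x0 + r) t0)
    have h4 := min_le_right (DD u k b c0 (x0 - r) t0) (DD u k b c0 (x0 + r) t0)
    have h5 : 0 < min (DD u k b c0 (x0 - r) t0) (DD u k b c0 (x0 + r) t0) :=
      lt_min (by linarith) (by linarith)
    exact ⟨min (DD u k b c0 (x0 - r) t0) (DD u k b c0 (x0 + r) t0) / 2, by linarith, by linarith,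
      by linarith⟩
  have hshift : ∀ x t, DD u k b (c0 + m) x t = DD u k b c0 x t - m := by
    intro x t; unfold DD; ring
  obtain ⟨B2, hB2, hB2u⟩ := u_bdd hu (T1 := t0) (zero_le_one (α := ℝ))
  obtain ⟨a, ha1, ha2, ha3⟩ := gr_blow_left hk0 hkl (B2 - (c0 + m)) (x0 - r) (by linarith)
  obtain ⟨a', ha1', ha2', ha3'⟩ := gr_blow_right hk0 hkr (B2 - (c0 + m)) (x0 + r) (by linarith)
  have hend : ∀ w ∈ Set.Icc (-1 : ℝ) 1, B2 - (c0 + m) ≤ gr k b w → ∀ t ∈ Set.Ioc 1 t0,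
      0 ≤ -DD u k b (c0 + m) w t := by
    intro w hw hgw t ht
    have e1 := (abs_le.1 (hB2u t ⟨ht.1.le, ht.2⟩ w hw)).2
    have e2 : 0 ≤ k * t := mul_nonneg hk0.le (by linarith [ht.1])
    unfold DD; linarith
  obtain ⟨x, y, z, hax, hxy, hyz, hz1, hFx, hFy, hFz⟩ := sturm (fun x t => -DD u k b (c0 + m) x t)
    (a := a) (b := a') (T0 := 1) (T1 := t0) (m := m) hm0 htT0.le
    ((DD_cont hu hk0 (by linarith) (by linarith) zero_le_one
      (fun x hx => hcosI x (by linarith [hx.1]) (by linarith [hx.2]))).neg)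
    (fun t ht x hx => DD_negmax hu hk0 (by linarith [ht.1])
      ⟨by linarith [hx.1], by linarith [hx.2]⟩
      (hcosI x (by linarith [hx.1]) (by linarith [hx.2])))
    (fun t ht x hx => DD_negmin hu hk0 (by linarith [ht.1])
      ⟨by linarith [hx.1], by linarith [hx.2]⟩
      (hcosI x (by linarith [hx.1]) (by linarith [hx.2])))
    (Or.inr (fun t ht => Or.inl (hend a ⟨by linarith, by linarith⟩ ha3 t ht)))
    (Or.inr (fun t ht => Or.inl (hend a' ⟨by linarith, by linarith⟩ ha3' t ht)))
    ⟨x0 - r, x0, x0 + r, by linarith, by linarith, by linarith, by linarith, by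
      simp only [hshift]; linarith, by simp only [hshift]; linarith, by
      simp only [hshift]; linarith⟩
  have hyB := (abs_le.1 (hBu 1 ⟨le_rfl, le_rfl⟩ y ⟨by linarith, by linarith⟩)).1
  have hub := upper_bound hu hM t0 ht00.le x0 hxI'
  have hgr0 : gr (π / 2) 0 x0 ≤ Q0 := by
    refine gr_le (by positivity) 0 x0 hqd (cos_ge ?_ (by nlinarith))
    rw [add_zero, abs_mul, abs_of_pos (by positivity : 0 < π / 2)]
    exact mul_le_mul_of_nonneg_left hx0 (by positivity)
  have hgx0 := gr_nonneg hk0 b x0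
  have hbig : Qα < gr k b y := by
    have hFy' := hFy
    simp only [DD] at hFy'
    have : k * t0 = π / 2 * t0 + t0 * η := by rw [hk]; ring
    linarith
  have hyα : α < |k * y + b| := by
    by_contra hh
    push Not at hh
    have := gr_le hk0 b y hcα (cos_ge hh (by linarith))
    linarith
  have htanα : Real.tan α = L := Real.tan_arctan L
  rcases lt_abs.1 hyα with hpos | hnegc
  · obtain ⟨g1, g2, g3⟩ := DD_end_aux (c := c0 + m) hu hk0 one_pos (p := y) (q := z) (by linarith)
      (by linarith) (fun w hw => hcosI w (by linarith [hw.1]) (by linarith [hw.2]))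
    have hanti : StrictAntiOn (fun w => DD u k b (c0 + m) w 1) (Set.Icc y z) := by
      apply strictAntiOn_of_deriv_neg (convex_Icc _ _) g1
      intro w hw
      rw [interior_Icc] at hw
      rw [(g3 w hw).deriv]
      have e1 := (abs_le.1 (hLu w ⟨by linarith [hw.1], by linarith [hw.2]⟩)).2
      have e2 := mul_lt_mul_of_pos_left hw.1 hk0
      have e3 := Real.tan_lt_tan_of_lt_of_lt_pi_div_two (by linarith : -(π / 2) < α)
        (hangr w (by linarith [hw.2])) (by linarith : α < k * w + b)
      linarith
    have := hanti ⟨le_rfl, hyz.le⟩ ⟨hyz.le, le_rfl⟩ hyz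
    simp only at this
    linarith
  · obtain ⟨g1, g2, g3⟩ := DD_end_aux (c := c0 + m) hu hk0 one_pos (p := x) (q := y) (by linarith)
      (by linarith) (fun w hw => hcosI w (by linarith [hw.1]) (by linarith [hw.2]))
    have hmono : StrictMonoOn (fun w => DD u k b (c0 + m) w 1) (Set.Icc x y) := by
      apply strictMonoOn_of_deriv_pos (convex_Icc _ _) g1
      intro w hw
      rw [interior_Icc] at hw
      rw [(g3 w hw).deriv]
      have e1 := (abs_le.1 (hLu w ⟨by linarith [hw.1], by linarith [hw.2]⟩)).1
      have e2 := mul_lt_mul_of_pos_left hw.2 hk0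
      have e3 := Real.tan_lt_tan_of_lt_of_lt_pi_div_two
        (hangl w (by linarith [hw.1])) (by linarith : -α < π / 2) (by linarith : k * w + b < -α)
      rw [Real.tan_neg] at e3
      linarith
    have := hmono ⟨le_rfl, hxy.le⟩ ⟨hxy.le, le_rfl⟩ hxy
    simp only at this
    linarith
end
section
variable {u : ℝ → ℝ → ℝ} {u0 : ℝ → ℝ}

theorem ux_lim (hu : IsGlobalSolB u u0) (h1 : ∀ x ∈ Set.Icc (-1 : ℝ) 1, 1 ≤ u0 x)
    {d ε : ℝ} (hd : 0 < d) (hε : 0 < ε) :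
    ∃ T > 0, ∀ t ≥ T, ∀ x, |x| ≤ 1 - d → |ux u x t - Real.tan (π / 2 * x)| < ε := by
  have hpi := Real.pi_gt_three
  set κ := π / 2 * (1 - d / 2) with hκ
  have hκ1 : κ < π / 2 := by rw [hκ]; nlinarith
  have hcont : ContinuousOn Real.tan (Set.Icc (-κ) κ) :=
    Real.continuousOn_tan_Ioo.mono (fun y hy => ⟨by linarith [hy.1], by linarith [hy.2]⟩)
  have huc := isCompact_Icc.uniformContinuousOn_of_continuous hcont
  rw [Metric.uniformContinuousOn_iff] at huc
  obtain ⟨δ, hδ, hδ2⟩ := huc ε hε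
  obtain ⟨T, hT, H⟩ := slope_lim hu h1 hd (ε := min (δ / 2) (π / 2 * (d / 2)))
    (lt_min (by positivity) (by positivity))
  refine ⟨T, hT, fun t ht x hx => ?_⟩
  have h2 := H t ht x hx
  have h3 := abs_le.1 (h2.trans (min_le_right _ _))
  have hx' := abs_le.1 hx
  have e1 : π / 2 * x ≤ π / 2 * (1 - d) := mul_le_mul_of_nonneg_left hx'.2 (by positivity)
  have e2 : π / 2 * (-(1 - d)) ≤ π / 2 * x := mul_le_mul_of_nonneg_left hx'.1 (by positivity)
  have e3 : 0 < π / 2 * (d / 2) := by positivity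
  have h4 := hδ2 (Real.arctan (ux u x t)) ⟨by rw [hκ]; linarith, by rw [hκ]; linarith⟩ (π / 2 * x)
    ⟨by rw [hκ]; linarith, by rw [hκ]; linarith⟩
    (by rw [Real.dist_eq]; linarith [h2.trans (min_le_left _ _)])
  rwa [Real.tan_arctan, Real.dist_eq] at h4

theorem ut_lim (hu : IsGlobalSolB u u0) (h1 : ∀ x ∈ Set.Icc (-1 : ℝ) 1, 1 ≤ u0 x) {M0 : ℝ}
    (hM : ∀ x ∈ Set.Icc (-1 : ℝ) 1, u0 x ≤ M0) {d ε : ℝ} (hd : 0 < d) (hε : 0 < ε) :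
    ∃ T > 0, ∀ t ≥ T, ∀ x, |x| ≤ 1 - d → |ut u x t - π / 2| < ε := by
  have hpi := Real.pi_gt_three
  set η := min (ε / 2) (1 / 2) with hη
  have hη0 : 0 < η := lt_min (by positivity) (by norm_num)
  have e1 : η ≤ ε / 2 := min_le_left _ _
  have e2 : η ≤ 1 / 2 := min_le_right _ _
  obtain ⟨T1, hT1, H1⟩ := ut_lower hu h1 hd hη0 (by linarith)
  obtain ⟨T2, hT2, H2⟩ := ut_upper hu h1 hM hd hη0
  refine ⟨max T1 T2, lt_max_of_lt_left hT1, fun t ht x hx => ?_⟩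
  have a1 := H1 t ((le_max_left _ _).trans ht) x hx
  have a2 := H2 t ((le_max_right _ _).trans ht) x hx
  rw [abs_lt]; constructor <;> linarith

theorem uxx_lim (hu : IsGlobalSolB u u0) (h1 : ∀ x ∈ Set.Icc (-1 : ℝ) 1, 1 ≤ u0 x) {M0 : ℝ}
    (hM : ∀ x ∈ Set.Icc (-1 : ℝ) 1, u0 x ≤ M0) {d ε : ℝ} (hd : 0 < d) (hε : 0 < ε) :
    ∃ T > 0, ∀ t ≥ T, ∀ x, |x| ≤ 1 - d →
      |uxx u x t - π / 2 * (1 + Real.tan (π / 2 * x) ^ 2)| < ε := by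
  have hpi := Real.pi_gt_three
  obtain ⟨S, hS⟩ : ∃ S, ∀ x ∈ Set.Icc (-(1 - d)) (1 - d), |Real.tan (π / 2 * x)| ≤ S := by
    have hc : ContinuousOn (fun x => Real.tan (π / 2 * x)) (Set.Icc (-(1 - d)) (1 - d)) := by
      refine Real.continuousOn_tan_Ioo.comp (by fun_prop) (fun x hx => ⟨?_, ?_⟩)
      · nlinarith [hx.1]
      · nlinarith [hx.2]
    obtain ⟨S, hS⟩ := isCompact_Icc.exists_bound_of_continuousOn hc
    exact ⟨S, hS⟩
  set A := 1 + (S + 1) ^ 2 + π / 2 * (2 * |S| + 1) with hA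
  have hA0 : 0 < A := by positivity
  set δ := min 1 (ε / A) with hδ
  have hδ0 : 0 < δ := lt_min one_pos (by positivity)
  have hδ1 : δ ≤ 1 := min_le_left _ _
  have hδ2 : δ * A ≤ ε := by
    have : δ ≤ ε / A := min_le_right _ _
    rwa [le_div_iff₀ hA0] at this
  obtain ⟨T1, hT1, H1⟩ := ux_lim hu h1 hd hδ0
  obtain ⟨T2, hT2, H2⟩ := ut_lim hu h1 hM hd hδ0
  refine ⟨max T1 T2, lt_max_of_lt_left hT1, fun t ht x hx => ?_⟩
  have a1 := H1 t ((le_max_left _ _).trans ht) x hx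
  have a2 := H2 t ((le_max_right _ _).trans ht) x hx
  have hx' := abs_le.1 hx
  have ht0 : 0 < t := hT1.trans_le ((le_max_left _ _).trans ht)
  rw [ut_eq hu ht0 ⟨by linarith, by linarith⟩]
  have hST := hS x hx'
  set p := ux u x t
  set τ := Real.tan (π / 2 * x)
  have hp : |p| ≤ S + 1 := by
    have : |p| ≤ |p - τ| + |τ| := by simpa using abs_add_le (p - τ) τ
    linarith
  have hpτ : |p + τ| ≤ 2 * |S| + 1 := by
    have := abs_add_le p τ
    have := le_abs_self S
    linarith
  have hp2 : p ^ 2 ≤ (S + 1) ^ 2 := by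
    rw [← sq_abs p]; exact pow_le_pow_left₀ (abs_nonneg _) hp 2
  have hid : ut u x t * (1 + p ^ 2) - π / 2 * (1 + τ ^ 2) =
      (ut u x t - π / 2) * (1 + p ^ 2) + π / 2 * ((p - τ) * (p + τ)) := by ring
  have hb1 : |(ut u x t - π / 2) * (1 + p ^ 2)| < δ * (1 + (S + 1) ^ 2) := by
    rw [abs_mul, abs_of_pos (by positivity : 0 < 1 + p ^ 2)]
    exact mul_lt_mul a2 (by linarith) (by positivity) hδ0.le
  have hb2 : |π / 2 * ((p - τ) * (p + τ))| ≤ π / 2 * (δ * (2 * |S| + 1)) := by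
    rw [abs_mul, abs_mul, abs_of_pos (by positivity : 0 < π / 2)]
    exact mul_le_mul_of_nonneg_left (mul_le_mul a1.le hpτ (abs_nonneg _) hδ0.le) (by positivity)
  rw [hid]
  have hsum := abs_add_le ((ut u x t - π / 2) * (1 + p ^ 2)) (π / 2 * ((p - τ) * (p + τ)))
  have : δ * A = δ * (1 + (S + 1) ^ 2) + π / 2 * (δ * (2 * |S| + 1)) := by rw [hA]; ring
  linarith

theorem DD_lim (hu : IsGlobalSolB u u0) (h1 : ∀ x ∈ Set.Icc (-1 : ℝ) 1, 1 ≤ u0 x) {M0 : ℝ}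
    (hM : ∀ x ∈ Set.Icc (-1 : ℝ) 1, u0 x ≤ M0) {d ε : ℝ} (hd : 0 < d) (hε : 0 < ε) :
    ∃ T > 0, ∀ t ≥ T, ∀ s ≥ T, ∀ x, |x| ≤ 1 - d →
      |DD u (π / 2) 0 0 x t - DD u (π / 2) 0 0 0 s| ≤ ε * (1 + |t - s|) := by
  have hpi := Real.pi_gt_three
  obtain ⟨T1, hT1, H1⟩ := ux_lim hu h1 hd hε
  obtain ⟨T2, hT2, H2⟩ := ut_lim hu h1 hM hd hε
  refine ⟨max T1 T2, lt_max_of_lt_left hT1, fun t ht s hs x hx => ?_⟩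
  have hd1 : 0 ≤ 1 - d := (abs_nonneg x).trans hx
  have hxI := abs_le.1 hx
  have hk : 0 < π / 2 := by positivity
  have A1 : ‖DD u (π / 2) 0 0 x t - DD u (π / 2) 0 0 0 t‖ ≤ ε * ‖x - 0‖ := by
    refine Convex.norm_image_sub_le_of_norm_hasDerivWithin_le
      (f := fun y => DD u (π / 2) 0 0 y t) (s := Set.Icc (-(1 - d)) (1 - d))
      (f' := fun y => ux u y t - Real.tan (π / 2 * y + 0)) ?_ ?_ (convex_Icc _ _)
      ⟨by linarith, hd1⟩ hxI
    · intro y hy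
      refine (DD_x hu 0 hk (hT1.trans_le ((le_max_left _ _).trans ht))
        ⟨by linarith [hy.1], by linarith [hy.2]⟩ ?_).hasDerivWithinAt
      refine (Real.cos_pos_of_mem_Ioo ⟨?_, ?_⟩).ne'
      · nlinarith [hy.1]
      · nlinarith [hy.2]
    · intro y hy
      rw [add_zero]
      exact (H1 t ((le_max_left _ _).trans ht) y (abs_le.2 hy)).le
  have A2 : ‖DD u (π / 2) 0 0 0 t - DD u (π / 2) 0 0 0 s‖ ≤ ε * ‖t - s‖ := by
    refine Convex.norm_image_sub_le_of_norm_hasDerivWithin_le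
      (f := fun y => DD u (π / 2) 0 0 0 y) (s := Set.Ici (max T1 T2))
      (f' := fun y => ut u 0 y - π / 2) ?_ ?_ (convex_Ici _) hs ht
    · intro y hy
      exact (DD_t hu (hT1.trans_le ((le_max_left _ _).trans hy))
        ⟨by norm_num, by norm_num⟩).hasDerivWithinAt
    · intro y hy
      exact (H2 y ((le_max_right _ _).trans hy) 0 (by simpa using hd1)).le
  rw [Real.norm_eq_abs, Real.norm_eq_abs] at A1 A2
  rw [sub_zero] at A1
  have h3 := abs_sub_le (DD u (π / 2) 0 0 x t) (DD u (π / 2) 0 0 0 t) (DD u (π / 2) 0 0 0 s)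
  have h4 : ε * |x| ≤ ε * 1 := mul_le_mul_of_nonneg_left (by linarith) hε.le
  linarith
end

theorem box_of_compact {K : Set (ℝ × ℝ)} (hK : IsCompact K)
    (hs : K ⊆ Set.Ioo (-1 : ℝ) 1 ×ˢ (Set.univ : Set ℝ)) :
    ∃ d > 0, ∃ R > 0, ∀ p ∈ K, |p.1| ≤ 1 - d ∧ |p.2| ≤ R := by
  rcases K.eq_empty_or_nonempty with rfl | hne
  · exact ⟨1, one_pos, 1, one_pos, fun p hp => absurd hp (Set.notMem_empty p)⟩
  obtain ⟨p0, hp0, hmax⟩ := hK.exists_isMaxOn hne (f := fun p : ℝ × ℝ => |p.1|) (by fun_prop)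
  obtain ⟨q0, hq0, hmax2⟩ := hK.exists_isMaxOn hne (f := fun p : ℝ × ℝ => |p.2|) (by fun_prop)
  have h1 : |p0.1| < 1 := abs_lt.2 (hs hp0).1
  refine ⟨1 - |p0.1|, by linarith, |q0.2| + 1, by positivity, fun p hp => ⟨?_, ?_⟩⟩
  · have : |p.1| ≤ |p0.1| := hmax hp
    linarith
  · have : |p.2| ≤ |q0.2| := hmax2 hp
    linarith

/-- convergence of symmetric solutions to the grim reaper.
With `u0` even, `1 ≤ u0 ≤ M0`, `0 < u0' < tan(πx/2)` on `(0,1)` and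
`u0'(1) = u0(1)`, as `s → ∞`, `u(x,t+s) − u(0,s) → φ0(x) + (π/2)t` uniformly
together with its first and second `x`-derivatives and first `t`-derivative on
every compact subset of `(-1,1) × ℝ`, where `φ0(x) = -(2/π)·ln(cos(πx/2))`
(so `φ0'(x) = tan(πx/2)` and `φ0''(x) = (π/2)(1 + tan²(πx/2))`). -/
theorem stmt_13 (M0 : ℝ) (hM0 : 0 < M0) (u0 : ℝ → ℝ)
    (hu0C1 : ContDiffOn ℝ 1 u0 (Set.Icc (-1 : ℝ) 1))
    (heven : ∀ x ∈ Set.Icc (-1 : ℝ) 1, u0 x = u0 (-x))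
    (hbounds : ∀ x ∈ Set.Icc (-1 : ℝ) 1, 1 ≤ u0 x ∧ u0 x ≤ M0)
    (hslope : ∀ x ∈ Set.Ioo (0 : ℝ) 1,
      0 < derivWithin u0 (Set.Icc (-1 : ℝ) 1) x ∧
      derivWithin u0 (Set.Icc (-1 : ℝ) 1) x < Real.tan (π * x / 2))
    (hend : derivWithin u0 (Set.Icc (-1 : ℝ) 1) 1 = u0 1)
    (u : ℝ → ℝ → ℝ) (hu : IsGlobalSolB u u0)
    (φ0 : ℝ → ℝ) (hφ0 : ∀ x : ℝ, φ0 x = -(2 / π) * Real.log (Real.cos (π * x / 2))) :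
    ∀ K : Set (ℝ × ℝ), IsCompact K → K ⊆ Set.Ioo (-1 : ℝ) 1 ×ˢ (Set.univ : Set ℝ) →
      TendstoUniformlyOn (fun s (p : ℝ × ℝ) => u p.1 (p.2 + s) - u 0 s)
        (fun p => φ0 p.1 + (π / 2) * p.2) Filter.atTop K ∧
      TendstoUniformlyOn (fun s (p : ℝ × ℝ) => ux u p.1 (p.2 + s))
        (fun p => Real.tan (π * p.1 / 2)) Filter.atTop K ∧
      TendstoUniformlyOn (fun s (p : ℝ × ℝ) => uxx u p.1 (p.2 + s))
        (fun p => (π / 2) * (1 + Real.tan (π * p.1 / 2) ^ 2)) Filter.atTop K ∧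
      TendstoUniformlyOn (fun s (p : ℝ × ℝ) => ut u p.1 (p.2 + s))
        (fun _ => π / 2) Filter.atTop K := by
  intro K hK hKs
  obtain ⟨d, hd, R, hR, hbox⟩ := box_of_compact hK hKs
  have h1 : ∀ x ∈ Set.Icc (-1 : ℝ) 1, 1 ≤ u0 x := fun x hx => (hbounds x hx).1
  have hM : ∀ x ∈ Set.Icc (-1 : ℝ) 1, u0 x ≤ M0 := fun x hx => (hbounds x hx).2
  have harg : ∀ x : ℝ, π * x / 2 = π / 2 * x := fun x => by ring
  have htime : ∀ T s : ℝ, T + R ≤ s → ∀ p ∈ K, T ≤ p.2 + s := by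
    intro T s hs p hp
    have := (abs_le.1 (hbox p hp).2).1
    linarith
  refine ⟨?_, ?_, ?_, ?_⟩
  · rw [Metric.tendstoUniformlyOn_iff]
    intro ε hε
    have hδ : 0 < ε / (2 * (1 + R)) := by positivity
    obtain ⟨T, hT, H⟩ := DD_lim hu h1 hM hd hδ
    filter_upwards [Filter.eventually_ge_atTop (T + R)] with s hs p hp
    have h2 := H (p.2 + s) (htime T s hs p hp) s (by linarith) p.1 (hbox p hp).1
    rw [add_sub_cancel_right] at h2
    have h3 : ε / (2 * (1 + R)) * (1 + |p.2|) ≤ ε / (2 * (1 + R)) * (1 + R) :=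
      mul_le_mul_of_nonneg_left (by linarith [(hbox p hp).2]) hδ.le
    have h4 : ε / (2 * (1 + R)) * (1 + R) = ε / 2 := by field_simp
    have hgr : gr (π / 2) 0 p.1 = φ0 p.1 := by
      rw [hφ0, harg]; unfold gr
      rw [add_zero, one_div_div]
    have hgr0 : gr (π / 2) 0 0 = 0 := by simp [gr]
    have h5 : DD u (π / 2) 0 0 p.1 (p.2 + s) - DD u (π / 2) 0 0 0 s =
        (u p.1 (p.2 + s) - u 0 s) - (φ0 p.1 + π / 2 * p.2) := by
      unfold DD; rw [hgr, hgr0]; ring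
    rw [h5] at h2
    rw [dist_comm, Real.dist_eq]
    linarith
  · rw [Metric.tendstoUniformlyOn_iff]
    intro ε hε
    obtain ⟨T, hT, H⟩ := ux_lim hu h1 hd hε
    filter_upwards [Filter.eventually_ge_atTop (T + R)] with s hs p hp
    rw [dist_comm, Real.dist_eq, harg]
    exact H (p.2 + s) (htime T s hs p hp) p.1 (hbox p hp).1
  · rw [Metric.tendstoUniformlyOn_iff]
    intro ε hε
    obtain ⟨T, hT, H⟩ := uxx_lim hu h1 hM hd hε
    filter_upwards [Filter.eventually_ge_atTop (T + R)] with s hs p hp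
    rw [dist_comm, Real.dist_eq, harg]
    exact H (p.2 + s) (htime T s hs p hp) p.1 (hbox p hp).1
  · rw [Metric.tendstoUniformlyOn_iff]
    intro ε hε
    obtain ⟨T, hT, H⟩ := ut_lim hu h1 hM hd hε
    filter_upwards [Filter.eventually_ge_atTop (T + R)] with s hs p hp
    rw [dist_comm, Real.dist_eq]
    exact H (p.2 + s) (htime T s hs p hp) p.1 (hbox p hp).1
end

section
/- Let u be a time-global classical solution of problem (B) with initial data u0 ∈ C^1([-1,1]) satisfying u0(x) ≥ 1 on [-1,1] and u0'(±1) = ±u0(±1). Then for every ε ∈ (0,1/2) there exist T_ε > 0 and M2 > 0 such that |u_x(x,t)| ≤ M2 for all x ∈ (-1+2ε, 1-2ε) and all t > T_ε. -/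
open Real

/-- Second derivative test (necessary condition). -/
lemma second_deriv_test {g g' : ℝ → ℝ} {g'' x : ℝ}
    (h1 : ∀ᶠ y in nhds x, HasDerivAt g (g' y) y) (h2 : HasDerivAt g' g'' x)
    (hm : IsLocalMax g x) : g' x = 0 ∧ g'' ≤ 0 := by
  have h0 : g' x = 0 := hm.hasDerivAt_eq_zero h1.self_of_nhds
  refine ⟨h0, ?_⟩
  by_contra hpos
  push Not at hpos
  have hd : deriv g =ᶠ[nhds x] g' := h1.mono fun y hy => hy.deriv
  have hdd : deriv (deriv g) x = g'' := by rw [hd.deriv_eq]; exact h2.deriv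
  have hmin : IsLocalMin g x := by
    apply isLocalMin_of_deriv_deriv_pos
    · rw [hdd]; exact hpos
    · rw [hd.self_of_nhds]; exact h0
    · exact h1.self_of_nhds.continuousAt
  have hc : g =ᶠ[nhds x] fun _ => g x := by
    filter_upwards [hm, hmin] with y hy1 hy2
    exact le_antisymm hy1 hy2
  have hc1 : deriv g =ᶠ[nhds x] fun _ => 0 := by
    filter_upwards [hc.eventuallyEq_nhds] with y hy
    rw [hy.deriv_eq]; simp
  have : deriv (deriv g) x = 0 := by rw [hc1.deriv_eq]; simp
  linarith

/-- One-sided first derivative test, max over an interval on the left. -/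
lemma deriv_left_max {g : ℝ → ℝ} {g' a b : ℝ} (hab : a < b) (h : HasDerivAt g g' b)
    (hm : ∀ s ∈ Set.Icc a b, g s ≤ g b) : 0 ≤ g' := by
  have h2 : HasDerivWithinAt g g' (Set.Iio b) b := h.hasDerivWithinAt
  rw [hasDerivWithinAt_iff_tendsto_slope' (by simp)] at h2
  refine ge_of_tendsto h2 ?_
  filter_upwards [Ioo_mem_nhdsLT hab] with s hs
  rw [slope_def_field]
  have := hm s ⟨hs.1.le, hs.2.le⟩
  exact div_nonneg_of_nonpos (by linarith) (by linarith [hs.2])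

lemma deriv_right_max {g : ℝ → ℝ} {g' a b : ℝ} (hab : a < b) (h : HasDerivAt g g' a)
    (hm : ∀ s ∈ Set.Icc a b, g s ≤ g a) : g' ≤ 0 := by
  have h2 : HasDerivWithinAt g g' (Set.Ioi a) a := h.hasDerivWithinAt
  rw [hasDerivWithinAt_iff_tendsto_slope' (by simp)] at h2
  refine le_of_tendsto h2 ?_
  filter_upwards [Ioo_mem_nhdsGT hab] with s hs
  rw [slope_def_field]
  have := hm s ⟨hs.1.le, hs.2.le⟩
  exact div_nonpos_of_nonpos_of_nonneg (by linarith) (by linarith [hs.1])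

lemma sol_pos {u : ℝ → ℝ → ℝ} {u0 : ℝ → ℝ} (hu : IsGlobalSolB u u0)
    (hu0ge : ∀ x ∈ Set.Icc (-1 : ℝ) 1, 1 ≤ u0 x) :
    ∀ x ∈ Set.Icc (-1 : ℝ) 1, ∀ t ≥ (0 : ℝ), 1 / 2 < u x t := by
  obtain ⟨hc, -, hpde, hbc, hin⟩ := hu
  intro x hx t ht
  by_contra hcon
  push Not at hcon
  have hboxc : IsCompact (Set.Icc (-1 : ℝ) 1 ×ˢ Set.Icc (0 : ℝ) t) := isCompact_Icc.prod isCompact_Icc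
  have hsub : Set.Icc (-1 : ℝ) 1 ×ˢ Set.Icc (0 : ℝ) t ⊆ Set.Icc (-1 : ℝ) 1 ×ˢ Set.Ici (0 : ℝ) :=
    Set.prod_mono le_rfl Set.Icc_subset_Ici_self
  have hKc : IsCompact ((Set.Icc (-1 : ℝ) 1 ×ˢ Set.Icc (0 : ℝ) t) ∩
      (fun p : ℝ × ℝ => u p.1 p.2) ⁻¹' Set.Iic (1 / 2)) :=
    hboxc.of_isClosed_subset
      ((hc.mono hsub).preimage_isClosed_of_isClosed hboxc.isClosed isClosed_Iic)
      Set.inter_subset_left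
  obtain ⟨⟨x0, t0⟩, ⟨⟨hx0, ht0⟩, hle⟩, hmin⟩ := hKc.exists_isMinOn ⟨(x, t), ⟨⟨hx, ht, le_rfl⟩, hcon⟩⟩
    continuous_snd.continuousOn
  simp only [Set.mem_preimage, Set.mem_Iic] at hle hx0 ht0
  have hbefore : ∀ y ∈ Set.Icc (-1 : ℝ) 1, ∀ s, 0 ≤ s → s < t0 → 1 / 2 < u y s := by
    intro y hy s hs hst
    by_contra hh
    push Not at hh
    have := hmin (show (y, s) ∈ _ from ⟨⟨hy, hs, by linarith [ht0.2]⟩, hh⟩)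
    simp only [Set.mem_ofPred_eq] at this
    linarith
  have hct : ∀ y ∈ Set.Icc (-1 : ℝ) 1, ContinuousOn (fun s => u y s) (Set.Icc 0 t0) := by
    intro y hy
    exact hc.comp (f := fun s => (y, s)) (by fun_prop) (fun s hs => ⟨hy, hs.1⟩)
  have hall : ∀ y ∈ Set.Icc (-1 : ℝ) 1, ∀ s ∈ Set.Icc 0 t0, 1 / 2 ≤ u y s := by
    intro y hy s hs
    rcases hs.2.lt_or_eq with h | rfl
    · exact (hbefore y hy s hs.1 h).le
    · by_contra hh
      push Not at hh
      have h0 : 1 ≤ u y 0 := by rw [hin y hy]; exact hu0ge y hy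
      obtain ⟨r, hr, hr2⟩ := intermediate_value_Icc' hs.1 (hct y hy) (show (1/2:ℝ) ∈ _ from ⟨hh.le, by linarith⟩)
      simp only at hr2
      rcases hr.2.lt_or_eq with h | rfl
      · linarith [hbefore y hy r hr.1 h]
      · linarith
  have ht0pos : 0 < t0 := by
    rcases ht0.1.lt_or_eq with h | h
    · exact h
    · rw [← h, hin x0 hx0] at hle
      linarith [hu0ge x0 hx0]
  set δ : ℝ := 1 / (4 * t0) with hδ
  have hδ0 : 0 < δ := by positivity
  have hδt : δ * t0 = 1 / 4 := by rw [hδ]; field_simp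
  have hcc : ContinuousOn (fun p : ℝ × ℝ => u p.1 p.2 + δ * p.2) (Set.Icc (-1 : ℝ) 1 ×ˢ Set.Icc (0 : ℝ) t0) :=
    (hc.mono (Set.prod_mono le_rfl Set.Icc_subset_Ici_self)).add (by fun_prop)
  obtain ⟨⟨x1, t1⟩, ⟨hx1, ht1⟩, hmin1⟩ := (isCompact_Icc.prod isCompact_Icc).exists_isMinOn
    ⟨(x0, t0), ⟨hx0, ht0.1, le_rfl⟩⟩ hcc
  simp only at hx1 ht1
  have hm : ∀ y ∈ Set.Icc (-1 : ℝ) 1, ∀ s ∈ Set.Icc 0 t0, u x1 t1 + δ * t1 ≤ u y s + δ * s := by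
    intro y hy s hs
    exact hmin1 (show (y, s) ∈ _ from ⟨hy, hs⟩)
  have hfin := hm x0 hx0 t0 ⟨ht0.1, le_rfl⟩
  have hu1 := hall x1 hx1 t1 ht1
  rcases ht1.1.lt_or_eq with h1 | h1
  swap
  · rw [← h1, hin x1 hx1] at hfin
    linarith [hu0ge x1 hx1]
  obtain ⟨hb1, hb2⟩ := hbc t1 h1
  rcases hx1.1.lt_or_eq with h2 | h2
  swap
  · subst h2
    have hd : DifferentiableAt ℝ (fun y => u y t1) (-1) := by
      apply differentiableAt_of_deriv_ne_zero
      change ux u (-1) t1 ≠ 0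
      rw [hb2]; linarith
    have := deriv_right_max (g := fun y => - u y t1) (a := -1) (b := 1) (by norm_num) hd.hasDerivAt.neg
      (fun s hs => by have := hm s hs t1 ht1; linarith)
    change -ux u (-1) t1 ≤ 0 at this
    linarith
  rcases hx1.2.lt_or_eq with h3 | h3
  swap
  · subst h3
    have hd : DifferentiableAt ℝ (fun y => u y t1) 1 := by
      apply differentiableAt_of_deriv_ne_zero
      change ux u 1 t1 ≠ 0
      rw [hb1]; linarith
    have := deriv_left_max (g := fun y => - u y t1) (a := -1) (b := 1) (by norm_num) hd.hasDerivAt.neg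
      (fun s hs => by have := hm s hs t1 ht1; linarith)
    change 0 ≤ -ux u 1 t1 at this
    linarith
  obtain ⟨d1, d2, d3, heq⟩ := hpde t1 h1 x1 ⟨h2, h3⟩
  have hst := second_deriv_test (g := fun y => - u y t1) (g' := fun y => - ux u y t1) (x := x1)
    (g'' := - uxx u x1 t1)
    (by
      filter_upwards [Ioo_mem_nhds h2 h3] with y hy
      exact (hpde t1 h1 y hy).1.hasDerivAt.neg)
    d2.hasDerivAt.neg
    (by
      filter_upwards [Ioo_mem_nhds h2 h3] with y hy
      have := hm y ⟨hy.1.le, hy.2.le⟩ t1 ht1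
      linarith)
  have htd := deriv_left_max (g := fun s => - u x1 s - δ * s) (a := 0) (b := t1) h1
    (d3.hasDerivAt.neg.sub ((hasDerivAt_id t1).const_mul δ))
    (fun s hs => by have := hm x1 hx1 s ⟨hs.1, hs.2.trans ht1.2⟩; linarith)
  change 0 ≤ -ut u x1 t1 - δ * 1 at htd
  have : 0 ≤ ut u x1 t1 := by rw [heq]; exact div_nonneg (by linarith [hst.2]) (by positivity)
  linarith

lemma upper_bound_s17 {u : ℝ → ℝ → ℝ} {u0 : ℝ → ℝ} (hu : IsGlobalSolB u u0)
    (hu0ge : ∀ x ∈ Set.Icc (-1 : ℝ) 1, 1 ≤ u0 x)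
    {M : ℝ} (hM0 : 0 ≤ M)
    (hM : ∀ x ∈ Set.Icc (-1 : ℝ) 1, ∀ y ∈ Set.Icc (-1 : ℝ) 1, y ≤ x → u0 x - u0 y ≤ M * (x - y)) :
    ∃ c > 0, c < π / 2 ∧ ∀ x ∈ Set.Ioo (-1 : ℝ) 1, ∀ t > (0 : ℝ), ux u x t ≤ tan (π / 2 - c * (1 - x)) := by
  have hpos := sol_pos hu hu0ge
  obtain ⟨hc, -, hpde, hbc, hin⟩ := hu
  have hMlt := arctan_lt_pi_div_two M
  have hMge : 0 ≤ arctan M := arctan_nonneg.2 hM0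
  set c : ℝ := (π / 2 - arctan M) / 3 with hcdef
  have hc0 : 0 < c := by rw [hcdef]; linarith
  refine ⟨c, hc0, by rw [hcdef]; linarith [pi_pos], ?_⟩
  intro X hX T hT
  -- bound for `u 1 t`
  have hsubT : Set.Icc (-1 : ℝ) 1 ×ˢ Set.Icc (0 : ℝ) T ⊆ Set.Icc (-1 : ℝ) 1 ×ˢ Set.Ici (0 : ℝ) :=
    Set.prod_mono le_rfl Set.Icc_subset_Ici_self
  obtain ⟨B, hB⟩ := (isCompact_Icc.prod isCompact_Icc).bddAbove_image (hc.mono hsubT)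
  have hB' : ∀ t ∈ Set.Icc 0 T, u 1 t ≤ B := fun t ht =>
    hB ⟨(1, t), ⟨⟨by norm_num, le_rfl⟩, ht⟩, rfl⟩
  set β : ℝ := max (arctan (B + 1)) (π / 2 - c) with hβ
  have hβlt : β < π / 2 := max_lt (arctan_lt_pi_div_two _) (by linarith)
  have hβB : arctan (B + 1) ≤ β := le_max_left _ _
  have hβc : π / 2 - c ≤ β := le_max_right _ _
  set θ : ℝ → ℝ := fun x => β - c * (1 - x) with hθ
  have hθlo : ∀ x ∈ Set.Icc (-1 : ℝ) 1, arctan M ≤ θ x := by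
    intro x hx
    have : c * (1 - x) ≤ c * 2 := by apply mul_le_mul_of_nonneg_left _ hc0.le; linarith [hx.1]
    have h3 : 3 * c = π / 2 - arctan M := by rw [hcdef]; ring
    simp only [hθ]; linarith
  have hθhi : ∀ x ∈ Set.Icc (-1 : ℝ) 1, θ x < π / 2 := by
    intro x hx
    have : 0 ≤ c * (1 - x) := mul_nonneg hc0.le (by linarith [hx.2])
    simp only [hθ]; linarith
  have hcos : ∀ x ∈ Set.Icc (-1 : ℝ) 1, 0 < cos (θ x) := fun x hx =>
    cos_pos_of_mem_Ioo ⟨by linarith [hθlo x hx, pi_pos], hθhi x hx⟩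
  have htanM : ∀ x ∈ Set.Icc (-1 : ℝ) 1, M ≤ tan (θ x) := by
    intro x hx
    rw [← tan_arctan M]
    exact strictMonoOn_tan.monotoneOn ⟨neg_pi_div_two_lt_arctan M, hMlt⟩
      ⟨by linarith [hθlo x hx, pi_pos], hθhi x hx⟩ (hθlo x hx)
  have htan1 : B + 1 ≤ tan (θ 1) := by
    have h1 : θ 1 = β := by simp [hθ]
    rw [← tan_arctan (B + 1), h1]
    exact strictMonoOn_tan.monotoneOn ⟨neg_pi_div_two_lt_arctan _, arctan_lt_pi_div_two _⟩
      ⟨by linarith [neg_pi_div_two_lt_arctan (B + 1)], hβlt⟩ hβB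
  have hθd : ∀ x, HasDerivAt θ c x := by
    intro x
    have := (((hasDerivAt_id x).const_sub 1).const_mul c).const_sub β
    simpa [hθ] using this
  set F : ℝ → ℝ := fun x => - log (cos (θ x)) / c with hF
  have hFd : ∀ x ∈ Set.Icc (-1 : ℝ) 1, HasDerivAt F (tan (θ x)) x := by
    intro x hx
    have := (((hθd x).cos.log (hcos x hx).ne').neg).div_const c
    refine HasDerivAt.congr_deriv this ?_
    rw [tan_eq_sin_div_cos]
    have := (hcos x hx).ne'
    field_simp
  have hFdd : ∀ x ∈ Set.Icc (-1 : ℝ) 1, HasDerivAt (fun y => tan (θ y)) (c * (1 + tan (θ x) ^ 2)) x := by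
    intro x hx
    have := (hasDerivAt_tan (hcos x hx).ne').comp x (hθd x)
    refine HasDerivAt.congr_deriv this ?_
    rw [← inv_one_add_tan_sq (hcos x hx).ne']
    field_simp
  have hFc : ContinuousOn F (Set.Icc (-1) 1) := fun x hx => (hFd x hx).continuousAt.continuousWithinAt
  have hFM : ∀ x ∈ Set.Icc (-1 : ℝ) 1, ∀ y ∈ Set.Icc (-1 : ℝ) 1, y ≤ x → M * (x - y) ≤ F x - F y := by
    intro x hx y hy hyx
    apply (convex_Icc (-1 : ℝ) 1).mul_sub_le_image_sub_of_le_deriv hFc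
      (fun z hz => (hFd z (interior_subset hz)).differentiableAt.differentiableWithinAt)
      (fun z hz => by rw [(hFd z (interior_subset hz)).deriv]; exact htanM z (interior_subset hz))
      y hy x hx hyx
  have key : ∀ δ > 0, ∀ x ∈ Set.Icc (-1 : ℝ) 1, ∀ y ∈ Set.Icc (-1 : ℝ) 1, y ≤ x →
      u x T - u y T - F x + F y - δ * T ≤ 0 := by
    intro δ hδ x hx y hy hyx
    by_contra hcon
    push Not at hcon
    set D : Set (ℝ × ℝ × ℝ) := (Set.Icc (-1 : ℝ) 1 ×ˢ (Set.Icc (-1 : ℝ) 1 ×ˢ Set.Icc (0 : ℝ) T)) ∩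
      {p | p.2.1 ≤ p.1} with hD
    have hDc : IsCompact D :=
      (isCompact_Icc.prod (isCompact_Icc.prod isCompact_Icc)).inter_right
        (isClosed_le (by fun_prop) (by fun_prop))
    have hZc : ContinuousOn (fun p : ℝ × ℝ × ℝ => u p.1 p.2.2 - u p.2.1 p.2.2 - F p.1 + F p.2.1 - δ * p.2.2) D := by
      have e1 : ContinuousOn (fun p : ℝ × ℝ × ℝ => u p.1 p.2.2) D :=
        hc.comp (f := fun p : ℝ × ℝ × ℝ => (p.1, p.2.2)) (by fun_prop)
          (fun p hp => ⟨hp.1.1, hp.1.2.2.1⟩)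
      have e2 : ContinuousOn (fun p : ℝ × ℝ × ℝ => u p.2.1 p.2.2) D :=
        hc.comp (f := fun p : ℝ × ℝ × ℝ => (p.2.1, p.2.2)) (by fun_prop)
          (fun p hp => ⟨hp.1.2.1, hp.1.2.2.1⟩)
      have e3 : ContinuousOn (fun p : ℝ × ℝ × ℝ => F p.1) D :=
        hFc.comp (f := fun p : ℝ × ℝ × ℝ => p.1) (by fun_prop) (fun p hp => hp.1.1)
      have e4 : ContinuousOn (fun p : ℝ × ℝ × ℝ => F p.2.1) D :=
        hFc.comp (f := fun p : ℝ × ℝ × ℝ => p.2.1) (by fun_prop) (fun p hp => hp.1.2.1)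
      exact (((e1.sub e2).sub e3).add e4).sub (by fun_prop)
    obtain ⟨⟨a, b, t⟩, ⟨⟨ha, hb, ht⟩, hba⟩, hmax⟩ := hDc.exists_isMaxOn
      ⟨(x, y, T), ⟨⟨hx, hy, hT.le, le_rfl⟩, hyx⟩⟩ hZc
    simp only [Set.mem_ofPred_eq] at ha hb ht hba
    have hm : ∀ x' ∈ Set.Icc (-1 : ℝ) 1, ∀ y' ∈ Set.Icc (-1 : ℝ) 1, ∀ s ∈ Set.Icc 0 T, y' ≤ x' →
        u x' s - u y' s - F x' + F y' - δ * s ≤ u a t - u b t - F a + F b - δ * t := by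
      intro x' hx' y' hy' s hs h
      exact hmax (show (x', y', s) ∈ D from ⟨⟨hx', hy', hs⟩, h⟩)
    have hZ : 0 < u a t - u b t - F a + F b - δ * t :=
      lt_of_lt_of_le hcon (hm x hx y hy T ⟨hT.le, le_rfl⟩ hyx)
    have htδ : 0 ≤ δ * t := mul_nonneg hδ.le ht.1
    rcases ht.1.lt_or_eq with h1 | h1
    swap
    · rw [← h1, hin a ha, hin b hb] at hZ
      linarith [hM a ha b hb hba, hFM a ha b hb hba]
    have hba' : b < a := by
      rcases hba.lt_or_eq with h | h
      · exact h
      · rw [h] at hZ; linarith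
    obtain ⟨hb1, hb2⟩ := hbc t h1
    rcases ha.2.lt_or_eq with ha1 | ha1
    swap
    · subst ha1
      have hd : DifferentiableAt ℝ (fun y => u y t) 1 := by
        apply differentiableAt_of_deriv_ne_zero
        change ux u 1 t ≠ 0
        rw [hb1]; linarith [hpos 1 ha t h1.le]
      have := deriv_left_max (g := fun y => u y t - F y) (a := b) (b := 1) hba'
        (hd.hasDerivAt.sub (hFd 1 ha))
        (fun s hs => by have := hm s ⟨hb.1.trans hs.1, hs.2⟩ b hb t ht hs.1; linarith)
      change 0 ≤ ux u 1 t - tan (θ 1) at this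
      linarith [hB' t ht]
    rcases hb.1.lt_or_eq with hb3 | hb3
    swap
    · subst hb3
      have hd : DifferentiableAt ℝ (fun y => u y t) (-1) := by
        apply differentiableAt_of_deriv_ne_zero
        change ux u (-1) t ≠ 0
        rw [hb2]; linarith [hpos (-1) hb t h1.le]
      have := deriv_right_max (g := fun y => F y - u y t) (a := -1) (b := a) hba'
        ((hFd (-1) hb).sub hd.hasDerivAt)
        (fun s hs => by have := hm a ha s ⟨hs.1, hs.2.trans ha.2⟩ t ht hs.2; linarith)
      change tan (θ (-1)) - ux u (-1) t ≤ 0 at this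
      linarith [htanM (-1) hb, hpos (-1) hb t h1.le]
    have ha0 : -1 < a := lt_trans hb3 hba'
    have hb0 : b < 1 := lt_trans hba' ha1
    obtain ⟨d1, d2, d3, heqa⟩ := hpde t h1 a ⟨ha0, ha1⟩
    obtain ⟨f1, f2, f3, heqb⟩ := hpde t h1 b ⟨hb3, hb0⟩
    have hsa := second_deriv_test (g := fun y => u y t - F y) (g' := fun y => ux u y t - tan (θ y)) (x := a)
      (g'' := uxx u a t - c * (1 + tan (θ a) ^ 2))
      (by
        filter_upwards [Ioo_mem_nhds ha0 ha1] with y hy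
        exact (hpde t h1 y hy).1.hasDerivAt.sub (hFd y ⟨hy.1.le, hy.2.le⟩))
      (d2.hasDerivAt.sub (hFdd a ha))
      (by
        filter_upwards [Ioo_mem_nhds hba' ha1] with y hy
        have := hm y ⟨hb.1.trans hy.1.le, hy.2.le⟩ b hb t ht hy.1.le
        linarith)
    have hsb := second_deriv_test (g := fun y => F y - u y t) (g' := fun y => tan (θ y) - ux u y t) (x := b)
      (g'' := c * (1 + tan (θ b) ^ 2) - uxx u b t)
      (by
        filter_upwards [Ioo_mem_nhds hb3 hb0] with y hy
        exact (hFd y ⟨hy.1.le, hy.2.le⟩).sub (hpde t h1 y hy).1.hasDerivAt)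
      ((hFdd b hb).sub f2.hasDerivAt)
      (by
        filter_upwards [Ioo_mem_nhds hb3 hba'] with y hy
        have := hm a ha y ⟨hy.1.le, hy.2.le.trans ha.2⟩ t ht hy.2.le
        linarith)
    have htd := deriv_left_max (g := fun s => u a s - u b s - δ * s) (a := 0) (b := t) h1
      ((d3.hasDerivAt.sub f3.hasDerivAt).sub ((hasDerivAt_id t).const_mul δ))
      (fun s hs => by have := hm a ha b hb s ⟨hs.1, hs.2.trans ht.2⟩ hba; linarith)
    change 0 ≤ ut u a t - ut u b t - δ * 1 at htd
    have ga : ut u a t ≤ c := by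
      rw [heqa, div_le_iff₀ (by positivity)]
      have : ux u a t = tan (θ a) := by linarith [hsa.1]
      rw [this]; linarith [hsa.2]
    have gb : c ≤ ut u b t := by
      rw [heqb, le_div_iff₀ (by positivity)]
      have : ux u b t = tan (θ b) := by linarith [hsb.1]
      rw [this]; linarith [hsb.2]
    linarith
  have key2 : ∀ x ∈ Set.Icc (-1 : ℝ) 1, X ≤ x → u x T - F x ≤ u X T - F X := by
    intro x hx hxX
    apply le_of_forall_pos_le_add
    intro e he
    have := key (e / T) (by positivity) x hx X ⟨hX.1.le, hX.2.le⟩ hxX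
    rw [div_mul_cancel₀ _ hT.ne'] at this
    linarith
  have hXI : X ∈ Set.Icc (-1 : ℝ) 1 := ⟨hX.1.le, hX.2.le⟩
  have hd := deriv_right_max (g := fun y => u y T - F y) (a := X) (b := 1) hX.2
    ((hpde T hT X hX).1.hasDerivAt.sub (hFd X hXI))
    (fun s hs => key2 s ⟨hX.1.le.trans hs.1, hs.2⟩ hs.1)
  change ux u X T - tan (θ X) ≤ 0 at hd
  have hlast : tan (θ X) ≤ tan (π / 2 - c * (1 - X)) := by
    have hp : 0 < c * (1 - X) := mul_pos hc0 (by linarith [hX.2])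
    have hle : θ X ≤ π / 2 - c * (1 - X) := by simp only [hθ]; linarith
    exact strictMonoOn_tan.monotoneOn
      ⟨by linarith [hθlo X hXI, pi_pos], hθhi X hXI⟩
      ⟨by linarith [hθlo X hXI, pi_pos], by linarith⟩ hle
  linarith

lemma ux_reflect (u : ℝ → ℝ → ℝ) (x t : ℝ) : ux (fun y s => u (-y) s) x t = - ux u (-x) t := by
  unfold ux
  exact deriv_comp_neg (fun y => u y t) x

lemma uxx_reflect (u : ℝ → ℝ → ℝ) (x t : ℝ) : uxx (fun y s => u (-y) s) x t = uxx u (-x) t := by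
  unfold uxx
  simp only [ux_reflect]
  rw [deriv_comp_neg (fun y => - ux u y t) x]
  simp

lemma sol_reflect {u : ℝ → ℝ → ℝ} {u0 : ℝ → ℝ} (hu : IsGlobalSolB u u0) :
    IsGlobalSolB (fun y s => u (-y) s) (fun y => u0 (-y)) := by
  obtain ⟨hc, hcx, hpde, hbc, hin⟩ := hu
  have hmaps : Set.MapsTo (fun p : ℝ × ℝ => (-p.1, p.2)) (Set.Icc (-1 : ℝ) 1 ×ˢ Set.Ici (0 : ℝ))
      (Set.Icc (-1 : ℝ) 1 ×ˢ Set.Ici (0 : ℝ)) := fun p hp =>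
    ⟨⟨by linarith [hp.1.2], by linarith [hp.1.1]⟩, hp.2⟩
  refine ⟨hc.comp (f := fun p : ℝ × ℝ => (-p.1, p.2)) (by fun_prop) hmaps, ?_, ?_, ?_, ?_⟩
  · simp only [ux_reflect]
    exact (hcx.comp (f := fun p : ℝ × ℝ => (-p.1, p.2)) (by fun_prop) hmaps).neg
  · intro t ht x hx
    obtain ⟨h1, h2, h3, h4⟩ := hpde t ht (-x) ⟨by linarith [hx.2], by linarith [hx.1]⟩
    refine ⟨h1.comp x differentiableAt_id.neg, ?_, h3, ?_⟩
    · simp only [ux_reflect]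
      exact (h2.comp x differentiableAt_id.neg).neg
    · rw [ux_reflect, uxx_reflect, neg_sq]
      exact h4
  · intro t ht
    obtain ⟨h1, h2⟩ := hbc t ht
    rw [ux_reflect, ux_reflect, neg_neg, h1, h2]
    simp
  · intro x hx
    exact hin (-x) ⟨by linarith [hx.2], by linarith [hx.1]⟩

/-- uniform interior gradient estimate. If `u` is a time-global
classical solution of (B) with `u0 ≥ 1` and `u0'(±1) = ±u0(±1)`, then for
every `ε ∈ (0,1/2)` there exist `T_ε > 0` and `M2 > 0` such that
`|u_x(x,t)| ≤ M2` for `x ∈ (-1+2ε, 1-2ε)` and `t > T_ε`. -/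
theorem stmt_17 (u0 : ℝ → ℝ)
    (hu0C1 : ContDiffOn ℝ 1 u0 (Set.Icc (-1 : ℝ) 1))
    (hu0ge : ∀ x ∈ Set.Icc (-1 : ℝ) 1, 1 ≤ u0 x)
    (hbcp : derivWithin u0 (Set.Icc (-1 : ℝ) 1) 1 = u0 1)
    (hbcm : derivWithin u0 (Set.Icc (-1 : ℝ) 1) (-1) = -u0 (-1))
    (u : ℝ → ℝ → ℝ) (hu : IsGlobalSolB u u0) :
    ∀ ε ∈ Set.Ioo (0 : ℝ) (1 / 2), ∃ Tε > (0 : ℝ), ∃ M2 > (0 : ℝ),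
      ∀ x ∈ Set.Ioo (-1 + 2 * ε) (1 - 2 * ε), ∀ t > Tε, |ux u x t| ≤ M2 := by
  intro ε hε
  obtain ⟨M, hM0, hM⟩ : ∃ M : ℝ, 0 ≤ M ∧ ∀ x ∈ Set.Icc (-1 : ℝ) 1, ∀ y ∈ Set.Icc (-1 : ℝ) 1,
      |u0 x - u0 y| ≤ M * |x - y| := by
    have hcd : ContinuousOn (derivWithin u0 (Set.Icc (-1 : ℝ) 1)) (Set.Icc (-1) 1) :=
      hu0C1.continuousOn_derivWithin (uniqueDiffOn_Icc (by norm_num)) le_rfl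
    obtain ⟨M, hM⟩ := isCompact_Icc.exists_bound_of_continuousOn hcd
    refine ⟨M, (norm_nonneg _).trans (hM 0 (by norm_num)), ?_⟩
    intro x hx y hy
    exact (convex_Icc (-1 : ℝ) 1).norm_image_sub_le_of_norm_derivWithin_le
      (hu0C1.differentiableOn (by norm_num)) hM hy hx
  have hneg : ∀ x ∈ Set.Icc (-1 : ℝ) 1, -x ∈ Set.Icc (-1 : ℝ) 1 := fun x hx =>
    ⟨by linarith [hx.2], by linarith [hx.1]⟩
  obtain ⟨c1, hc1, hc1', H1⟩ := upper_bound_s17 hu hu0ge hM0 (fun x hx y hy hyx => by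
    have := hM x hx y hy
    rw [abs_of_nonneg (sub_nonneg.2 hyx)] at this
    exact (le_abs_self _).trans this)
  obtain ⟨c2, hc2, hc2', H2⟩ := upper_bound_s17 (sol_reflect hu) (fun x hx => hu0ge _ (hneg x hx)) hM0
    (fun x hx y hy hyx => by
      have := hM _ (hneg x hx) _ (hneg y hy)
      rw [show -x - -y = -(x - y) by ring, abs_neg, abs_of_nonneg (sub_nonneg.2 hyx)] at this
      exact (le_abs_self _).trans this)
  have hmono : ∀ c, 0 < c → c < π / 2 → ∀ x ∈ Set.Ioo (-1 + 2 * ε) (1 - 2 * ε),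
      tan (π / 2 - c * (1 - x)) ≤ tan (π / 2 - c * (2 * ε)) := by
    intro c h0 h1 x hx
    have e1 : c * (2 * ε) ≤ c * (1 - x) := mul_le_mul_of_nonneg_left (by linarith [hx.2]) h0.le
    have e2 : 0 < c * (2 * ε) := mul_pos h0 (by linarith [hε.1])
    have e3 : c * (1 - x) < c * 2 := mul_lt_mul_of_pos_left (by linarith [hx.1, hε.1]) h0
    exact strictMonoOn_tan.monotoneOn ⟨by linarith, by linarith⟩ ⟨by linarith, by linarith⟩ (by linarith)
  refine ⟨1, one_pos, max 1 (max (tan (π / 2 - c1 * (2 * ε))) (tan (π / 2 - c2 * (2 * ε)))),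
    lt_of_lt_of_le one_pos (le_max_left _ _), ?_⟩
  intro x hx t ht
  have hx1 : x ∈ Set.Ioo (-1 : ℝ) 1 := ⟨by linarith [hx.1, hε.1], by linarith [hx.2, hε.1]⟩
  have hxn : -x ∈ Set.Ioo (-1 + 2 * ε) (1 - 2 * ε) := ⟨by linarith [hx.2], by linarith [hx.1]⟩
  have g1 := (H1 x hx1 t (by linarith)).trans (hmono c1 hc1 hc1' x hx)
  have g2 := (H2 (-x) ⟨by linarith [hx1.2], by linarith [hx1.1]⟩ t (by linarith)).trans
    (hmono c2 hc2 hc2' (-x) hxn)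
  rw [ux_reflect, neg_neg] at g2
  rw [abs_le']
  exact ⟨g1.trans ((le_max_left _ _).trans (le_max_right _ _)),
    g2.trans ((le_max_right _ _).trans (le_max_right _ _))⟩
end
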